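/- Let x, y be positive integers with gcd(x, y) = 1, let k, ℓ, m be non-negative integers and let n > 3 be a multiple of 3 such that x² + 2^k·11^ℓ·19^m = y^n. Then n ∈ {6, 12}; moreover, if n = 6 then (x, y, k, ℓ, m) ∈ {(5,3,6,1,0), (487,9,7,2,1), (117,5,4,2,0), (11,3,5,0,1)}, and if n = 12 then (x, y, k, ℓ, m) = (487,3,7,2,1). -/

import Mathlib

section Descent
open QuadraticAlgebra
open scoped QuadraticAlgebra

variable {a b : ℤ}

local notation "R" => QuadraticAlgebra ℤ a b

/-- `w` is parallel to `α` modulo `Y`. -/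
def Par (Y : ℤ) (α w : QuadraticAlgebra ℤ a b) : Prop :=
  Y ∣ α.re * w.im - α.im * w.re

lemma Par.lin {Y : ℤ} {α w v : QuadraticAlgebra ℤ a b} (hw : Par Y α w) (hv : Par Y α v) (k : ℤ) :
    Par Y α (w + k * v) := by
  obtain ⟨s, hs⟩ := hw
  obtain ⟨t, ht⟩ := hv
  refine ⟨s + k * t, ?_⟩
  simp
  linear_combination hs + k * ht

lemma intCast_mul_cancel {m : ℤ} (hm : m ≠ 0) {u v : QuadraticAlgebra ℤ a b}
    (h : (m : QuadraticAlgebra ℤ a b) * u = m * v) : u = v := by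
  have h1 := congrArg QuadraticAlgebra.re h
  have h2 := congrArg QuadraticAlgebra.im h
  simp at h1 h2
  ext
  · exact h1.resolve_right hm
  · exact h2.resolve_right hm

lemma mul_star_eq (w : QuadraticAlgebra ℤ a b) : w * star w = (w.norm : ℤ) :=
  (algebraMap_norm_eq_mul_star w).symm

lemma dvd_pow_of_par {Y : ℤ} {n : ℕ} (hn : n ≠ 0) {α w : QuadraticAlgebra ℤ a b} (hY : Y ≠ 0)
    (hα : α.norm = Y ^ n) (hc : IsCoprime α.im Y) (hw : Par Y α w) : α ∣ w ^ n := by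
  obtain ⟨p, q, hpq⟩ := hc.pow_right (n := n)
  -- `s` with `z * s ≡ x` modulo `Y ^ n`
  set s : ℤ := p * α.re with hs
  let θ : R := ⟨s, 1⟩
  have hθ : ∃ g : R, θ * star α = ((Y ^ n : ℤ) : R) * g := by
    refine ⟨(p : R) + ((q : ℤ) : R) * θ * star α - (p : R) * (q : R) * ((α.re : ℤ) : R) * star α , ?_⟩
    have h1 : ((α.im : ℤ) : R) * θ = α - (((Y ^ n : ℤ) : R)) * (q : R) * ((α.re : ℤ) : R) := by
      clear hα
      generalize Y ^ n = m at hpq ⊢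
      ext
      · simp [θ, hs]; linear_combination α.re * hpq
      · simp [θ]
    have h2 : (p : R) * ((α.im : ℤ) : R) + (q : R) * ((Y ^ n : ℤ) : R) = 1 := by
      have := congrArg (Int.cast : ℤ → R) hpq
      push_cast at this ⊢
      exact this
    have h3 : α * star α = ((Y ^ n : ℤ) : R) := by rw [mul_star_eq, hα]
    linear_combination (-(θ * star α)) * h2 + (p : R) * star α * h1 + (p : R) * h3
  obtain ⟨g, hg⟩ := hθ
  obtain ⟨t, ht⟩ : Y ∣ w.re - s * w.im := by
    obtain ⟨u, hu⟩ := hw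
    obtain ⟨r, hr⟩ := dvd_pow_self Y hn
    refine ⟨q * r * w.re - p * u, ?_⟩
    rw [hs]
    linear_combination (-w.re) * hpq - p * hu + q * w.re * hr
  have hwe : w = (w.im : R) * θ + ((Y * t : ℤ) : R) := by
    ext
    · simp [θ]; linear_combination ht
    · simp [θ]
  obtain ⟨d, hd⟩ := sub_dvd_pow_sub_pow w ((Y * t : ℤ) : R) n
  have hd2 : w ^ n = (w.im : R) * θ * d + ((Y ^ n : ℤ) : R) * (t : R) ^ n := by
    have : w - ((Y * t : ℤ) : R) = (w.im : R) * θ := by linear_combination hwe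
    rw [this] at hd
    push_cast at hd ⊢
    linear_combination hd
  refine ⟨(w.im : R) * d * g + (t : R) ^ n * star α, ?_⟩
  have h3 : α * star α = ((Y ^ n : ℤ) : R) := by rw [mul_star_eq, hα]
  apply intCast_mul_cancel (pow_ne_zero n hY)
  rw [hd2]
  linear_combination α * (w.im : R) * d * hg - ((w.im : R) * d * θ + (Y ^ n : ℤ) * (t : R) ^ n) * h3

/-- The polar form of the norm. -/
def polar (w v : QuadraticAlgebra ℤ a b) : ℤ :=
  2 * w.re * v.re + b * (w.re * v.im + w.im * v.re) - 2 * a * w.im * v.im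

lemma norm_pos_of_disc (hD : b ^ 2 + 4 * a < 0) {w : QuadraticAlgebra ℤ a b} (hw : w ≠ 0) :
    0 < w.norm := by
  have h4 : 4 * w.norm = (2 * w.re + b * w.im) ^ 2 - (b ^ 2 + 4 * a) * w.im ^ 2 := by
    rw [norm_def]; ring
  by_cases h : w.im = 0
  · have : w.re ≠ 0 := fun h' => hw (by ext <;> simp [h, h'])
    rw [h] at h4
    have : 0 < w.re ^ 2 := by positivity
    nlinarith
  · have : 0 < w.im ^ 2 := by positivity
    nlinarith [sq_nonneg (2 * w.re + b * w.im)]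

lemma exists_reduced_aux (hD : b ^ 2 + 4 * a < 0) {Y : ℤ} (hY : 0 < Y) (α : QuadraticAlgebra ℤ a b)
    (N : ℕ) : ∀ (w v : QuadraticAlgebra ℤ a b) (A B C : ℤ), A.toNat ≤ N → Par Y α w → Par Y α v →
      w.re * v.im - w.im * v.re = Y → w.norm = A * Y → polar w v = B * Y → v.norm = C * Y →
      ∃ (w v : QuadraticAlgebra ℤ a b) (A B C : ℤ), Par Y α w ∧ Par Y α v ∧
      w.re * v.im - w.im * v.re = Y ∧ w.norm = A * Y ∧ polar w v = B * Y ∧ v.norm = C * Y ∧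
      0 < A ∧ |B| ≤ A ∧ A ≤ C := by
  induction N with
  | zero =>
    intro w v A B C hA _ _ hdet hw _ _
    have hw0 : w ≠ 0 := by
      rintro rfl
      simp at hdet; omega
    have := norm_pos_of_disc hD hw0
    have : 0 < A := by rw [hw] at this; exact pos_of_mul_pos_left this hY.le
    omega
  | succ N ih =>
    intro w v A B C hA hPw hPv hdet hw hp hv
    have hw0 : w ≠ 0 := by
      rintro rfl
      simp at hdet; omega
    have := norm_pos_of_disc hD hw0
    have hA0 : 0 < A := by rw [hw] at this; exact pos_of_mul_pos_left this hY.le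
    obtain ⟨k, hk⟩ : ∃ k : ℤ, |B + 2 * k * A| ≤ A := by
      refine ⟨-((B + A) / (2 * A)), ?_⟩
      have h1 := Int.emod_add_mul_ediv (B + A) (2 * A)
      have h2 := Int.emod_nonneg (B + A) (show 2 * A ≠ 0 by omega)
      have h3 := Int.emod_lt_of_pos (B + A) (show 0 < 2 * A by omega)
      rw [abs_le]
      constructor <;> nlinarith
    set v' := v + k * w with hv'
    have hPv' : Par Y α v' := hPv.lin hPw k
    have hdet' : w.re * v'.im - w.im * v'.re = Y := by
      simp [hv']; linear_combination hdet
    have hp' : polar w v' = (B + 2 * k * A) * Y := by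
      rw [norm_def] at hw
      simp [polar, hv'] at hp ⊢
      linear_combination hp + 2 * k * hw
    have hn' : v'.norm = (C + k * B + k ^ 2 * A) * Y := by
      rw [norm_def] at hw hv ⊢
      simp [polar, hv'] at hp ⊢
      linear_combination hv + k * hp + k ^ 2 * hw
    by_cases hlt : A ≤ C + k * B + k ^ 2 * A
    · exact ⟨w, v', A, _, _, hPw, hPv', hdet', hw, hp', hn', hA0, hk, hlt⟩
    · refine ih v' (-w) (C + k * B + k ^ 2 * A) (-(B + 2 * k * A)) A (by omega) hPv' ?_ ?_ hn' ?_ ?_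
      · have := hPw
        unfold Par at this ⊢
        obtain ⟨u, hu⟩ := this
        refine ⟨-u, ?_⟩
        simp; linear_combination -hu
      · simp; linear_combination hdet'
      · simp [polar] at hp' ⊢; linear_combination -hp'
      · rw [QuadraticAlgebra.norm_neg, hw]

lemma exists_reduced (hD : b ^ 2 + 4 * a < 0) {Y : ℤ} (hY : 0 < Y) {n : ℕ} (hn : n ≠ 0)
    {α : QuadraticAlgebra ℤ a b} (hα : α.norm = Y ^ n) (hc : IsCoprime α.im Y) :
    ∃ (w v : QuadraticAlgebra ℤ a b) (A B C : ℤ), Par Y α w ∧ Par Y α v ∧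
      w.re * v.im - w.im * v.re = Y ∧ w.norm = A * Y ∧ polar w v = B * Y ∧ v.norm = C * Y ∧
      0 < A ∧ |B| ≤ A ∧ A ≤ C ∧ B ^ 2 - (b ^ 2 + 4 * a) = 4 * A * C := by
  obtain ⟨p, q, hpq⟩ := id hc
  have hnθ : Y ∣ (p * α.re) ^ 2 + b * (p * α.re) - a := by
    have h1 : Y ∣ α.norm := hα ▸ dvd_pow_self Y hn
    rw [norm_def] at h1
    obtain ⟨t, ht⟩ := h1
    have : Y ∣ α.im ^ 2 * ((p * α.re) ^ 2 + b * (p * α.re) - a) := by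
      refine ⟨t - q * α.re * (α.re * (1 + p * α.im) + b * α.im), ?_⟩
      have e : p * α.im = 1 - q * Y := by linear_combination hpq
      linear_combination ht + α.re * (α.re * (1 + p * α.im) + b * α.im) * e
    exact (hc.symm.pow_right).dvd_of_dvd_mul_left this
  obtain ⟨C, hC⟩ := hnθ
  obtain ⟨w, v, A, B, C, h1, h2, h3, h4, h5, h6, h7, h8, h9⟩ :=
    exists_reduced_aux hD hY α _ (⟨Y, 0⟩ : QuadraticAlgebra ℤ a b) ⟨p * α.re, 1⟩ Y
      (2 * (p * α.re) + b) C le_rfl ⟨-α.im, by simp; ring⟩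
      ⟨q * α.re, by simp; linear_combination (-α.re) * hpq⟩ (by simp) (by simp [norm_def])
      (by simp [polar]; ring) (by rw [norm_def]; simp; linear_combination hC)
  refine ⟨w, v, A, B, C, h1, h2, h3, h4, h5, h6, h7, h8, h9, ?_⟩
  have hid : (polar w v) ^ 2 - (b ^ 2 + 4 * a) * (w.re * v.im - w.im * v.re) ^ 2
      = 4 * w.norm * v.norm := by
    rw [norm_def, norm_def]; simp only [polar]; ring
  rw [h3, h4, h5, h6] at hid
  have : Y ^ 2 * (B ^ 2 - (b ^ 2 + 4 * a)) = Y ^ 2 * (4 * A * C) := by linear_combination hid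
  exact mul_left_cancel₀ (by positivity) this

lemma sq_lt_of_reduced {A B C D : ℤ} (hA : 0 < A) (hB : |B| ≤ A) (hC : A ≤ C)
    (h : B ^ 2 - D = 4 * A * C) : 3 * A ^ 2 ≤ -D := by
  have : B ^ 2 ≤ A ^ 2 := sq_le_sq' (by linarith [abs_le.mp hB]) (abs_le.mp hB).2
  nlinarith
end Descent

section Lucas
open QuadraticAlgebra

/-- Lucas sequence `U_n(P, Q)`. -/
def luc {R : Type*} [CommRing R] (P Q : R) : ℕ → R
  | 0 => 0
  | 1 => 1
  | n + 2 => P * luc P Q (n + 1) - Q * luc P Q n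

lemma luc_map {R S : Type*} [CommRing R] [CommRing S] (f : R →+* S) (P Q : R) (n : ℕ) :
    f (luc P Q n) = luc (f P) (f Q) n := by
  induction n using Nat.strong_induction_on with
  | _ n ih =>
    match n with
    | 0 => simp [luc]
    | 1 => simp [luc]
    | n + 2 => simp [luc, ih (n + 1) (by omega), ih n (by omega)]

lemma luc_cast (q : ℕ) (P Q : ℤ) (n : ℕ) :
    ((luc P Q n : ℤ) : ZMod q) = luc (P : ZMod q) (Q : ZMod q) n :=
  luc_map (Int.castRingHom (ZMod q)) P Q n

lemma luc_sub {R : Type*} [CommRing R] (P Q : R) (k n : ℕ) :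
    luc P Q (n + k) * luc P Q (n + 1) - luc P Q (n + k + 1) * luc P Q n = Q ^ n * luc P Q k := by
  induction n with
  | zero => simp [luc]
  | succ n ih =>
    have h1 : luc P Q (n + 1 + 1) = P * luc P Q (n + 1) - Q * luc P Q n := rfl
    have h2 : luc P Q (n + 1 + k + 1) = P * luc P Q (n + k + 1) - Q * luc P Q (n + k) := by
      rw [show n + 1 + k + 1 = n + k + 2 by ring]; rfl
    rw [h1, h2, show n + 1 + k = n + k + 1 by ring, pow_succ]
    linear_combination Q * ih

lemma luc_gcd {F : Type*} [Field F] {P Q : F} (hQ : Q ≠ 0) :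
    ∀ m n : ℕ, luc P Q m = 0 → luc P Q n = 0 → luc P Q (Nat.gcd m n) = 0 := by
  have key : ∀ k n, luc P Q n = 0 → luc P Q (n + k) = 0 → luc P Q k = 0 := by
    intro k n h1 h2
    have := luc_sub P Q k n
    rw [h1, h2] at this
    simp only [zero_mul, mul_zero, sub_zero] at this
    exact (mul_eq_zero.mp this.symm).resolve_left (pow_ne_zero n hQ)
  intro m n
  induction m, n using Nat.gcd.induction with
  | H0 n => simp
  | H1 m n hm ih =>
    intro h1 h2
    rw [Nat.gcd_rec]
    refine ih ?_ h1
    have : ∀ t, luc P Q (m * t + n % m) = 0 → luc P Q (n % m) = 0 := by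
      intro t
      induction t with
      | zero => simp
      | succ t iht =>
        intro h
        apply iht
        apply key _ m h1
        rw [← h]; congr 1; ring
    exact this (n / m) (by rw [Nat.div_add_mod]; exact h2)

variable {a b : ℤ}

lemma sq_eq_trace_norm (w : QuadraticAlgebra ℤ a b) :
    w ^ 2 = ((2 * w.re + b * w.im : ℤ) : QuadraticAlgebra ℤ a b) * w - ((w.norm : ℤ) : _) := by
  rw [norm_def]
  ext
  · simp [sq]; ring
  · simp [sq]; ring

/-- The trace. -/
def tr (w : QuadraticAlgebra ℤ a b) : ℤ := 2 * w.re + b * w.im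

lemma im_pow_eq (w : QuadraticAlgebra ℤ a b) (n : ℕ) :
    (w ^ n).im = w.im * luc (tr w) w.norm n := by
  induction n using Nat.strong_induction_on with
  | _ n ih =>
    match n with
    | 0 => simp [luc]
    | 1 => simp [luc]
    | n + 2 =>
      have : w ^ (n + 2) = ((tr w : ℤ) : QuadraticAlgebra ℤ a b) * w ^ (n + 1)
          - ((w.norm : ℤ) : _) * w ^ n := by
        rw [pow_add, sq_eq_trace_norm, tr]; ring
      rw [this]
      simp [luc, ih (n + 1) (by omega), ih n (by omega)]
      ring

lemma tr_sq (w : QuadraticAlgebra ℤ a b) :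
    tr w ^ 2 = 4 * w.norm + (b ^ 2 + 4 * a) * w.im ^ 2 := by
  rw [norm_def, tr]; ring

lemma luc_three {R : Type*} [CommRing R] (P Q : R) : luc P Q 3 = P ^ 2 - Q := by
  simp [luc]; ring

lemma luc_expand (P Q : ℤ) (n : ℕ) :
    (P ^ 2 - 4 * Q) ^ 2 ∣ 6 * P ^ 2 * 2 ^ n * luc P Q (n + 1)
      - (6 * (n + 1) * P ^ (n + 2) + (n + 1) * n * (n - 1) * P ^ n * (P ^ 2 - 4 * Q)) := by
  induction n using Nat.strong_induction_on with
  | _ n ih =>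
    match n with
    | 0 => simp [luc]
    | 1 =>
      simp [luc]
      exact ⟨0, by ring⟩
    | n + 2 =>
      obtain ⟨u, hu⟩ := ih (n + 1) (by omega)
      obtain ⟨v, hv⟩ := ih n (by omega)
      refine ⟨2 * P * u - 4 * Q * v + (n + 1) * n * (n - 1) * P ^ n, ?_⟩
      have : luc P Q (n + 2 + 1) = P * luc P Q (n + 1 + 1) - Q * luc P Q (n + 1) := rfl
      rw [this]
      push_cast at hu hv ⊢
      have e : (4 : ℤ) * Q = P ^ 2 - (P ^ 2 - 4 * Q) := by ring
      linear_combination 2 * P * hu - 4 * Q * hv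

end Lucas

section SUnits

/-- Integers composed of the primes 2, 11, 19. -/
def SU (n : ℤ) : Prop := n ≠ 0 ∧ ∀ q : ℕ, q.Prime → (q : ℤ) ∣ n → q = 2 ∨ q = 11 ∨ q = 19

lemma SU.dvd {m n : ℤ} (hn : SU n) (h : m ∣ n) : SU m :=
  ⟨fun h0 => hn.1 (by subst h0; exact zero_dvd_iff.mp h), fun q hq hd => hn.2 q hq (hd.trans h)⟩

lemma SU.of_eq {n : ℤ} {i j k : ℕ} (h : n = 2 ^ i * 11 ^ j * 19 ^ k) : SU n := by
  refine ⟨by rw [h]; positivity, fun q hq hd => ?_⟩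
  have hd' : q ∣ 2 ^ i * 11 ^ j * 19 ^ k := by
    rw [h] at hd; exact_mod_cast hd
  rcases (Nat.Prime.dvd_mul hq).mp hd' with hd' | hd'
  · rcases (Nat.Prime.dvd_mul hq).mp hd' with hd' | hd'
    · exact Or.inl ((Nat.prime_dvd_prime_iff_eq hq (by norm_num)).mp (hq.dvd_of_dvd_pow hd'))
    · exact Or.inr (Or.inl ((Nat.prime_dvd_prime_iff_eq hq (by norm_num)).mp (hq.dvd_of_dvd_pow hd')))
  · exact Or.inr (Or.inr ((Nat.prime_dvd_prime_iff_eq hq (by norm_num)).mp (hq.dvd_of_dvd_pow hd')))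

lemma exists_pow_of_primes (n : ℕ) (hn : n ≠ 0)
    (h : ∀ q : ℕ, q.Prime → q ∣ n → q = 2 ∨ q = 11 ∨ q = 19) :
    ∃ i j k : ℕ, n = 2 ^ i * 11 ^ j * 19 ^ k := by
  induction n using Nat.strong_induction_on with
  | _ n ih =>
    by_cases h1 : n = 1
    · exact ⟨0, 0, 0, by simp [h1]⟩
    obtain ⟨q, hq, m, rfl⟩ := Nat.exists_prime_and_dvd h1
    have hm : m ≠ 0 := by rintro rfl; simp at hn
    have hlt : m < q * m := lt_mul_of_one_lt_left (by omega) hq.one_lt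
    obtain ⟨i, j, k, hijk⟩ := ih m hlt hm (fun r hr hd => h r hr (hd.mul_left q))
    rcases h q hq (dvd_mul_right q m) with rfl | rfl | rfl
    · exact ⟨i + 1, j, k, by rw [hijk]; ring⟩
    · exact ⟨i, j + 1, k, by rw [hijk]; ring⟩
    · exact ⟨i, j, k + 1, by rw [hijk]; ring⟩

lemma SU.exists_pow {n : ℤ} (h : SU n) :
    ∃ i j k : ℕ, n = 2 ^ i * 11 ^ j * 19 ^ k ∨ n = -(2 ^ i * 11 ^ j * 19 ^ k) := by
  obtain ⟨i, j, k, hijk⟩ := exists_pow_of_primes n.natAbs (Int.natAbs_ne_zero.mpr h.1)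
    (fun q hq hd => h.2 q hq (Int.natCast_dvd.mpr hd))
  refine ⟨i, j, k, ?_⟩
  rcases Int.natAbs_eq n with e | e <;> rw [hijk] at e <;> push_cast at e <;> simp [← e]

end SUnits

section Rank

lemma rank_small (q : ℕ) (hq : q = 2 ∨ q = 11 ∨ q = 19) (P Q : ZMod q) (hQ : Q ≠ 0) :
    luc P Q (q - 1) = 0 ∨ luc P Q q = 0 ∨ luc P Q (q + 1) = 0 := by
  rcases hq with rfl | rfl | rfl <;> revert P Q <;> decide +kernel

lemma not_dvd_luc {p q : ℕ} (hq : q = 2 ∨ q = 11 ∨ q = 19) (hp : p.Prime) (hp7 : 7 ≤ p)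
    (hpq : p ≠ q) {P Q : ℤ} (hQ : ¬ (q : ℤ) ∣ Q) : ¬ (q : ℤ) ∣ luc P Q p := by
  intro h
  have hqp : q.Prime := by rcases hq with rfl | rfl | rfl <;> norm_num
  have := Fact.mk hqp
  have h0 : luc (P : ZMod q) (Q : ZMod q) p = 0 := by
    rw [← luc_cast]; exact (ZMod.intCast_zmod_eq_zero_iff_dvd _ _).mpr h
  have hQ0 : (Q : ZMod q) ≠ 0 := fun h' => hQ ((ZMod.intCast_zmod_eq_zero_iff_dvd _ _).mp h')
  have hcop : ∀ m, 0 < m → Nat.Coprime p m → luc (P : ZMod q) (Q : ZMod q) m ≠ 0 := by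
    intro m _ hc hm
    have := luc_gcd hQ0 p m h0 hm
    rw [hc] at this
    simp [luc] at this
  have hm : ∀ m, (m = q - 1 ∨ m = q ∨ m = q + 1) → Nat.Coprime p m := by
    intro m hm
    rw [hp.coprime_iff_not_dvd]
    intro hd
    rcases hq with rfl | rfl | rfl <;> rcases hm with rfl | rfl | rfl <;>
      (have hle := Nat.le_of_dvd (by norm_num) hd
       first
       | omega
       | (interval_cases p <;> revert hd hp hpq <;> norm_num))
  rcases rank_small q hq _ _ hQ0 with h | h | h
  · exact hcop _ (by have := hqp.two_le; omega) (hm _ (by simp)) h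
  · exact hcop _ hqp.pos (hm _ (by simp)) h
  · exact hcop _ (by omega) (hm _ (by simp)) h

lemma disc_eq_zero_of_luc {p : ℕ} (hp : p = 11 ∨ p = 19) (P Q : ZMod p) (h : luc P Q p = 0) :
    P ^ 2 - 4 * Q = 0 := by
  rcases hp with rfl | rfl <;> revert P Q <;> decide +kernel

lemma sq_not_dvd_luc {p : ℕ} (hp : p = 11 ∨ p = 19) {P Q : ℤ} (hQ : ¬ (p : ℤ) ∣ Q) :
    ¬ (p : ℤ) ^ 2 ∣ luc P Q p := by
  intro h
  have hpp : p.Prime := by rcases hp with rfl | rfl <;> norm_num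
  have hpi : Prime (p : ℤ) := Nat.prime_iff_prime_int.mp hpp
  have := Fact.mk hpp
  have hΔ : (p : ℤ) ∣ P ^ 2 - 4 * Q := by
    have h1 : (p : ℤ) ∣ luc P Q p := (dvd_pow_self _ two_ne_zero).trans h
    have h0 : luc (P : ZMod p) (Q : ZMod p) p = 0 := by
      rw [← luc_cast]; exact (ZMod.intCast_zmod_eq_zero_iff_dvd _ _).mpr h1
    have := disc_eq_zero_of_luc hp _ _ h0
    apply (ZMod.intCast_zmod_eq_zero_iff_dvd _ _).mp
    push_cast; exact this
  have hP : ¬ (p : ℤ) ∣ P := by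
    intro hP
    have h4 : (p : ℤ) ∣ 4 * Q := by
      have := dvd_sub (hP.trans (dvd_pow_self P two_ne_zero)) hΔ
      simpa using this
    rcases hpi.dvd_or_dvd h4 with h4 | h4
    · rcases hp with rfl | rfl <;> norm_num at h4
    · exact hQ h4
  obtain ⟨n, rfl⟩ : ∃ n, p = n + 1 := ⟨p - 1, by have := hpp.pos; omega⟩
  have h2 := luc_expand P Q n
  set Δ := P ^ 2 - 4 * Q with hΔd
  have h3 : ((n + 1 : ℕ) : ℤ) ^ 2 ∣ Δ ^ 2 := pow_dvd_pow_of_dvd hΔ 2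
  have h4 := (h3.trans h2)
  have h5 := dvd_sub (h.mul_left (6 * P ^ 2 * 2 ^ n)) h4
  obtain ⟨t, ht⟩ := hΔ
  have h6 : ((n + 1 : ℕ) : ℤ) ^ 2 ∣ 6 * (n + 1) * P ^ (n + 2) := by
    obtain ⟨u, hu⟩ := h5
    refine ⟨u - n * (n - 1) * P ^ n * t, ?_⟩
    rw [ht] at hu
    push_cast at hu ⊢
    linear_combination hu
  have h7 : ((n + 1 : ℕ) : ℤ) ∣ 6 * P ^ (n + 2) := by
    obtain ⟨u, hu⟩ := h6
    refine ⟨u, ?_⟩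
    have hne : ((n + 1 : ℕ) : ℤ) ≠ 0 := by positivity
    apply mul_left_cancel₀ hne
    push_cast at hu ⊢
    linear_combination hu
  rcases hpi.dvd_or_dvd h7 with h7 | h7
  · rcases hp with hp | hp <;> rw [hp] at h7 <;> norm_num at h7
  · exact hP (hpi.dvd_of_dvd_pow h7)

/-- A Lucas number of prime index `p ≥ 7` supported at 2, 11, 19 is `±1`, `±11` or `±19`, the last
two only for `p = 11`, `p = 19`. -/
lemma luc_prime_bound {p : ℕ} (hp : p.Prime) (hp7 : 7 ≤ p) {P Q : ℤ} (hSU : SU (luc P Q p))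
    (hQ : ∀ q : ℕ, (q = 2 ∨ q = 11 ∨ q = 19) → (q : ℤ) ∣ luc P Q p → ¬ (q : ℤ) ∣ Q) :
    |luc P Q p| = 1 ∨ ((p = 11 ∨ p = 19) ∧ |luc P Q p| = p) := by
  obtain ⟨i, j, k, h⟩ := hSU.exists_pow
  have habs : |luc P Q p| = 2 ^ i * 11 ^ j * 19 ^ k := by
    rcases h with h | h <;> rw [h]
    · exact abs_of_pos (by positivity)
    · rw [abs_neg]; exact abs_of_pos (by positivity)
  have nd : ∀ q : ℕ, (q = 2 ∨ q = 11 ∨ q = 19) → p ≠ q → ¬ (q : ℤ) ∣ luc P Q p := by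
    intro q hq hne hd
    exact not_dvd_luc hq hp hp7 hne (hQ q hq hd) hd
  have nd2 : (p = 11 ∨ p = 19) → ¬ (p : ℤ) ^ 2 ∣ luc P Q p := by
    intro hp' hd
    exact sq_not_dvd_luc hp' (hQ p (Or.inr hp') ((dvd_pow_self _ two_ne_zero).trans hd)) hd
  have hi : i = 0 := by
    by_contra hi
    refine nd 2 (by simp) (by omega) ?_
    rw [← dvd_abs, habs]
    exact ((dvd_pow_self _ hi).mul_right _).mul_right _
  have hj : p ≠ 11 → j = 0 := by
    intro hp'
    by_contra hj
    refine nd 11 (by simp) hp' ?_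
    rw [← dvd_abs, habs]
    exact ((dvd_pow_self _ hj).mul_left _).mul_right _
  have hk : p ≠ 19 → k = 0 := by
    intro hp'
    by_contra hk
    refine nd 19 (by simp) hp' ?_
    rw [← dvd_abs, habs]
    exact ((dvd_pow_self _ hk).mul_left _)
  subst hi
  by_cases h11 : p = 11
  · subst h11
    have := hk (by norm_num)
    subst this
    have hj2 : j < 2 := by
      by_contra hj2
      apply nd2 (by simp)
      rw [← dvd_abs, habs]
      simpa using pow_dvd_pow (11 : ℤ) (by omega : 2 ≤ j)
    interval_cases j
    · left; simpa using habs
    · right; simpa using habs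
  · have := hj h11
    subst this
    by_cases h19 : p = 19
    · subst h19
      have hk2 : k < 2 := by
        by_contra hk2
        apply nd2 (by simp)
        rw [← dvd_abs, habs]
        simpa using pow_dvd_pow (19 : ℤ) (by omega : 2 ≤ k)
      interval_cases k
      · left; simpa using habs
      · right; simpa using habs
    · have := hk h19
      subst this
      left; simpa using habs

end Rank

section Size
open QuadraticAlgebra
variable {a b : ℤ}

lemma three_pow_gt {p : ℕ} (hp : 7 ≤ p) : (4 * p ^ 2 + 3 * p : ℤ) < 3 * 3 ^ (p - 1) := by
  induction p, hp using Nat.le_induction with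
  | base => norm_num
  | succ p hp ih =>
    obtain ⟨m, rfl⟩ : ∃ m, p = m + 7 := ⟨p - 7, by omega⟩
    simp only [Nat.add_sub_cancel, show m + 7 - 1 = m + 6 by omega] at ih ⊢
    have e : (3 : ℤ) ^ (m + 7) = 3 * 3 ^ (m + 6) := by ring
    rw [e]
    push_cast at ih ⊢
    nlinarith

lemma norm_pow' (w : QuadraticAlgebra ℤ a b) (n : ℕ) : (w ^ n).norm = w.norm ^ n := map_pow _ _ _

lemma no_prime_index (hD : b ^ 2 + 4 * a < 0) {w : QuadraticAlgebra ℤ a b} {y Z : ℤ} (hy : 3 ≤ y)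
    (hw : w.norm = y) {p : ℕ} (hp : p.Prime) (hp7 : 7 ≤ p) (hZ : (w ^ (3 * p)).im = Z) (hSU : SU Z)
    (hco : ∀ q : ℕ, (q = 2 ∨ q = 11 ∨ q = 19) → (q : ℤ) ∣ Z → ¬ (q : ℤ) ∣ y) : False := by
  set u := luc (tr w) y p with hu
  set v := luc (tr (w ^ 3)) (y ^ 3) p with hv
  have hγ : (w ^ p).im = w.im * u := by rw [im_pow_eq, hw]
  have hγn : (w ^ p).norm = y ^ p := by rw [norm_pow', hw]
  have h1 : Z = (w.im * u) * (tr (w ^ p) ^ 2 - y ^ p) := by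
    rw [← hZ, mul_comm, pow_mul, im_pow_eq, luc_three, hγ, hγn]
  have h2 : Z = (w.im * (tr w ^ 2 - y)) * v := by
    rw [← hZ, pow_mul, im_pow_eq, im_pow_eq w, luc_three, norm_pow', hw]
  have ht1 := tr_sq w
  have ht2 := tr_sq (w ^ p)
  rw [hγn, hγ] at ht2
  rw [hw] at ht1
  have hZ0 := hSU.1
  have hi0 : w.im ≠ 0 := by rintro h; rw [h] at h2; simp at h2; exact hZ0 h2
  have hub : |u| = 1 ∨ ((p = 11 ∨ p = 19) ∧ |u| = p) := by
    have hdu : u ∣ Z := ⟨w.im * (tr (w ^ p) ^ 2 - y ^ p), by rw [h1]; ring⟩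
    exact luc_prime_bound hp hp7 (hSU.dvd hdu) (fun q hq hd => hco q hq (hd.trans hdu))
  have hvb : |v| = 1 ∨ ((p = 11 ∨ p = 19) ∧ |v| = p) := by
    have hdv : v ∣ Z := ⟨w.im * (tr w ^ 2 - y), by rw [h2]; ring⟩
    refine luc_prime_bound hp hp7 (hSU.dvd hdv) (fun q hq hd hd2 => hco q hq (hd.trans hdv) ?_)
    have hqp : q.Prime := by rcases hq with rfl | rfl | rfl <;> norm_num
    exact (Nat.prime_iff_prime_int.mp hqp).dvd_of_dvd_pow hd2
  have bd : ∀ {t : ℤ}, (|t| = 1 ∨ ((p = 11 ∨ p = 19) ∧ |t| = p)) → 1 ≤ |t| ∧ |t| ≤ p := by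
    rintro t (h | ⟨_, h⟩) <;> rw [h] <;> constructor <;> norm_cast <;> omega
  obtain ⟨hu1, hup⟩ := bd hub
  obtain ⟨hv1, hvp⟩ := bd hvb
  set c := tr w ^ 2 - y with hc
  have hmain : u * (3 * y ^ p + (b ^ 2 + 4 * a) * w.im ^ 2 * u ^ 2) = c * v := by
    apply mul_left_cancel₀ hi0
    have : w.im * u * (tr (w ^ p) ^ 2 - y ^ p) = w.im * c * v := by rw [← h1, h2]
    rw [ht2] at this
    linear_combination this
  have hDi : -(4 * y) ≤ (b ^ 2 + 4 * a) * w.im ^ 2 := by linarith [sq_nonneg (tr w)]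
  have hDi2 : (b ^ 2 + 4 * a) * w.im ^ 2 ≤ 0 :=
    mul_nonpos_of_nonpos_of_nonneg hD.le (sq_nonneg _)
  have hcb : |c| ≤ 3 * y := by
    rw [abs_le]; constructor <;> linarith
  have hu2 : u ^ 2 ≤ p ^ 2 := by
    rw [← sq_abs]; exact pow_le_pow_left₀ (abs_nonneg u) hup 2
  have hp0 : (0 : ℤ) < p := by exact_mod_cast hp.pos
  have hpow : 3 ^ (p - 1) * y ≤ y ^ p := by
    obtain ⟨m, rfl⟩ : ∃ m, p = m + 1 := ⟨p - 1, by omega⟩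
    rw [Nat.add_sub_cancel, pow_succ]
    exact mul_le_mul_of_nonneg_right (pow_le_pow_left₀ (by norm_num) hy m) (by linarith)
  have h3 := three_pow_gt hp7
  have hbig : 4 * y * p ^ 2 + 3 * y * p < 3 * y ^ p := by
    have := mul_lt_mul_of_pos_right h3 (show 0 < y by linarith)
    linarith
  set E := 3 * y ^ p + (b ^ 2 + 4 * a) * w.im ^ 2 * u ^ 2 with hE
  have hE1 : 3 * y * p < E := by
    have : -(4 * y * p ^ 2) ≤ (b ^ 2 + 4 * a) * w.im ^ 2 * u ^ 2 := by
      have h5 : -(4 * y) * u ^ 2 ≤ (b ^ 2 + 4 * a) * w.im ^ 2 * u ^ 2 :=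
        mul_le_mul_of_nonneg_right hDi (sq_nonneg u)
      have h6 : 4 * y * u ^ 2 ≤ 4 * y * p ^ 2 :=
        mul_le_mul_of_nonneg_left hu2 (by linarith)
      linarith
    linarith
  have hE2 : |u| * E = |c| * |v| := by
    have h6 : 0 < E := lt_trans (by positivity) hE1
    rw [← abs_of_pos h6, ← abs_mul, ← abs_mul, hmain]
  have h7 : |c| * |v| ≤ 3 * y * p := mul_le_mul hcb hvp (abs_nonneg v) (by linarith)
  have hE0 : 0 < E := lt_trans (by positivity) hE1
  have h8 := le_mul_of_one_le_left hE0.le hu1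
  linarith

end Size

section Roots
open QuadraticAlgebra
variable {a b : ℤ}

lemma exists_pow_eq_mul (hD : b ^ 2 + 4 * a < 0) {Y : ℤ} (hY : 0 < Y) {n : ℕ} (hn : n ≠ 0)
    {α : QuadraticAlgebra ℤ a b} (hα : α.norm = Y ^ n) (hc : IsCoprime α.im Y) :
    ∃ (w ρ : QuadraticAlgebra ℤ a b) (A B C : ℤ), w.norm = A * Y ∧ ρ.norm = A ^ n ∧
      w ^ n = α * ρ ∧ 0 < A ∧ |B| ≤ A ∧ A ≤ C ∧ B ^ 2 - (b ^ 2 + 4 * a) = 4 * A * C := by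
  obtain ⟨w, v, A, B, C, h1, h2, h3, h4, h5, h6, h7, h8, h9, h10⟩ := exists_reduced hD hY hn hα hc
  obtain ⟨ρ, hρ⟩ := dvd_pow_of_par hn hY.ne' hα hc h1
  refine ⟨w, ρ, A, B, C, h4, ?_, hρ, h7, h8, h9, h10⟩
  have := congrArg QuadraticAlgebra.norm hρ
  rw [norm_pow', map_mul, h4, hα, mul_pow] at this
  exact mul_left_cancel₀ (pow_ne_zero n hY.ne') (by linear_combination -this)

lemma exists_root_of_one {Y : ℤ} {n : ℕ} (hn : Odd n)
    (hunit : ∀ ρ : QuadraticAlgebra ℤ a b, ρ.norm = 1 → ρ = 1 ∨ ρ = -1)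
    {α w ρ : QuadraticAlgebra ℤ a b} (hw : w.norm = Y) (hρ : ρ.norm = 1) (h : w ^ n = α * ρ) :
    ∃ w : QuadraticAlgebra ℤ a b, w.norm = Y ∧ w ^ n = α := by
  rcases hunit ρ hρ with rfl | rfl
  · exact ⟨w, hw, by rw [h, mul_one]⟩
  · exact ⟨-w, by rw [QuadraticAlgebra.norm_neg, hw], by rw [hn.neg_pow, h]; ring⟩

lemma unit_of_norm_one {d : ℤ} (hd : 2 ≤ d) (ρ : QuadraticAlgebra ℤ (-d) 0) (h : ρ.norm = 1) :
    ρ = 1 ∨ ρ = -1 := by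
  rw [norm_def] at h
  simp only [zero_mul, add_zero, sub_neg_eq_add, neg_mul] at h
  have h2 : ρ.im = 0 := by
    by_contra hne
    have : 1 ≤ ρ.im * ρ.im := by
      have : 0 < ρ.im * ρ.im := mul_self_pos.mpr hne
      omega
    nlinarith [mul_self_nonneg ρ.re]
  rw [h2] at h
  have : ρ.re * ρ.re = 1 := by linarith
  rcases mul_self_eq_one_iff.mp this with h3 | h3
  · left; ext <;> simp [h2, h3]
  · right; ext <;> simp [h2, h3]

lemma unit_of_norm_one_max {c : ℤ} (hc : 2 ≤ c) (ρ : QuadraticAlgebra ℤ (-c) 1) (h : ρ.norm = 1) :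
    ρ = 1 ∨ ρ = -1 := by
  rw [norm_def] at h
  simp only [one_mul, sub_neg_eq_add, neg_mul] at h
  have h2 : ρ.im = 0 := by
    by_contra hne
    have : 1 ≤ ρ.im * ρ.im := by
      have : 0 < ρ.im * ρ.im := mul_self_pos.mpr hne
      omega
    nlinarith [mul_self_nonneg (2 * ρ.re + ρ.im)]
  rw [h2] at h
  have : ρ.re * ρ.re = 1 := by linarith
  rcases mul_self_eq_one_iff.mp this with h3 | h3
  · left; ext <;> simp [h2, h3]
  · right; ext <;> simp [h2, h3]

lemma root_neg_one {x z Y : ℤ} (hY : 0 < Y) {n : ℕ} (hn : Odd n) (h : x ^ 2 + z ^ 2 = Y ^ n)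
    (hc : IsCoprime z Y) : ∃ w : QuadraticAlgebra ℤ (-1) 0, w.norm = Y ∧ w ^ n = ⟨x, z⟩ := by
  obtain ⟨w, ρ, A, B, C, h1, h2, h3, h4, h5, h6, h7⟩ := exists_pow_eq_mul (a := -1) (b := 0)
    (by norm_num) hY hn.pos.ne' (α := ⟨x, z⟩) (by rw [norm_def, ← h]; ring) hc
  have hA := sq_lt_of_reduced h4 h5 h6 h7
  have hA1 : A = 1 := by nlinarith
  subst hA1
  rw [one_mul] at h1
  rw [one_pow] at h2
  have hu : ρ * star ρ = 1 := by rw [mul_star_eq, h2]; simp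
  -- the units are fourth roots of unity
  have hρ4 : ρ ^ 4 = 1 := by
    rw [norm_def] at h2
    simp only [zero_mul, add_zero, sub_neg_eq_add, neg_mul, one_mul] at h2
    have hr : ρ.re ^ 2 ≤ 1 := by nlinarith [sq_nonneg ρ.im]
    have hi : ρ.im ^ 2 ≤ 1 := by nlinarith [sq_nonneg ρ.re]
    have hr' := abs_le_of_sq_le_sq' (show ρ.re ^ 2 ≤ 1 ^ 2 by linarith) (by norm_num)
    have hi' := abs_le_of_sq_le_sq' (show ρ.im ^ 2 ≤ 1 ^ 2 by linarith) (by norm_num)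
    obtain ⟨r, i⟩ := ρ
    simp only at h2 hr' hi'
    obtain ⟨hr1, hr2⟩ := hr'
    obtain ⟨hi1, hi2⟩ := hi'
    interval_cases r <;> interval_cases i <;> simp at h2 <;> (ext <;> simp [pow_succ])
  refine ⟨w * star ρ ^ n, ?_, ?_⟩
  · rw [map_mul, h1, norm_pow', QuadraticAlgebra.norm_star, h2]; simp
  · rw [mul_pow, h3]
    have : star ρ ^ 4 = 1 := by rw [← star_pow, hρ4, star_one]
    have h8 : (star ρ ^ n) ^ n = star ρ := by
      rw [← pow_mul]
      obtain ⟨m, rfl⟩ := hn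
      rw [show (2 * m + 1) * (2 * m + 1) = 4 * (m * m + m) + 1 by ring, pow_succ, pow_mul, this]
      simp
    rw [h8, mul_assoc, hu, mul_one]

lemma root_neg_two {x z Y : ℤ} (hY : 0 < Y) {n : ℕ} (hn : Odd n) (h : x ^ 2 + 2 * z ^ 2 = Y ^ n)
    (hc : IsCoprime z Y) : ∃ w : QuadraticAlgebra ℤ (-2) 0, w.norm = Y ∧ w ^ n = ⟨x, z⟩ := by
  obtain ⟨w, ρ, A, B, C, h1, h2, h3, h4, h5, h6, h7⟩ := exists_pow_eq_mul (a := -2) (b := 0)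
    (by norm_num) hY hn.pos.ne' (α := ⟨x, z⟩) (by rw [norm_def, ← h]; ring) hc
  have hA := sq_lt_of_reduced h4 h5 h6 h7
  have hA1 : A = 1 := by nlinarith
  subst hA1
  exact exists_root_of_one hn (unit_of_norm_one le_rfl) (by rw [h1, one_mul])
    (by rw [h2, one_pow]) h3

lemma root_neg_eleven {x z Y : ℤ} (hY : 0 < Y) {n : ℕ} (hn : Odd n)
    (h : x ^ 2 + 11 * z ^ 2 = Y ^ n) (hc : IsCoprime z Y) (hodd : Odd Y) :
    ∃ w : QuadraticAlgebra ℤ (-3) 1, w.norm = Y ∧ w ^ n = ⟨x - z, 2 * z⟩ := by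
  have hc2 : IsCoprime (2 * z) Y := IsCoprime.mul_left
    (by obtain ⟨t, ht⟩ := hodd; exact ⟨-t, 1, by rw [ht]; ring⟩) hc
  obtain ⟨w, ρ, A, B, C, h1, h2, h3, h4, h5, h6, h7⟩ := exists_pow_eq_mul (a := -3) (b := 1)
    (by norm_num) hY hn.pos.ne' (α := ⟨x - z, 2 * z⟩) (by rw [norm_def, ← h]; ring) hc2
  have hA := sq_lt_of_reduced h4 h5 h6 h7
  have hA1 : A = 1 := by nlinarith
  subst hA1
  exact exists_root_of_one hn (unit_of_norm_one_max (by norm_num))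
    (by rw [h1, one_mul]) (by rw [h2, one_pow]) h3

lemma root_neg_nineteen {x z Y : ℤ} (hY : 0 < Y) {n : ℕ} (hn : Odd n)
    (h : x ^ 2 + 19 * z ^ 2 = Y ^ n) (hc : IsCoprime z Y) (hodd : Odd Y) :
    ∃ w : QuadraticAlgebra ℤ (-5) 1, w.norm = Y ∧ w ^ n = ⟨x - z, 2 * z⟩ := by
  have hc2 : IsCoprime (2 * z) Y := IsCoprime.mul_left
    (by obtain ⟨t, ht⟩ := hodd; exact ⟨-t, 1, by rw [ht]; ring⟩) hc
  obtain ⟨w, ρ, A, B, C, h1, h2, h3, h4, h5, h6, h7⟩ := exists_pow_eq_mul (a := -5) (b := 1)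
    (by norm_num) hY hn.pos.ne' (α := ⟨x - z, 2 * z⟩) (by rw [norm_def, ← h]; ring) hc2
  have hA := sq_lt_of_reduced h4 h5 h6 h7
  have hA1 : A = 1 := by
    have : A ≤ 2 := by nlinarith
    obtain ⟨hB1, hB2⟩ := abs_le.mp h5
    interval_cases A
    · rfl
    · interval_cases B <;> omega
  subst hA1
  exact exists_root_of_one hn (unit_of_norm_one_max (by norm_num))
    (by rw [h1, one_mul]) (by rw [h2, one_pow]) h3

/-- The leading coefficient of the reduced form is a square modulo a prime dividing `d`. -/
lemma isSquare_of_norm {q : ℕ} [Fact q.Prime] {d x z Y A U V : ℤ} {n : ℕ} (hn : Odd n)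
    (hqd : (q : ℤ) ∣ d) (hqY : ¬ (q : ℤ) ∣ Y)
    (h : x ^ 2 + d * z ^ 2 = Y ^ n) (hA : U ^ 2 + d * V ^ 2 = A * Y) : IsSquare (A : ZMod q) := by
  have hd : (d : ZMod q) = 0 := (ZMod.intCast_zmod_eq_zero_iff_dvd _ _).mpr hqd
  have hY0 : (Y : ZMod q) ≠ 0 := fun h' => hqY ((ZMod.intCast_zmod_eq_zero_iff_dvd _ _).mp h')
  have e1 := congrArg (Int.cast : ℤ → ZMod q) h
  have e2 := congrArg (Int.cast : ℤ → ZMod q) hA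
  push_cast at e1 e2
  rw [hd, zero_mul, add_zero] at e1 e2
  obtain ⟨m, rfl⟩ := hn
  have : (Y : ZMod q) = (x * ((Y : ZMod q) ^ m)⁻¹) ^ 2 := by
    rw [mul_pow, e1]; field_simp; ring
  refine ⟨U * (x * ((Y : ZMod q) ^ m)⁻¹)⁻¹, ?_⟩
  have hs : (x * ((Y : ZMod q) ^ m)⁻¹) ≠ 0 := by
    intro h0; rw [h0] at this; simp at this; exact hY0 this
  set s := (x * ((Y : ZMod q) ^ m)⁻¹) with hsd
  rw [this] at e2
  field_simp
  exact e2.symm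

lemma root_neg_twentytwo {x z Y : ℤ} (hY : 0 < Y) {n : ℕ} (hn : Odd n)
    (h : x ^ 2 + 22 * z ^ 2 = Y ^ n) (hc : IsCoprime z Y) (h11 : ¬ (11 : ℤ) ∣ Y) :
    ∃ w : QuadraticAlgebra ℤ (-22) 0, w.norm = Y ∧ w ^ n = ⟨x, z⟩ := by
  obtain ⟨w, ρ, A, B, C, h1, h2, h3, h4, h5, h6, h7⟩ := exists_pow_eq_mul (a := -22) (b := 0)
    (by norm_num) hY hn.pos.ne' (α := ⟨x, z⟩) (by rw [norm_def, ← h]; ring) hc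
  have hA := sq_lt_of_reduced h4 h5 h6 h7
  have hA1 : A = 1 ∨ A = 2 := by
    have : A ≤ 5 := by nlinarith
    obtain ⟨hB1, hB2⟩ := abs_le.mp h5
    interval_cases A
    · simp
    · simp
    all_goals (exfalso; interval_cases B <;> omega)
  rcases hA1 with rfl | rfl
  · exact exists_root_of_one hn (unit_of_norm_one (by norm_num))
      (by rw [h1, one_mul]) (by rw [h2, one_pow]) h3
  · exfalso
    have hsq : ¬ IsSquare (2 : ZMod 11) := by decide
    have : Fact (Nat.Prime 11) := ⟨by norm_num⟩
    rw [norm_def] at h1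
    have := isSquare_of_norm (q := 11) hn (d := 22) (by norm_num) h11 h (A := 2) (U := w.re)
      (V := w.im) (by linear_combination h1)
    exact hsq (by exact_mod_cast this)

end Roots

section RootThirtyEight
open QuadraticAlgebra

lemma dvd_pow_of_mul_coprime {a b : ℤ} {α τ κ κ' : QuadraticAlgebra ℤ a b} {p : ℕ}
    (hco : IsCoprime κ.norm κ'.norm) (h1 : α ∣ (κ * τ) ^ p) (h2 : α ∣ (κ' * τ) ^ p) :
    α ∣ τ ^ p := by
  have : IsCoprime κ κ' := by
    obtain ⟨u, v, huv⟩ := hco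
    refine ⟨u * star κ, v * star κ', ?_⟩
    have := congrArg (Int.cast : ℤ → QuadraticAlgebra ℤ a b) huv
    push_cast at this
    rw [← mul_star_eq, ← mul_star_eq] at this
    linear_combination this
  obtain ⟨u, v, huv⟩ := this.pow (m := p) (n := p)
  rw [show τ ^ p = u * (κ * τ) ^ p + v * (κ' * τ) ^ p by
    rw [mul_pow, mul_pow]; linear_combination - τ ^ p * huv]
  exact dvd_add (h1.mul_left u) (h2.mul_left v)

/-- Coordinates of the cube of a generator attached to the form `(6, 4, 7)`. -/
def cubeRe (s t : ℤ) : ℤ := -s ^ 3 - 48 * s ^ 2 * t + 30 * s * t ^ 2 + 8 * t ^ 3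

/-- Coordinates of the cube of a generator attached to the form `(6, 4, 7)`. -/
def cubeIm (s t : ℤ) : ℤ := -3 * s ^ 3 + 3 * s ^ 2 * t + 6 * s * t ^ 2 - 2 * t ^ 3

lemma cube_norm (s t : ℤ) : cubeRe s t ^ 2 + 38 * cubeIm s t ^ 2 =
    (7 * s ^ 2 - 4 * s * t + 6 * t ^ 2) ^ 3 := by
  rw [cubeRe, cubeIm]; ring

lemma root_neg_thirtyeight {x z Y : ℤ} (hY : 0 < Y) {p : ℕ} (hp : Odd p)
    (h : x ^ 2 + 38 * z ^ 2 = Y ^ (3 * p)) (hc : IsCoprime z Y) (h19 : ¬ (19 : ℤ) ∣ Y) :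
    (∃ w : QuadraticAlgebra ℤ (-38) 0, w.norm = Y ∧ w ^ (3 * p) = ⟨x, z⟩) ∨
    ∃ s t : ℤ, Y = 7 * s ^ 2 - 4 * s * t + 6 * t ^ 2 ∧
      ((⟨cubeRe s t, cubeIm s t⟩ : QuadraticAlgebra ℤ (-38) 0) ^ p = ⟨x, z⟩ ∨
       (⟨cubeRe s t, -cubeIm s t⟩ : QuadraticAlgebra ℤ (-38) 0) ^ p = ⟨x, z⟩) := by
  have hn : 3 * p ≠ 0 := by have := hp.pos; omega
  have hn' : Odd (3 * p) := Odd.mul (by decide) hp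
  set α : QuadraticAlgebra ℤ (-38) 0 := ⟨x, z⟩ with hαd
  have hα : α.norm = Y ^ (3 * p) := by rw [norm_def, ← h]; ring
  have key : ∀ τ : QuadraticAlgebra ℤ (-38) 0, τ.norm = Y ^ 3 → α ∣ τ ^ p →
      τ ^ p = α ∨ (-τ) ^ p = α := by
    rintro τ hτ ⟨u, hu⟩
    have hu1 : u.norm = 1 := by
      have := congrArg QuadraticAlgebra.norm hu
      rw [norm_pow', map_mul, hτ, hα, ← pow_mul] at this
      exact mul_left_cancel₀ (pow_ne_zero (3 * p) hY.ne') (by linear_combination -this)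
    rcases unit_of_norm_one (by norm_num) u hu1 with rfl | rfl
    · left; rw [hu, mul_one]
    · right; rw [hp.neg_pow, hu]; ring
  obtain ⟨w, v, A, B, C, h1, h2, h3, h4, h5, h6, h7, h8, h9, h10⟩ :=
    exists_reduced (by norm_num) hY hn hα hc
  have hw := dvd_pow_of_par hn hY.ne' hα hc h1
  have hv := dvd_pow_of_par hn hY.ne' hα hc h2
  have hA := sq_lt_of_reduced h7 h8 h9 h10
  have hsq2 : ¬ IsSquare (2 : ZMod 19) := by decide
  have hsq3 : ¬ IsSquare (3 : ZMod 19) := by decide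
  have : Fact (Nat.Prime 19) := ⟨by norm_num⟩
  have hAs : IsSquare (A : ZMod 19) := by
    refine isSquare_of_norm (q := 19) hn' (d := 38) (by norm_num) h19 h (U := w.re) (V := w.im) ?_
    rw [norm_def] at h4
    linear_combination h4
  have hA1 : A = 1 ∨ A = 6 ∧ C = 7 ∧ (B = 4 ∨ B = -4) := by
    have : A ≤ 7 := by nlinarith
    obtain ⟨hB1, hB2⟩ := abs_le.mp h8
    interval_cases A
    · simp
    · exact absurd (by exact_mod_cast hAs) hsq2
    · exact absurd (by exact_mod_cast hAs) hsq3
    all_goals (right; interval_cases B <;> omega)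
  rcases hA1 with rfl | ⟨rfl, rfl, hB⟩
  · left
    obtain ⟨ρ, hρ⟩ := hw
    refine exists_root_of_one hn' (unit_of_norm_one (by norm_num)) (by rw [h4, one_mul]) ?_ hρ
    have := congrArg QuadraticAlgebra.norm hρ
    rw [norm_pow', map_mul, h4, hα, one_mul] at this
    exact mul_left_cancel₀ (pow_ne_zero (3 * p) hY.ne') (by linear_combination -this)
  right
  rw [pow_mul] at hw hv
  obtain ⟨w1, w2⟩ := w
  obtain ⟨v1, v2⟩ := v
  simp only [norm_def, polar] at h3 h4 h5 h6
  rcases hB with rfl | rfl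
  · have h5' : w1 * v1 + 38 * w2 * v2 = 2 * Y := by linarith
    have e1 : w1 = -2 * w2 + 6 * v2 := mul_left_cancel₀ hY.ne' (by
      linear_combination v2 * h4 - w1 * h3 - w2 * h5')
    have e2 : v1 = -7 * w2 + 2 * v2 := by
      have : 6 * v1 = 2 * w1 - 38 * w2 := mul_left_cancel₀ hY.ne' (by
        linear_combination (-v1) * h4 - 38 * w2 * h3 + w1 * h5')
      linarith
    have hYe : Y = 7 * w2 ^ 2 - 4 * w2 * v2 + 6 * v2 ^ 2 := by
      rw [e1] at h4; linarith
    have hN : (⟨cubeRe w2 v2, cubeIm w2 v2⟩ : QuadraticAlgebra ℤ (-38) 0).norm = Y ^ 3 := by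
      rw [norm_def, hYe, ← cube_norm]; ring
    have := key _ hN (dvd_pow_of_mul_coprime (κ := ⟨8, 2⟩) (κ' := ⟨1, -3⟩) (by norm_num [norm_def])
      (by convert hw using 2; rw [e1]; ext <;> simp [pow_succ, cubeRe, cubeIm] <;> ring)
      (by convert hv using 2; rw [e2]; ext <;> simp [pow_succ, cubeRe, cubeIm] <;> ring))
    rcases this with this | this
    · exact ⟨w2, v2, hYe, Or.inl this⟩
    · refine ⟨-w2, -v2, by rw [hYe]; ring, Or.inl ?_⟩
      rw [← this]; congr 1; ext <;> simp [cubeRe, cubeIm] <;> ring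
  · have h5' : w1 * v1 + 38 * w2 * v2 = -2 * Y := by linarith
    have e1 : w1 = 2 * w2 + 6 * v2 := mul_left_cancel₀ hY.ne' (by
      linear_combination v2 * h4 - w1 * h3 - w2 * h5')
    have e2 : v1 = -7 * w2 - 2 * v2 := by
      have : 6 * v1 = -2 * w1 - 38 * w2 := mul_left_cancel₀ hY.ne' (by
        linear_combination (-v1) * h4 - 38 * w2 * h3 + w1 * h5')
      linarith
    have hYe : Y = 7 * (-w2) ^ 2 - 4 * (-w2) * v2 + 6 * v2 ^ 2 := by
      rw [e1] at h4; linarith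
    have hN : (⟨cubeRe (-w2) v2, -cubeIm (-w2) v2⟩ : QuadraticAlgebra ℤ (-38) 0).norm = Y ^ 3 := by
      rw [norm_def, hYe, ← cube_norm]; ring
    have := key _ hN (dvd_pow_of_mul_coprime (κ := ⟨8, -2⟩) (κ' := ⟨-1, -3⟩)
      (by norm_num [norm_def])
      (by convert hw using 2; rw [e1]; ext <;> simp [pow_succ, cubeRe, cubeIm] <;> ring)
      (by convert hv using 2; rw [e2]; ext <;> simp [pow_succ, cubeRe, cubeIm] <;> ring))
    rcases this with this | this
    · exact ⟨-w2, v2, hYe, Or.inr this⟩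
    · refine ⟨w2, -v2, by rw [hYe]; ring, Or.inr ?_⟩
      rw [← this]; congr 1; ext <;> simp [cubeRe, cubeIm] <;> ring

end RootThirtyEight

section Setup
open QuadraticAlgebra

/-- A coprime solution of `x² + d z² = y ^ n` with `d * z` an `{2, 11, 19}`-unit. -/
structure Sol (d x z y : ℤ) (n : ℕ) : Prop where
  three_le : 3 ≤ y
  odd : ¬ (2 : ℤ) ∣ y
  x_pos : 0 < x
  z_pos : 0 < z
  su : SU z
  eq : x ^ 2 + d * z ^ 2 = y ^ n
  cop : ∀ q : ℕ, (q = 2 ∨ q = 11 ∨ q = 19) → (q : ℤ) ∣ d * z → ¬ (q : ℤ) ∣ y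

variable {d x z y : ℤ} {n : ℕ}

lemma isCoprime_of_primes (hz : SU z) (h : ∀ q : ℕ, (q = 2 ∨ q = 11 ∨ q = 19) → (q : ℤ) ∣ z →
    ¬ (q : ℤ) ∣ y) : IsCoprime z y := by
  rw [Int.isCoprime_iff_gcd_eq_one]
  by_contra hne
  obtain ⟨q, hq, hd⟩ := Nat.exists_prime_and_dvd hne
  have hd' : (q : ℤ) ∣ (Int.gcd z y : ℤ) := by exact_mod_cast hd
  have h1 := hd'.trans (Int.gcd_dvd_left z y)
  exact h q (hz.2 q hq h1) h1 (hd'.trans (Int.gcd_dvd_right z y))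

lemma Sol.coprime (h : Sol d x z y n) : IsCoprime z y :=
  isCoprime_of_primes h.su fun q hq hd => h.cop q hq (hd.mul_left d)

lemma Sol.pos (h : Sol d x z y n) : 0 < y := by linarith [h.three_le]

lemma Sol.root (h : Sol d x z y n) {j : ℕ} (hj : j ∣ n) (hn : n ≠ 0) : Sol d x z (y ^ (n / j)) j := by
  obtain ⟨m, rfl⟩ := hj
  have hj0 : 0 < j := Nat.pos_of_ne_zero (by rintro rfl; simp at hn)
  have hm : m ≠ 0 := by rintro rfl; simp at hn
  rw [Nat.mul_div_cancel_left _ hj0]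
  refine ⟨?_, ?_, h.x_pos, h.z_pos, h.su, ?_, ?_⟩
  · calc (3 : ℤ) ≤ y := h.three_le
      _ = y ^ 1 := (pow_one y).symm
      _ ≤ y ^ m := pow_le_pow_right₀ (by linarith [h.three_le]) (by omega)
  · exact fun h2 => h.odd (Int.prime_two.dvd_of_dvd_pow h2)
  · rw [h.eq, ← pow_mul, mul_comm]
  · intro q hq hd h2
    have hqp : Prime (q : ℤ) := by
      rw [← Nat.prime_iff_prime_int]; rcases hq with rfl | rfl | rfl <;> norm_num
    exact h.cop q hq hd (hqp.dvd_of_dvd_pow h2)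

lemma SU.one_or_neg_one {r : ℤ} (h : SU r)
    (h' : ∀ q : ℕ, (q = 2 ∨ q = 11 ∨ q = 19) → ¬ (q : ℤ) ∣ r) : r = 1 ∨ r = -1 := by
  rw [← Int.isUnit_iff, Int.isUnit_iff_natAbs_eq]
  by_contra hne
  obtain ⟨q, hq, hd⟩ := Nat.exists_prime_and_dvd hne
  have := Int.natCast_dvd.mpr hd
  exact h' q (h.2 q hq this) this

/-- Coordinates of a cube in `ℤ[√-d]`. -/
lemma cube_coords {w : QuadraticAlgebra ℤ (-d) 0} (h : w ^ 3 = ⟨x, z⟩) :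
    x = w.re * (w.re ^ 2 - 3 * d * w.im ^ 2) ∧ z = w.im * (3 * w.re ^ 2 - d * w.im ^ 2) := by
  have h1 := congrArg QuadraticAlgebra.re h
  have h2 := congrArg QuadraticAlgebra.im h
  simp [pow_succ] at h1 h2
  constructor
  · rw [← h1]; ring
  · rw [← h2]; ring

/-- In a cube, primes of `d` other than `3` do not divide the cofactor of the second coordinate. -/
lemma Sol.not_dvd_cofactor (h : Sol d x z y 3) {q : ℕ} (hq : q = 2 ∨ q = 11 ∨ q = 19)
    (hqd : (q : ℤ) ∣ d) {A B : ℤ} (hy : A ^ 2 + d * B ^ 2 = y) :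
    ¬ (q : ℤ) ∣ 3 * A ^ 2 - d * B ^ 2 := by
  intro hd
  have hqp : Prime (q : ℤ) := by
    rw [← Nat.prime_iff_prime_int]; rcases hq with rfl | rfl | rfl <;> norm_num
  have h3 : ¬ (q : ℤ) ∣ 3 := by rcases hq with rfl | rfl | rfl <;> norm_num
  have h4 : (q : ℤ) ∣ 3 * A ^ 2 := by
    have := dvd_add hd (hqd.mul_right (B ^ 2)); rwa [sub_add_cancel] at this
  refine h.cop q hq (hqd.mul_right z) ?_
  rw [← hy]
  exact dvd_add ((hqp.dvd_or_dvd h4).resolve_left h3) (hqd.mul_right _)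

/-- Bounded search for the reduced forms representing a norm that becomes rational after cubing. -/
lemma reduced_finite {d N K L c : ℕ} {A B C P Q : ℤ}
    (hfin : ∀ a ∈ Finset.Icc 1 N, ∀ b ∈ Finset.range (N + 1), (b ^ 2 + d) % a = 0 →
      a ^ 2 ≤ b ^ 2 + d → 2 * b ≤ a → ∀ q ∈ Finset.range K, ∀ p ∈ Finset.range L,
      p ^ 2 + d * q ^ 2 = a ^ 3 → q = 0 ∧ (a = 1 ∨ a = c))
    (hL : N ^ 3 < L ^ 2) (hK : N ^ 3 < d * K ^ 2) (hA : 0 < A) (hAN : A ≤ N) (hB : |B| ≤ A)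
    (hC : A ≤ C) (h : B ^ 2 + 4 * d = 4 * A * C) (hn : P ^ 2 + d * Q ^ 2 = A ^ 3) :
    Q = 0 ∧ (A = 1 ∨ A = c) := by
  obtain ⟨b, rfl⟩ : ∃ b, B = 2 * b := ⟨B / 2, by
    have : Even (B ^ 2) := ⟨2 * A * C - 2 * d, by linarith⟩
    have := (Int.even_pow' two_ne_zero).mp this
    rw [Int.even_iff] at this; omega⟩
  have hb : 2 * |b| ≤ A := by rwa [abs_mul, abs_two] at hB
  have hA3 : A ^ 3 ≤ (N : ℤ) ^ 3 := pow_le_pow_left₀ hA.le hAN 3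
  zify at hL hK
  have hQK : |Q| < K := abs_lt_of_sq_lt_sq (by
    by_contra! hcon
    have := mul_le_mul_of_nonneg_left hcon (Int.natCast_nonneg d)
    nlinarith [sq_nonneg P]) (by positivity)
  have hPL : |P| < L := abs_lt_of_sq_lt_sq (by
    have : (0 : ℤ) ≤ d * Q ^ 2 := by positivity
    linarith) (by positivity)
  have e1 : b ^ 2 + d = A * C := by linarith
  obtain ⟨a, rfl⟩ := Int.eq_ofNat_of_zero_le hA.le
  have e2 : ((b.natAbs ^ 2 + d : ℕ) : ℤ) = a * C := by push_cast; rw [sq_abs]; exact e1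
  have e3 : a ^ 2 ≤ b.natAbs ^ 2 + d := by zify; rw [sq_abs]; nlinarith
  have e4 : P.natAbs ^ 2 + d * Q.natAbs ^ 2 = a ^ 3 := by zify; rw [sq_abs, sq_abs]; linarith
  rw [Int.abs_eq_natAbs] at hb hQK hPL
  have := hfin a (by simp; omega) b.natAbs (by simp; omega)
    (Nat.mod_eq_zero_of_dvd (Int.natCast_dvd_natCast.mp ⟨C, e2⟩)) e3 (by omega) Q.natAbs
    (by simp; omega) P.natAbs (by simp; omega) e4
  omega

lemma no_sol_209 : ¬ Sol 209 x z y 3 := by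
  intro h
  obtain ⟨w, hw, hw3⟩ : ∃ w : QuadraticAlgebra ℤ (-209) 0, w.norm = y ∧ w ^ 3 = ⟨x, z⟩ := by
    obtain ⟨w, ρ, A, B, C, h1, h2, h3, h4, h5, h6, h7⟩ := exists_pow_eq_mul (a := -209) (b := 0)
      (by norm_num) h.pos three_ne_zero (α := ⟨x, z⟩) (by rw [norm_def, ← h.eq]; ring) h.coprime
    have hA := sq_lt_of_reduced h4 h5 h6 h7
    have hA16 : A ≤ 16 := by nlinarith
    obtain ⟨P, Q⟩ := ρ
    simp only [norm_def] at h2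
    have hPQ : Q = 0 ∧ (A = 1 ∨ A = (9 : ℕ)) :=
      reduced_finite (d := 209) (P := P) (N := 16) (K := 5) (L := 65) (by decide +kernel) (by norm_num)
        (by norm_num) h4 hA16 h5 h6 (by linear_combination h7) (by linear_combination h2)
    push_cast at hPQ
    obtain ⟨rfl, hA'⟩ := hPQ
    rcases hA' with rfl | rfl
    · exact exists_root_of_one (by decide) (unit_of_norm_one (by norm_num)) (by rw [h1, one_mul])
        (ρ := ⟨P, 0⟩) (by rw [norm_def]; simpa using h2) h3
    · obtain ⟨u, v⟩ := w
      have hP : P = 27 ∨ P = -27 := by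
        have : (P - 27) * (P + 27) = 0 := by linear_combination h2
        rcases mul_eq_zero.mp this with h | h <;> omega
      have e1 := congrArg QuadraticAlgebra.re h3
      have e2 := congrArg QuadraticAlgebra.im h3
      simp [pow_succ] at e1 e2
      rw [norm_def] at h1
      simp only at h1
      have hv : v % 3 = 0 := by
        have h27 : (v * (3 * u ^ 2 - 209 * v ^ 2)) % 3 = 0 := by
          rw [show v * (3 * u ^ 2 - 209 * v ^ 2) = z * P by linear_combination e2]
          rcases hP with rfl | rfl <;> omega
        have : v % 3 = 0 ∨ v % 3 = 1 ∨ v % 3 = 2 := by omega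
        rcases this with h1 | h1 | h1 <;> simp [Int.sub_emod, Int.mul_emod, sq, h1] at h27 ⊢
      have hu : u % 3 = 0 := by
        have h9 : (u * u + 209 * v * v) % 3 = 0 := by
          rw [show u * u + 209 * v * v = 9 * y by linear_combination h1]; omega
        have : u % 3 = 0 ∨ u % 3 = 1 ∨ u % 3 = 2 := by omega
        rcases this with h1 | h1 | h1 <;> simp [Int.add_emod, Int.mul_emod, h1, hv] at h9 ⊢
      obtain ⟨u, rfl⟩ := Int.dvd_of_emod_eq_zero hu
      obtain ⟨v, rfl⟩ := Int.dvd_of_emod_eq_zero hv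
      refine exists_root_of_one (by decide) (unit_of_norm_one (by norm_num))
        (w := ⟨u, v⟩) (ρ := ⟨P / 27, 0⟩) (by rw [norm_def]; simp only; linarith) ?_ ?_
      · rcases hP with rfl | rfl <;> simp [norm_def]
      · rcases hP with rfl | rfl <;> ext <;> simp [pow_succ] <;> linarith
  rw [norm_def] at hw
  obtain ⟨hx, hz⟩ := cube_coords hw3
  have hy : w.re ^ 2 + 209 * w.im ^ 2 = y := by rw [← hw]; ring
  have hpar : w.re % 2 = 0 ∧ w.im % 2 = 1 ∨ w.re % 2 = 1 ∧ w.im % 2 = 0 := by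
    have := h.odd
    rw [← hy] at this
    rcases Int.emod_two_eq_zero_or_one w.re with h1 | h1 <;>
      rcases Int.emod_two_eq_zero_or_one w.im with h2 | h2 <;> simp [h1, h2] <;> apply this
    · exact Int.dvd_of_emod_eq_zero (by simp [Int.add_emod, Int.mul_emod, sq, h1, h2])
    · exact Int.dvd_of_emod_eq_zero (by simp [Int.add_emod, Int.mul_emod, sq, h1, h2])
  have hr := (h.su.dvd (Dvd.intro_left _ hz.symm)).one_or_neg_one ?_
  · have h3 : (3 * w.re ^ 2 - 209 * w.im ^ 2) % 3 ≠ 2 := by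
      have : w.im % 3 = 0 ∨ w.im % 3 = 1 ∨ w.im % 3 = 2 := by omega
      rcases this with h1 | h1 | h1 <;> simp [Int.sub_emod, Int.mul_emod, sq, h1]
    have h4 : (3 * w.re ^ 2 - 209 * w.im ^ 2) % 4 = 3 := by
      rcases hpar with ⟨h1, h2⟩ | ⟨h1, h2⟩
      · obtain ⟨s, hs⟩ : ∃ s, w.re = 2 * s := ⟨w.re / 2, by omega⟩
        obtain ⟨t, ht⟩ : ∃ t, w.im = 2 * t + 1 := ⟨w.im / 2, by omega⟩
        rw [hs, ht]; ring_nf; omega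
      · obtain ⟨s, hs⟩ : ∃ s, w.re = 2 * s + 1 := ⟨w.re / 2, by omega⟩
        obtain ⟨t, ht⟩ : ∃ t, w.im = 2 * t := ⟨w.im / 2, by omega⟩
        rw [hs, ht]; ring_nf; omega
    omega
  · intro q hq
    rcases hq with rfl | rfl | rfl
    · intro h2
      rcases hpar with ⟨h3, h4⟩ | ⟨h3, h4⟩
      · obtain ⟨s, hs⟩ : ∃ s, w.re = 2 * s := ⟨w.re / 2, by omega⟩
        obtain ⟨t, ht⟩ : ∃ t, w.im = 2 * t + 1 := ⟨w.im / 2, by omega⟩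
        rw [hs, ht] at h2; ring_nf at h2; omega
      · obtain ⟨s, hs⟩ : ∃ s, w.re = 2 * s + 1 := ⟨w.re / 2, by omega⟩
        obtain ⟨t, ht⟩ : ∃ t, w.im = 2 * t := ⟨w.im / 2, by omega⟩
        rw [hs, ht] at h2; ring_nf at h2; omega
    · exact h.not_dvd_cofactor (by simp) (by norm_num) hy
    · exact h.not_dvd_cofactor (by simp) (by norm_num) hy

lemma no_sol_418 : ¬ Sol 418 x z y 3 := by
  intro h
  obtain ⟨w, hw, hw3⟩ : ∃ w : QuadraticAlgebra ℤ (-418) 0, w.norm = y ∧ w ^ 3 = ⟨x, z⟩ := by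
    obtain ⟨w, ρ, A, B, C, h1, h2, h3, h4, h5, h6, h7⟩ := exists_pow_eq_mul (a := -418) (b := 0)
      (by norm_num) h.pos three_ne_zero (α := ⟨x, z⟩) (by rw [norm_def, ← h.eq]; ring) h.coprime
    have hA := sq_lt_of_reduced h4 h5 h6 h7
    have hA23 : A ≤ 23 := by nlinarith
    have h2' := h2
    rw [norm_def] at h2'
    have hPQ : ρ.im = 0 ∧ (A = 1 ∨ A = (1 : ℕ)) :=
      reduced_finite (d := 418) (P := ρ.re) (N := 23) (K := 6) (L := 111) (by decide +kernel) (by norm_num)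
        (by norm_num) h4 hA23 h5 h6 (by linear_combination h7) (by linear_combination h2')
    obtain rfl : A = 1 := by push_cast at hPQ; tauto
    exact exists_root_of_one (by decide) (unit_of_norm_one (by norm_num)) (by rw [h1, one_mul])
      (by rw [h2, one_pow]) h3
  rw [norm_def] at hw
  obtain ⟨hx, hz⟩ := cube_coords hw3
  have hy : w.re ^ 2 + 418 * w.im ^ 2 = y := by rw [← hw]; ring
  have hodd : w.re % 2 = 1 := by
    have := h.odd
    rw [← hy] at this
    by_contra h1
    have h1 : w.re % 2 = 0 := by omega
    exact this (Int.dvd_of_emod_eq_zero (by simp [Int.add_emod, Int.mul_emod, sq, h1]))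
  have hr := (h.su.dvd (Dvd.intro_left _ hz.symm)).one_or_neg_one fun q hq => by
    rcases hq with rfl | rfl | rfl <;> exact h.not_dvd_cofactor (by simp) (by norm_num) hy
  have h3 : (3 * w.re ^ 2 - 418 * w.im ^ 2) % 3 ≠ 1 := by
    have : w.im % 3 = 0 ∨ w.im % 3 = 1 ∨ w.im % 3 = 2 := by omega
    rcases this with h1 | h1 | h1 <;> simp [Int.sub_emod, Int.mul_emod, sq, h1]
  have h4 : (3 * w.re ^ 2 - 418 * w.im ^ 2) % 8 ≠ 7 := by
    have h5 : w.re % 8 = 1 ∨ w.re % 8 = 3 ∨ w.re % 8 = 5 ∨ w.re % 8 = 7 := by omega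
    have h6 : w.im % 8 = 0 ∨ w.im % 8 = 1 ∨ w.im % 8 = 2 ∨ w.im % 8 = 3 ∨ w.im % 8 = 4 ∨
      w.im % 8 = 5 ∨ w.im % 8 = 6 ∨ w.im % 8 = 7 := by omega
    rcases h5 with h5 | h5 | h5 | h5 <;>
      rcases h6 with h6 | h6 | h6 | h6 | h6 | h6 | h6 | h6 <;>
      simp [Int.sub_emod, Int.mul_emod, sq, h5, h6]
  omega

end Setup

section Exist

lemma not_dvd_of_gcd {x y k l m n q : ℕ} (hn : n ≠ 0) (hgcd : Nat.gcd x y = 1)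
    (heq : x ^ 2 + 2 ^ k * 11 ^ l * 19 ^ m = y ^ n) (hq : q.Prime)
    (hd : q ∣ 2 ^ k * 11 ^ l * 19 ^ m) : ¬ q ∣ y := by
  intro hy
  have h1 : q ∣ x ^ 2 := (Nat.dvd_add_left hd).mp (heq ▸ dvd_pow hy hn)
  have := Nat.dvd_gcd (hq.dvd_of_dvd_pow h1) hy
  rw [hgcd] at this
  exact hq.one_lt.ne' (Nat.dvd_one.mp this)

lemma odd_of_eq {x y k l m n : ℕ} (hn : 3 ≤ n) (hgcd : Nat.gcd x y = 1)
    (heq : x ^ 2 + 2 ^ k * 11 ^ l * 19 ^ m = y ^ n) : ¬ 2 ∣ y := by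
  rcases Nat.eq_zero_or_pos k with rfl | hk
  · rintro ⟨t, rfl⟩
    have hx : x % 2 = 1 := by
      by_contra hx
      have : 2 ∣ Nat.gcd x (2 * t) := Nat.dvd_gcd (by omega) ⟨t, rfl⟩
      rw [hgcd] at this; omega
    have h8 : (2 * t) ^ n % 8 = 0 := by
      obtain ⟨r, rfl⟩ := Nat.exists_eq_add_of_le hn
      rw [pow_add, mul_pow]; norm_num [Nat.mul_mod]
    have hx2 : x ^ 2 % 8 = 1 := by
      have : x % 8 = 1 ∨ x % 8 = 3 ∨ x % 8 = 5 ∨ x % 8 = 7 := by omega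
      rcases this with h | h | h | h <;> simp [Nat.pow_mod, h]
    have h3 : ∀ j : ℕ, 3 ^ j % 8 = 1 ∨ 3 ^ j % 8 = 3 := by
      intro j
      induction j with
      | zero => simp
      | succ j ih => rw [pow_succ]; omega
    have hC : 11 ^ l * 19 ^ m % 8 = 3 ^ (l + m) % 8 := by
      rw [Nat.mul_mod, Nat.pow_mod 11, Nat.pow_mod 19, pow_add, Nat.mul_mod (3 ^ l),
        Nat.pow_mod 3 l, Nat.pow_mod 3 m]
    have := h3 (l + m)
    rw [pow_zero, one_mul] at heq
    omega
  · exact not_dvd_of_gcd (by omega) hgcd heq Nat.prime_two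
      (((dvd_pow_self 2 hk.ne').mul_right _).mul_right _)

lemma exists_sol {x y k l m n : ℕ} (hx : 0 < x) (hn : 3 ≤ n) (hgcd : Nat.gcd x y = 1)
    (heq : x ^ 2 + 2 ^ k * 11 ^ l * 19 ^ m = y ^ n) :
    ∃ d z : ℤ, (d = 1 ∨ d = 2 ∨ d = 11 ∨ d = 19 ∨ d = 22 ∨ d = 38 ∨ d = 209 ∨ d = 418) ∧
      d * z ^ 2 = 2 ^ k * 11 ^ l * 19 ^ m ∧ Sol d x z y n := by
  have hodd := odd_of_eq hn hgcd heq
  have hy3 : 3 ≤ y := by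
    have : y ≠ 1 := by
      rintro rfl
      rw [one_pow] at heq
      have : 0 < x ^ 2 := by positivity
      have : 0 < 2 ^ k * 11 ^ l * 19 ^ m := by positivity
      omega
    omega
  have hdz : ((2 : ℤ) ^ (k % 2) * 11 ^ (l % 2) * 19 ^ (m % 2)) *
      (2 ^ (k / 2) * 11 ^ (l / 2) * 19 ^ (m / 2)) ^ 2 = 2 ^ k * 11 ^ l * 19 ^ m := by
    conv_rhs => rw [← Nat.mod_add_div k 2, ← Nat.mod_add_div l 2, ← Nat.mod_add_div m 2]
    ring
  refine ⟨2 ^ (k % 2) * 11 ^ (l % 2) * 19 ^ (m % 2), 2 ^ (k / 2) * 11 ^ (l / 2) * 19 ^ (m / 2),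
    ?_, hdz, ⟨by exact_mod_cast hy3, by exact_mod_cast hodd, by exact_mod_cast hx, by positivity,
      SU.of_eq rfl, ?_, ?_⟩⟩
  · rcases Nat.mod_two_eq_zero_or_one k with h | h <;>
      rcases Nat.mod_two_eq_zero_or_one l with h' | h' <;>
      rcases Nat.mod_two_eq_zero_or_one m with h'' | h'' <;> simp [h, h', h'']
  · rw [hdz]; exact_mod_cast heq
  · intro q hq hd
    have hqp : q.Prime := by rcases hq with rfl | rfl | rfl <;> norm_num
    have : (q : ℤ) ∣ 2 ^ k * 11 ^ l * 19 ^ m := by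
      rw [← hdz, sq, ← mul_assoc]; exact hd.mul_right _
    have := not_dvd_of_gcd (by omega) hgcd heq hqp (by exact_mod_cast this)
    exact_mod_cast this

end Exist

section Fifteen
open QuadraticAlgebra
variable {a b : ℤ}

/-- The primitive part of the Lucas number of index fifteen. -/
def prim15 {R : Type*} [CommRing R] (P Q : R) : R :=
  Q ^ 4 - 8 * Q ^ 3 * (4 * Q - P ^ 2) + 14 * Q ^ 2 * (4 * Q - P ^ 2) ^ 2
    - 7 * Q * (4 * Q - P ^ 2) ^ 3 + (4 * Q - P ^ 2) ^ 4

lemma prim15_dvd (P Q : ℤ) : prim15 P Q ∣ luc P Q 15 :=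
  ⟨(P ^ 2 - Q) * (P ^ 4 - 3 * P ^ 2 * Q + Q ^ 2), by simp only [luc, prim15]; ring⟩

lemma prim15_ne_zero {q : ℕ} (hq : q = 2 ∨ q = 11 ∨ q = 19) (P Q : ZMod q) (hQ : Q ≠ 0) :
    prim15 P Q ≠ 0 := by
  rcases hq with rfl | rfl | rfl <;> revert P Q <;> unfold prim15 <;> decide +kernel

lemma prim15_cast (q : ℕ) (P Q : ℤ) : ((prim15 P Q : ℤ) : ZMod q) = prim15 (P : ZMod q) Q := by
  simp [prim15]

lemma no_index_fifteen {w : QuadraticAlgebra ℤ a b} {y Z : ℤ} (hy : 3 ≤ y) (hodd : ¬ (2 : ℤ) ∣ y)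
    (hw : w.norm = y) (hZ : (w ^ 15).im = Z) (hSU : SU Z)
    (hco : ∀ q : ℕ, (q = 2 ∨ q = 11 ∨ q = 19) → (q : ℤ) ∣ Z → ¬ (q : ℤ) ∣ y) : False := by
  rw [im_pow_eq, hw] at hZ
  set P := tr w
  have hZe : ∀ q : ℕ, (q = 2 ∨ q = 11 ∨ q = 19) → ∀ u : ℤ, u ∣ luc P y 15 → (q : ℤ) ∣ u →
      (y : ZMod q) ≠ 0 := by
    intro q hq u hu hd h0
    rw [ZMod.intCast_zmod_eq_zero_iff_dvd] at h0
    exact hco q hq (hZ ▸ (hd.trans hu).mul_left _) h0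
  have h3d : P ^ 2 - y ∣ luc P y 15 :=
    ⟨(P ^ 4 - 3 * P ^ 2 * y + y ^ 2) * prim15 P y, by simp only [luc, prim15]; ring⟩
  have h1 : prim15 P y = 1 := by
    have hpm := (hSU.dvd (hZ ▸ (prim15_dvd P y).mul_left _)).one_or_neg_one fun q hq hd => by
      refine prim15_ne_zero hq P y (hZe q hq _ (prim15_dvd P y) hd) ?_
      rw [← prim15_cast]
      exact (ZMod.intCast_zmod_eq_zero_iff_dvd _ _).mpr hd
    refine hpm.resolve_right fun h => ?_
    have h3 : ∀ P Q : ZMod 3, prim15 P Q ≠ -1 := by unfold prim15; decide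
    apply h3 P y
    rw [← prim15_cast, h]; simp
  have hr : SU (P ^ 2 - y) := hSU.dvd (hZ ▸ h3d.mul_left _)
  obtain ⟨i, j, k, hijk⟩ := hr.exists_pow
  have hj : ¬ (11 : ℤ) ∣ P ^ 2 - y := fun h => by
    have h11 : ∀ P Q : ZMod 11, Q ≠ 0 → P ^ 2 - Q = 0 → prim15 P Q ≠ 1 := by
      unfold prim15; decide +kernel
    apply h11 P y (hZe 11 (by simp) _ h3d h)
    · have := (ZMod.intCast_zmod_eq_zero_iff_dvd _ 11).mpr h; push_cast at this; exact this
    · rw [← prim15_cast, h1]; simp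
  have hk : ¬ (19 : ℤ) ∣ P ^ 2 - y := fun h => by
    have h19 : ∀ P Q : ZMod 19, Q ≠ 0 → P ^ 2 - Q = 0 → prim15 P Q ≠ 1 := by
      unfold prim15; decide +kernel
    apply h19 P y (hZe 19 (by simp) _ h3d h)
    · have := (ZMod.intCast_zmod_eq_zero_iff_dvd _ 19).mpr h; push_cast at this; exact this
    · rw [← prim15_cast, h1]; simp
  have hi : ¬ (4 : ℤ) ∣ P ^ 2 - y := fun h => by
    have h4 : ∀ P Q : ZMod 4, (Q = 1 ∨ Q = 3) → P ^ 2 - Q = 0 → prim15 P Q ≠ 1 := by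
      unfold prim15; decide
    apply h4 P y
    · have : y % 4 = 1 ∨ y % 4 = 3 := by omega
      rcases this with h | h
      · left; have := (ZMod.intCast_eq_intCast_iff' y 1 4).mpr (by push_cast; omega); simpa using this
      · right; have := (ZMod.intCast_eq_intCast_iff' y 3 4).mpr (by push_cast; omega); simpa using this
    · have := (ZMod.intCast_zmod_eq_zero_iff_dvd _ 4).mpr h; push_cast at this; exact this
    · rw [← prim15_cast, h1]; simp
  have hdd : ∀ u : ℤ, u ∣ 2 ^ i * 11 ^ j * 19 ^ k → u ∣ P ^ 2 - y := by
    intro u hu; rcases hijk with h | h <;> rw [h]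
    · exact hu
    · exact hu.neg_right
  obtain rfl : j = 0 := by
    by_contra h; exact hj (hdd _ (((dvd_pow_self 11 h).mul_left _).mul_right _))
  obtain rfl : k = 0 := by
    by_contra h; exact hk (hdd _ ((dvd_pow_self 19 h).mul_left _))
  have hi2 : i < 2 := by
    by_contra! h
    exact hi (hdd _ (((pow_dvd_pow 2 h).mul_right _).mul_right _))
  have hc : ∃ c r : ℤ, P ^ 2 - y = r ∧ c = 3 * y - r ∧
      r ^ 4 - 20 * r ^ 3 * c + 60 * r ^ 2 * c ^ 2 - 5 * r * c ^ 3 - 5 * c ^ 4 = 81 := by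
    refine ⟨_, _, rfl, rfl, ?_⟩
    unfold prim15 at h1
    linear_combination 81 * h1
  obtain ⟨c, r, hr, hc, h⟩ := hc
  rw [hr] at hijk
  interval_cases i <;> norm_num at hijk <;> rcases hijk with rfl | rfl
  · have : 5 * ((c - 2) ^ 2 * ((c + 1) * (c + 4))) = 0 := by linear_combination -h
    have : 0 < (c - 2) ^ 2 * ((c + 1) * (c + 4)) :=
      mul_pos (pow_pos (by linarith) 2) (mul_pos (by linarith) (by linarith))
    omega
  · have : 5 * ((c + 2) ^ 2 * ((c - 1) * (c - 4))) = 0 := by linear_combination -h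
    have : 0 < (c + 2) ^ 2 * ((c - 1) * (c - 4)) :=
      mul_pos (pow_pos (by linarith) 2) (mul_pos (by linarith) (by linarith))
    omega
  · have : 5 * ((c - 1) * (c ^ 3 + 3 * c ^ 2 - 45 * c - 13)) = 0 := by linear_combination -h
    have : 0 < (c - 1) * (c ^ 3 + 3 * c ^ 2 - 45 * c - 13) := by
      obtain ⟨t, rfl⟩ : ∃ t, c = t + 7 := ⟨c - 7, by ring⟩
      have ht : 0 ≤ t := by linarith
      refine mul_pos (by linarith) ?_
      ring_nf; positivity
    omega
  · have : 5 * ((c + 1) * (c ^ 3 - 3 * c ^ 2 - 45 * c + 13)) = 0 := by linear_combination -h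
    have : 0 < (c + 1) * (c ^ 3 - 3 * c ^ 2 - 45 * c + 13) := by
      obtain ⟨t, rfl⟩ : ∃ t, c = t + 11 := ⟨c - 11, by ring⟩
      have ht : 0 ≤ t := by linarith
      refine mul_pos (by linarith) ?_
      ring_nf; positivity
    omega

end Fifteen

section Nine
open QuadraticAlgebra
variable {a b d x z y : ℤ}

lemma SU.eq_pow_of_not_dvd {r : ℤ} (h : SU r) (h2 : ¬ (2 : ℤ) ∣ r) (h11 : ¬ (11 : ℤ) ∣ r) :
    ∃ e : ℕ, r = 19 ^ e ∨ r = -19 ^ e := by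
  obtain ⟨i, j, k, hijk⟩ := h.exists_pow
  have hdd : ∀ u : ℤ, u ∣ 2 ^ i * 11 ^ j * 19 ^ k → u ∣ r := by
    intro u hu; rcases hijk with h | h <;> rw [h]
    · exact hu
    · exact hu.neg_right
  obtain rfl : i = 0 := by
    by_contra h; exact h2 (hdd _ (((dvd_pow_self 2 h).mul_right _).mul_right _))
  obtain rfl : j = 0 := by
    by_contra h; exact h11 (hdd _ (((dvd_pow_self 11 h).mul_left _).mul_right _))
  exact ⟨k, by simpa using hijk⟩

lemma intCast_ne_zero_of_not_dvd {q : ℕ} {u : ℤ} (h : ¬ (q : ℤ) ∣ u) : (u : ZMod q) ≠ 0 :=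
  fun h' => h ((ZMod.intCast_zmod_eq_zero_iff_dvd _ _).mp h')

lemma intCast_eq_zero_of_dvd {q : ℕ} {u : ℤ} (h : (q : ℤ) ∣ u) : (u : ZMod q) = 0 :=
  (ZMod.intCast_zmod_eq_zero_iff_dvd _ _).mpr h

lemma ninth_cofactor {w : QuadraticAlgebra ℤ a b} {Z : ℤ} (hodd : ¬ (2 : ℤ) ∣ y)
    (hw : w.norm = y) (hZ : (w ^ 9).im = Z) (hSU : SU Z)
    (hco : ∀ q : ℕ, (q = 2 ∨ q = 11 ∨ q = 19) → (q : ℤ) ∣ Z → ¬ (q : ℤ) ∣ y) :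
    Z = w.im * (tr w ^ 2 - y) * ((tr w ^ 3 - 3 * tr w * y) ^ 2 - y ^ 3) ∧
    ∃ e : ℕ, (tr w ^ 3 - 3 * tr w * y) ^ 2 - y ^ 3 = 19 ^ e ∨
      (tr w ^ 3 - 3 * tr w * y) ^ 2 - y ^ 3 = -19 ^ e := by
  rw [im_pow_eq, hw] at hZ
  set P := tr w
  have hZe : Z = w.im * (P ^ 2 - y) * ((P ^ 3 - 3 * P * y) ^ 2 - y ^ 3) := by
    rw [← hZ]; simp only [luc]; ring
  have hd : (P ^ 3 - 3 * P * y) ^ 2 - y ^ 3 ∣ Z := hZe ▸ Dvd.intro_left _ rfl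
  refine ⟨hZe, (hSU.dvd hd).eq_pow_of_not_dvd ?_ ?_⟩
  · intro h
    have h2 : ∀ P y : ZMod 2, y ≠ 0 → (P ^ 3 - 3 * P * y) ^ 2 - y ^ 3 ≠ 0 := by decide
    refine h2 P y (intCast_ne_zero_of_not_dvd (by exact_mod_cast hodd)) ?_
    have := intCast_eq_zero_of_dvd (q := 2) h; push_cast at this; exact this
  · intro h
    have h2 : ∀ P y : ZMod 11, y ≠ 0 → (P ^ 3 - 3 * P * y) ^ 2 - y ^ 3 ≠ 0 := by decide +kernel
    refine h2 P y (intCast_ne_zero_of_not_dvd (hco 11 (by simp) (h.trans hd))) ?_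
    have := intCast_eq_zero_of_dvd (q := 11) h; push_cast at this; exact this

lemma no_sq_sub_one_eq_cube {A y : ℤ} (hy : 0 < y) : (2 * A - 1) * (2 * A + 1) ≠ y ^ 3 := by
  intro h
  have hc : IsCoprime (2 * A - 1) (2 * A + 1) := ⟨A, 1 - A, by ring⟩
  obtain ⟨⟨u, hu⟩, v, hv⟩ := Int.eq_pow_of_mul_eq_pow_odd hc (by decide) h
  rw [hu, hv, ← mul_pow] at h
  have huv : u * v = y := (Odd.strictMono_pow (by decide : Odd 3)).injective h
  have e : (v - u) * (v ^ 2 + u * v + u ^ 2) = 2 := by linear_combination hu - hv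
  have h2 : 3 ≤ v ^ 2 + u * v + u ^ 2 := by nlinarith [sq_nonneg (v - u)]
  have h1 : 1 ≤ v - u := by
    by_contra! h1
    nlinarith
  nlinarith

lemma no_sq_add_one_eq_cube {A y : ℤ} (hy : 1 < y) : A ^ 2 + 1 ≠ y ^ 3 := by
  intro h
  obtain ⟨w, hw, hw3⟩ := root_neg_one (x := A) (z := 1) (Y := y) (n := 3) (by linarith)
    (by decide) (by linarith) isCoprime_one_left
  obtain ⟨-, hz⟩ := cube_coords hw3
  rw [norm_def] at hw
  have hv : w.im = 1 ∨ w.im = -1 := Int.isUnit_iff.mp (IsUnit.of_mul_eq_one _ hz.symm)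
  rcases hv with hv | hv <;> rw [hv] at hz hw
  · omega
  · have : w.re = 0 := by
      have : w.re ^ 2 = 0 := by linarith
      exact pow_eq_zero_iff two_ne_zero |>.mp this
    rw [this] at hw
    omega

lemma three_not_dvd_of_SU {u : ℤ} (h : SU u) : ¬ (3 : ℤ) ∣ u := fun h3 => by
  have := h.2 3 (by norm_num) h3
  omega

lemma SU.two_mul (h : SU z) : SU (2 * z) := by
  refine ⟨mul_ne_zero two_ne_zero h.1, fun q hq hd => ?_⟩
  rcases (Nat.prime_iff_prime_int.mp hq).dvd_or_dvd hd with h2 | h2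
  · exact Or.inl ((Nat.prime_dvd_prime_iff_eq hq Nat.prime_two).mp (by exact_mod_cast h2))
  · exact h.2 q hq h2

lemma Sol.cop_two_mul {n : ℕ} (h : Sol d x z y n) (q : ℕ) (hq : q = 2 ∨ q = 11 ∨ q = 19)
    (hd : (q : ℤ) ∣ 2 * z) : ¬ (q : ℤ) ∣ y := by
  by_cases h2 : q = 2
  · subst h2; exact_mod_cast h.odd
  · have hqp : Prime (q : ℤ) := by
      rw [← Nat.prime_iff_prime_int]; rcases hq with rfl | rfl | rfl <;> norm_num
    refine h.cop q hq ((hqp.dvd_or_dvd hd).resolve_left (fun h3 => ?_) |>.mul_left d)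
    rcases hq with rfl | rfl | rfl
    · exact h2 rfl
    · norm_num at h3
    · norm_num at h3

lemma Sol.cop_self {n : ℕ} (h : Sol d x z y n) (q : ℕ) (hq : q = 2 ∨ q = 11 ∨ q = 19)
    (hd : (q : ℤ) ∣ z) : ¬ (q : ℤ) ∣ y := h.cop q hq (hd.mul_left d)

lemma Sol.not_dvd {n : ℕ} (h : Sol d x z y n) (q : ℕ) (hq : q = 2 ∨ q = 11 ∨ q = 19)
    (hd : (q : ℤ) ∣ d) : ¬ (q : ℤ) ∣ y := h.cop q hq (hd.mul_right z)

lemma eq_one_or_neg_one_of_not_dvd {r : ℤ} {e : ℕ} (he : r = 19 ^ e ∨ r = -19 ^ e)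
    (h : ¬ (19 : ℤ) ∣ r) : r = 1 ∨ r = -1 := by
  rcases Nat.eq_zero_or_pos e with rfl | he'
  · simpa using he
  · refine absurd ?_ h
    rcases he with rfl | rfl
    · exact dvd_pow_self 19 he'.ne'
    · exact (dvd_pow_self 19 he'.ne').neg_right

lemma no_nine_nineteen : ¬ Sol 19 x z y 9 := by
  intro h
  obtain ⟨w, hw, hw9⟩ := root_neg_nineteen h.pos (by decide) h.eq h.coprime
    (by have := h.odd; rw [Int.odd_iff]; omega)
  obtain ⟨hZ, e, he⟩ := ninth_cofactor h.odd hw (by rw [hw9]) h.su.two_mul h.cop_two_mul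
  have hy : (y : ZMod 19) ≠ 0 := intCast_ne_zero_of_not_dvd (h.cop 19 (by simp) (by norm_num))
  have hfin : ∀ u v : ZMod 19, u * u + u * v + 5 * v * v ≠ 0 →
      ((2 * u + v) ^ 3 - 3 * (2 * u + v) * (u * u + u * v + 5 * v * v)) ^ 2
        - (u * u + u * v + 5 * v * v) ^ 3 ∉ ({0, 1, -1} : Finset (ZMod 19)) := by decide +kernel
  rw [norm_def] at hw
  have hr : (((tr w ^ 3 - 3 * tr w * y) ^ 2 - y ^ 3 : ℤ) : ZMod 19) ∉
      ({0, 1, -1} : Finset (ZMod 19)) := by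
    rw [← hw] at hy ⊢
    have := hfin w.re w.im (by push_cast at hy; convert hy using 1; ring)
    rw [tr]; push_cast; convert this using 2; ring
  simp only [Finset.mem_insert, Finset.mem_singleton, not_or] at hr
  rcases eq_one_or_neg_one_of_not_dvd he (fun hd => hr.1 (intCast_eq_zero_of_dvd hd)) with h | h <;>
    rw [h] at hr <;> simp at hr

lemma nineteen_dvd_ninth_cofactor {w : QuadraticAlgebra ℤ (-d) 0} (hy3 : 3 ≤ y) {e : ℕ}
    (he : (tr w ^ 3 - 3 * tr w * y) ^ 2 - y ^ 3 = 19 ^ e ∨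
      (tr w ^ 3 - 3 * tr w * y) ^ 2 - y ^ 3 = -19 ^ e) :
    (19 : ℤ) ∣ (tr w ^ 3 - 3 * tr w * y) ^ 2 - y ^ 3 := by
  by_contra hd
  have hP : tr w = 2 * w.re := by simp [tr]
  rcases eq_one_or_neg_one_of_not_dvd he hd with h | h <;> rw [hP] at h
  · exact no_sq_sub_one_eq_cube (A := 4 * w.re ^ 3 - 3 * w.re * y)
      (y := y) (by linarith) (by linear_combination h)
  · exact no_sq_add_one_eq_cube (A := 2 * (4 * w.re ^ 3 - 3 * w.re * y))
      (y := y) (by linarith) (by linear_combination h)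

lemma no_nine_one : ¬ Sol 1 x z y 9 := by
  intro h
  obtain ⟨w, hw, hw9⟩ := root_neg_one (n := 9) h.pos (by decide) (by simpa using h.eq) h.coprime
  obtain ⟨hZ, e, he⟩ := ninth_cofactor h.odd hw (by rw [hw9]) h.su h.cop_self
  have hd := nineteen_dvd_ninth_cofactor (d := 1) h.three_le he
  have hy := intCast_ne_zero_of_not_dvd (h.cop_self 19 (by simp)
    (hd.trans (hZ ▸ Dvd.intro_left _ rfl)))
  have hfin : ∀ u v : ZMod 19, u * u + v * v ≠ 0 →
      ((2 * u) ^ 3 - 3 * (2 * u) * (u * u + v * v)) ^ 2 - (u * u + v * v) ^ 3 ≠ 0 := by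
    decide +kernel
  have hd' := intCast_eq_zero_of_dvd (q := 19) hd
  rw [norm_def] at hw
  rw [← hw] at hy hd'
  refine hfin w.re w.im ?_ ?_
  · push_cast at hy; convert hy using 1; ring
  · rw [tr] at hd'; push_cast at hd'; convert hd' using 1; ring

lemma no_nine_even {w : QuadraticAlgebra ℤ (-d) 0} (h : Sol d x z y 9)
    (hw : w.norm = y) (hw9 : w ^ 9 = ⟨x, z⟩) (h2d : (2 : ℤ) ∣ d)
    (h11 : (11 : ℤ) ∣ 3 * w.re ^ 2 - d * w.im ^ 2 → (11 : ℤ) ∣ y) :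
    SU w.im ∧ (3 * w.re ^ 2 - d * w.im ^ 2 = 1 ∨ 3 * w.re ^ 2 - d * w.im ^ 2 = -1) ∧
    ¬ (19 : ℤ) ∣ y ∧ (19 : ℤ) ∣ (tr w ^ 3 - 3 * tr w * y) ^ 2 - y ^ 3 ∧
    ∃ e : ℕ, (tr w ^ 3 - 3 * tr w * y) ^ 2 - y ^ 3 = 19 ^ e ∨
      (tr w ^ 3 - 3 * tr w * y) ^ 2 - y ^ 3 = -19 ^ e := by
  obtain ⟨hZ, e, he⟩ := ninth_cofactor h.odd hw (by rw [hw9]) h.su h.cop_self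
  have hd := nineteen_dvd_ninth_cofactor h.three_le he
  have hr1 : tr w ^ 2 - y = 3 * w.re ^ 2 - d * w.im ^ 2 := by
    rw [norm_def] at hw; rw [← hw, tr]; ring
  rw [hr1] at hZ
  have h1 : 3 * w.re ^ 2 - d * w.im ^ 2 ∣ z :=
    hZ ▸ (Dvd.intro_left _ rfl).mul_right _
  refine ⟨h.su.dvd ⟨_, by rw [hZ, mul_assoc]⟩, (h.su.dvd h1).one_or_neg_one ?_,
    h.cop_self 19 (by simp) (hd.trans (hZ ▸ Dvd.intro_left _ rfl)), hd, e, he⟩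
  rintro q (rfl | rfl | rfl) hq
  · have h4 : (2 : ℤ) ∣ w.re ^ 2 := by
      obtain ⟨c, rfl⟩ := h2d
      push_cast at hq
      have : 2 * c * w.im ^ 2 = 2 * (c * w.im ^ 2) := by ring
      omega
    apply h.odd
    rw [← hw, norm_def]
    have := dvd_add h4 (h2d.mul_right (w.im ^ 2))
    rwa [show w.re * w.re + 0 * w.re * w.im - -d * w.im * w.im = w.re ^ 2 + d * w.im ^ 2 by ring]
  · exact h.cop_self 11 (by simp) (hq.trans h1) (h11 hq)
  · have hy := h.cop_self 19 (by simp) (hq.trans h1)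
    push_cast at hq
    rw [← hr1] at hq
    have hp : Prime (19 : ℤ) := by norm_num
    obtain ⟨s, hs⟩ := hq
    have e1 : (tr w ^ 3 - 3 * tr w * y) ^ 2 - y ^ 3 =
        3 * y ^ 3 + 19 * (s * (tr w ^ 4 - 5 * tr w ^ 2 * y + 4 * y ^ 2)) := by
      linear_combination (tr w ^ 4 - 5 * tr w ^ 2 * y + 4 * y ^ 2) * hs
    rw [e1] at hd
    have h3 : (19 : ℤ) ∣ 3 * y ^ 3 := by omega
    exact hy (hp.dvd_of_dvd_pow ((hp.dvd_or_dvd h3).resolve_left (by norm_num)))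

lemma no_nine_two : ¬ Sol 2 x z y 9 := by
  intro h
  obtain ⟨w, hw, hw9⟩ := root_neg_two h.pos (by decide) h.eq h.coprime
  have hw' : w.re ^ 2 + 2 * w.im ^ 2 = y := by rw [← hw, norm_def]; ring
  have h11 : (11 : ℤ) ∣ 3 * w.re ^ 2 - 2 * w.im ^ 2 → (11 : ℤ) ∣ y := by
    have : ∀ u v : ZMod 11, 3 * u ^ 2 - 2 * v ^ 2 = 0 → u ^ 2 + 2 * v ^ 2 = 0 := by decide +kernel
    intro h11
    have h11 := intCast_eq_zero_of_dvd (q := 11) h11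
    refine (ZMod.intCast_zmod_eq_zero_iff_dvd y 11).mp ?_
    rw [← hw']; push_cast at h11 ⊢; exact this _ _ h11
  obtain ⟨hv, hr, hy, hd, e, he⟩ := no_nine_even h hw hw9 (by norm_num) h11
  have hP : tr w = 2 * w.re := by simp [tr]
  have h3 := three_not_dvd_of_SU hv
  replace hr : 3 * w.re ^ 2 - 2 * w.im ^ 2 = 1 := by
    refine hr.resolve_right fun hr => ?_
    have : ∀ u v : ZMod 3, v ≠ 0 → 3 * u ^ 2 - 2 * v ^ 2 ≠ -1 := by decide
    refine this w.re w.im (intCast_ne_zero_of_not_dvd h3) ?_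
    exact_mod_cast congrArg (Int.cast : ℤ → ZMod 3) hr
  rw [hP, ← hw'] at hd he
  have h5 : (w.im : ZMod 5) ^ 2 = 1 := by
    obtain ⟨i, j, k, hijk⟩ := hv.exists_pow
    have hdd : ∀ u : ℤ, u ∣ 2 ^ i * 11 ^ j * 19 ^ k → u ∣ w.im := by
      intro u hu; rcases hijk with h | h <;> rw [h]
      · exact hu
      · exact hu.neg_right
    obtain rfl : i = 0 := by
      by_contra h0
      obtain ⟨c, hc⟩ := hdd 2 (((dvd_pow_self 2 h0).mul_right _).mul_right _)
      have : ∀ u v : ZMod 8, 3 * u ^ 2 - 2 * (2 * v) ^ 2 ≠ 1 := by decide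
      apply this w.re c
      rw [hc] at hr
      exact_mod_cast congrArg (Int.cast : ℤ → ZMod 8) hr
    obtain rfl : k = 0 := by
      by_contra h0
      have hv0 := intCast_eq_zero_of_dvd (q := 19) (hdd 19 ((dvd_pow_self 19 h0).mul_left _))
      have hd := intCast_eq_zero_of_dvd (q := 19) hd
      have hy := intCast_ne_zero_of_not_dvd (q := 19) hy
      rw [← hw'] at hy
      push_cast at hd hy
      rw [hv0] at hd hy
      revert hd hy
      generalize (w.re : ZMod 19) = u
      revert u
      decide
    have : (11 : ZMod 5) = 1 := by decide
    rcases hijk with h | h <;> rw [h] <;> push_cast <;> rw [this] <;> simp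
  have hr5 : 3 * (w.re : ZMod 5) ^ 2 - 2 * (w.im : ZMod 5) ^ 2 = 1 := by
    exact_mod_cast congrArg (Int.cast : ℤ → ZMod 5) hr
  have hfin : ∀ u v : ZMod 5, v ^ 2 = 1 → 3 * u ^ 2 - 2 * v ^ 2 = 1 → ((2 * u) ^ 3 -
      3 * (2 * u) * (u ^ 2 + 2 * v ^ 2)) ^ 2 - (u ^ 2 + 2 * v ^ 2) ^ 3 = 3 := by decide +kernel
  have h19 : ((19 : ZMod 5) ^ e) = 1 ∨ (19 : ZMod 5) ^ e = -1 :=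
    neg_one_pow_eq_or (ZMod 5) e
  have := hfin _ _ h5 hr5
  rcases he with he | he
  · have he := congrArg (Int.cast : ℤ → ZMod 5) he
    push_cast at he
    rw [this] at he
    rcases h19 with h | h <;> rw [h] at he <;> exact absurd he (by decide)
  · have he := congrArg (Int.cast : ℤ → ZMod 5) he
    push_cast at he
    rw [this] at he
    rcases h19 with h | h <;> rw [h] at he <;> exact absurd he (by decide)

lemma no_nine_twentytwo : ¬ Sol 22 x z y 9 := by
  intro h
  obtain ⟨w, hw, hw9⟩ := root_neg_twentytwo h.pos (by decide) h.eq h.coprime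
    (h.not_dvd 11 (by simp) (by norm_num))
  have h11 : (11 : ℤ) ∣ 3 * w.re ^ 2 - 22 * w.im ^ 2 → (11 : ℤ) ∣ y := by
    intro h11
    rw [← hw, norm_def]
    have : (11 : ℤ) ∣ w.re ^ 2 := by omega
    rw [show w.re * w.re + 0 * w.re * w.im - -22 * w.im * w.im =
      w.re ^ 2 + 11 * (2 * w.im ^ 2) by ring]
    omega
  obtain ⟨hv, hr, -⟩ := no_nine_even h hw hw9 (by norm_num) h11
  have h3 := three_not_dvd_of_SU hv
  have hv3 : ∀ u v : ZMod 3, v ≠ 0 → 3 * u ^ 2 - 22 * v ^ 2 ≠ 1 := by decide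
  have hu11 : ∀ u v : ZMod 11, 3 * u ^ 2 - 22 * v ^ 2 ≠ -1 := by decide +kernel
  rcases hr with hr | hr
  · refine hv3 w.re w.im (intCast_ne_zero_of_not_dvd h3) ?_
    exact_mod_cast congrArg (Int.cast : ℤ → ZMod 3) hr
  · refine hu11 w.re w.im ?_
    exact_mod_cast congrArg (Int.cast : ℤ → ZMod 11) hr

lemma no_nine_eleven : ¬ Sol 11 x z y 9 := by
  intro h
  obtain ⟨w, hw, hw9⟩ := root_neg_eleven h.pos (by decide) h.eq h.coprime
    (by have := h.odd; rw [Int.odd_iff]; omega)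
  obtain ⟨hZ, e, he⟩ := ninth_cofactor h.odd hw (by rw [hw9]) h.su.two_mul h.cop_two_mul
  have hy11 := h.not_dvd 11 (by simp) (by norm_num)
  have hP2 : tr w ^ 2 = 4 * y - 11 * w.im ^ 2 := by rw [tr_sq, hw]; ring
  have hr2 : (tr w ^ 3 - 3 * tr w * y) ^ 2 - y ^ 3 =
      3 * y ^ 3 - 11 * w.im ^ 2 * (3 * y - 11 * w.im ^ 2) ^ 2 := by
    rw [show (tr w ^ 3 - 3 * tr w * y) ^ 2 = tr w ^ 2 * (tr w ^ 2 - 3 * y) ^ 2 by ring, hP2]; ring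
  rw [hr2, hP2] at hZ
  rw [hr2] at he
  set v := w.im
  set r := 4 * y - 11 * v ^ 2 - y
  have hvd : v ∣ 2 * z := hZ ▸ ((Dvd.intro _ rfl).mul_right _)
  have hrd : r ∣ 2 * z := hZ ▸ (Dvd.intro_left _ rfl).mul_right _
  have hv := h.su.two_mul.dvd hvd
  have hr := h.su.two_mul.dvd hrd
  have hr' : 3 * y - 11 * v ^ 2 = r := by ring
  rw [hr'] at he hZ
  have hfin19 : ∀ P v : ZMod 19, P ^ 2 + 11 * v ^ 2 ≠ 0 → P ^ 2 + 11 * v ^ 2 = 4 * (11 * v ^ 2 * 13) ∨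
      3 * (5 * (P ^ 2 + 11 * v ^ 2)) ^ 3 - 11 * v ^ 2 * (3 * (5 * (P ^ 2 + 11 * v ^ 2)) - 11 * v ^ 2) ^ 2 = 0 →
      False := by decide +kernel
  have hy19 : (y : ZMod 19) = 5 * ((tr w : ZMod 19) ^ 2 + 11 * (v : ZMod 19) ^ 2) := by
    have := congrArg (Int.cast : ℤ → ZMod 19) hP2
    push_cast at this
    rw [this, show (4 * (y : ZMod 19) - 11 * (v : ZMod 19) ^ 2 + 11 * (v : ZMod 19) ^ 2) = 4 * y by ring,
      ← mul_assoc, show (5 * 4 : ZMod 19) = 1 by decide, one_mul]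
  have hr19 : ¬ (19 : ℤ) ∣ r := by
    intro hd
    have hy := intCast_ne_zero_of_not_dvd (h.cop_two_mul 19 (by simp) (hd.trans hrd))
    have hd := intCast_eq_zero_of_dvd (q := 19) (hr' ▸ hd)
    push_cast at hd
    have h3 : (y : ZMod 19) = 11 * v ^ 2 * 13 := by
      linear_combination (13 : ZMod 19) * hd - (2 * y : ZMod 19) * (by decide : (19 : ZMod 19) = 0)
    rw [hy19] at hy
    refine hfin19 (tr w) v (right_ne_zero_of_mul hy) (Or.inl ?_)
    linear_combination 4 * h3 - 4 * hy19 -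
      ((tr w : ZMod 19) ^ 2 + 11 * (v : ZMod 19) ^ 2) * (by decide : (19 : ZMod 19) = 0)
  have hv3 := intCast_ne_zero_of_not_dvd (q := 3) (three_not_dvd_of_SU hv)
  have hr2' : 3 * y ^ 3 - 11 * v ^ 2 * r ^ 2 = 1 := by
    refine (eq_one_or_neg_one_of_not_dvd he ?_).resolve_right ?_
    · intro hd
      have hy := intCast_ne_zero_of_not_dvd (h.cop_two_mul 19 (by simp)
        (hd.trans (hZ ▸ Dvd.intro_left _ rfl)))
      have hd := intCast_eq_zero_of_dvd (q := 19) (hr' ▸ hd)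
      push_cast at hd
      rw [hy19] at hy hd
      exact hfin19 (tr w) v (right_ne_zero_of_mul hy) (Or.inr hd)
    · intro hd
      have : ∀ v r : ZMod 3, v ≠ 0 → r ≠ 0 → ∀ y : ZMod 3, 3 * y ^ 3 - 11 * v ^ 2 * r ^ 2 ≠ -1 := by
        decide
      refine this v r hv3 (intCast_ne_zero_of_not_dvd (three_not_dvd_of_SU hr)) y ?_
      exact_mod_cast congrArg (Int.cast : ℤ → ZMod 3) hd
  obtain ⟨i, hi⟩ : ∃ i : ℕ, r = (-2) ^ i := by
    obtain ⟨i, j, k, hijk⟩ := hr.exists_pow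
    have hdd : ∀ u : ℤ, u ∣ 2 ^ i * 11 ^ j * 19 ^ k → u ∣ r := by
      intro u hu; rcases hijk with h | h <;> rw [h]
      · exact hu
      · exact hu.neg_right
    obtain rfl : k = 0 := by
      by_contra h0
      exact hr19 (hdd 19 ((dvd_pow_self 19 h0).mul_left _))
    obtain rfl : j = 0 := by
      by_contra h0
      have := hdd 11 (((dvd_pow_self 11 h0).mul_left _).mul_right _)
      exact hy11 (by push_cast; omega)
    have h3 : ∀ v y : ZMod 3, v ≠ 0 → 3 * y - 11 * v ^ 2 = 1 := by decide
    have h3 := h3 v y hv3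
    have h3' : (r : ZMod 3) = 1 := by rw [← h3, ← hr']; push_cast; ring
    refine ⟨i, ?_⟩
    have hijk : r = 2 ^ i ∨ r = -2 ^ i := by simpa using hijk
    have h2 : (2 : ZMod 3) ^ 2 = 1 := by decide
    rcases Nat.even_or_odd' i with ⟨m, rfl | rfl⟩
    · rw [(even_two_mul m).neg_pow]
      refine hijk.resolve_right fun hn => ?_
      rw [hn] at h3'
      push_cast at h3'
      rw [pow_mul, h2, one_pow] at h3'
      exact absurd h3' (by decide)
    · rw [(odd_two_mul_add_one m).neg_pow]
      refine hijk.resolve_left fun hn => ?_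
      rw [hn] at h3'
      push_cast at h3'
      rw [pow_succ, pow_mul, h2, one_pow, one_mul] at h3'
      exact absurd h3' (by decide)
  obtain ⟨i', j, k, hijk⟩ := hv.exists_pow
  have hdd : ∀ u : ℤ, u ∣ 2 ^ i' * 11 ^ j * 19 ^ k → u ∣ v := by
    intro u hu; rcases hijk with h | h <;> rw [h]
    · exact hu
    · exact hu.neg_right
  obtain rfl : i' = 0 := by
    by_contra h0
    have h2 := hdd 2 (((dvd_pow_self 2 h0).mul_right _).mul_right _)
    have h2r : ¬ (2 : ℤ) ∣ r := by
      obtain ⟨c, hc⟩ := h2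
      rw [← hr', hc, show 3 * y - 11 * (2 * c) ^ 2 = 3 * y - 2 * (22 * c ^ 2) by ring]
      have := h.odd
      omega
    obtain rfl : i = 0 := by
      by_contra h1
      exact h2r (hi ▸ (by norm_num : (2 : ℤ) ∣ -2).trans (dvd_pow_self (-2) h1))
    rw [pow_zero] at hi
    rw [hi] at hr2' hr'
    have h3 := h.three_le
    nlinarith [mul_pos (by linarith : 0 < y) (by linarith : 0 < y)]
  obtain rfl : k = 0 := by
    by_contra h0
    have := intCast_eq_zero_of_dvd (q := 19) (hdd 19 ((dvd_pow_self 19 h0).mul_left _))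
    have h1 := congrArg (Int.cast : ℤ → ZMod 19) hr2'
    push_cast at h1
    rw [this] at h1
    have hfin : ∀ y : ZMod 19, 3 * y ^ 3 ≠ 1 := by decide
    exact hfin y (by simpa using h1)
  have hv2 : v ^ 2 = 121 ^ j := by
    rw [show (121 : ℤ) = 11 ^ 2 by norm_num, ← pow_mul, mul_comm, pow_mul]
    rcases hijk with h | h <;> rw [h] <;> ring
  have e1 := congrArg (Int.cast : ℤ → ZMod 19) hr'
  have e2 := congrArg (Int.cast : ℤ → ZMod 19) hr2'
  rw [hv2, hi] at e1 e2
  push_cast at e1 e2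
  rw [pow_eq_pow_mod j (by decide : (121 : ZMod 19) ^ 3 = 1),
    pow_eq_pow_mod i (by decide : (-2 : ZMod 19) ^ 9 = 1)] at e1 e2
  have hfin : ∀ (j : Fin 3) (i : Fin 9) (y : ZMod 19), 3 * y - 11 * 121 ^ (j : ℕ) = (-2) ^ (i : ℕ) →
      3 * y ^ 3 - 11 * 121 ^ (j : ℕ) * ((-2) ^ (i : ℕ)) ^ 2 ≠ 1 := by decide +kernel
  exact hfin ⟨j % 3, Nat.mod_lt _ (by norm_num)⟩ ⟨i % 9, Nat.mod_lt _ (by norm_num)⟩ y e1 e2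

lemma no_nine_thirtyeight : ¬ Sol 38 x z y 9 := by
  intro h
  have h' := h.root (j := 3) (by norm_num) (by norm_num)
  norm_num at h'
  have h19 := h.not_dvd 19 (by simp) (by norm_num)
  obtain ⟨w, hw, hw3⟩ : ∃ w : QuadraticAlgebra ℤ (-38) 0, w.norm = y ^ 3 ∧ w ^ 3 = ⟨x, z⟩ := by
    rcases root_neg_thirtyeight (p := 3) h.pos (by decide) h.eq h.coprime h19 with
      ⟨w, hw, hw9⟩ | ⟨s, t, hy, hw | hw⟩
    · exact ⟨w ^ 3, by rw [map_pow, hw], by rw [← pow_mul, hw9]⟩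
    · exact ⟨_, by rw [hy, ← cube_norm, norm_def]; ring, hw⟩
    · exact ⟨_, by rw [hy, ← cube_norm, norm_def]; ring, hw⟩
  rw [norm_def] at hw
  obtain ⟨-, hz⟩ := cube_coords hw3
  have hy : w.re ^ 2 + 38 * w.im ^ 2 = y ^ 3 := by rw [← hw]; ring
  obtain ⟨i, j, k, hijk⟩ := (h.su.dvd (Dvd.intro_left _ hz.symm)).exists_pow
  have hdd : ∀ u : ℤ, u ∣ 2 ^ i * 11 ^ j * 19 ^ k → u ∣ 3 * w.re ^ 2 - 38 * w.im ^ 2 := by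
    intro u hu; rcases hijk with h | h <;> rw [h]
    · exact hu
    · exact hu.neg_right
  obtain rfl : i = 0 := by
    by_contra h0
    exact h'.not_dvd_cofactor (q := 2) (by simp) (by norm_num) hy
      (hdd _ (((dvd_pow_self 2 h0).mul_right _).mul_right _))
  obtain rfl : k = 0 := by
    by_contra h0
    exact h'.not_dvd_cofactor (q := 19) (by simp) (by norm_num) hy
      (hdd _ ((dvd_pow_self 19 h0).mul_left _))
  have hfin : ∀ u v y : ZMod 19, y ≠ 0 → u ^ 2 + 38 * v ^ 2 = y ^ 3 →
      ∀ j : Fin 3, 3 * u ^ 2 - 38 * v ^ 2 ≠ 11 ^ (j : ℕ) ∧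
        3 * u ^ 2 - 38 * v ^ 2 ≠ -11 ^ (j : ℕ) := by decide +kernel
  have := hfin w.re w.im y (intCast_ne_zero_of_not_dvd h19)
    (by exact_mod_cast congrArg (Int.cast : ℤ → ZMod 19) hy) ⟨j % 3, Nat.mod_lt _ (by norm_num)⟩
  simp only [← pow_eq_pow_mod j (by decide : (11 : ZMod 19) ^ 3 = 1)] at this
  rcases hijk with h | h
  · exact this.1 (by simpa using congrArg (Int.cast : ℤ → ZMod 19) h)
  · exact this.2 (by simpa using congrArg (Int.cast : ℤ → ZMod 19) h)

lemma no_index_nine (hd : d = 1 ∨ d = 2 ∨ d = 11 ∨ d = 19 ∨ d = 22 ∨ d = 38 ∨ d = 209 ∨ d = 418) :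
    ¬ Sol d x z y 9 := by
  rcases hd with rfl | rfl | rfl | rfl | rfl | rfl | rfl | rfl
  · exact no_nine_one
  · exact no_nine_two
  · exact no_nine_eleven
  · exact no_nine_nineteen
  · exact no_nine_twentytwo
  · exact no_nine_thirtyeight
  · exact fun h => no_sol_209 (h.root (by norm_num) (by norm_num))
  · exact fun h => no_sol_418 (h.root (by norm_num) (by norm_num))

end Nine

section Six
open QuadraticAlgebra
variable {d x z y : ℤ}

lemma SU.exists_pow_of_pos {n : ℤ} (h : SU n) (hn : 0 < n) : ∃ i j k : ℕ,
    n = 2 ^ i * 11 ^ j * 19 ^ k ∧ (¬ (2 : ℤ) ∣ n → i = 0) ∧ (¬ (11 : ℤ) ∣ n → j = 0) ∧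
    (¬ (19 : ℤ) ∣ n → k = 0) := by
  obtain ⟨i, j, k, hijk⟩ := h.exists_pow
  have hpos : (0 : ℤ) < 2 ^ i * 11 ^ j * 19 ^ k := by positivity
  replace hijk := hijk.resolve_right (by rintro rfl; linarith)
  refine ⟨i, j, k, hijk, ?_, ?_, ?_⟩ <;> intro hd <;> by_contra h0 <;> apply hd <;> rw [hijk]
  · exact ((dvd_pow_self 2 h0).mul_right _).mul_right _
  · exact ((dvd_pow_self 11 h0).mul_left _).mul_right _
  · exact (dvd_pow_self 19 h0).mul_left _

lemma SU.neg {n : ℤ} (h : SU n) : SU (-n) := h.dvd (by simp)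

lemma SU.mul {m n : ℤ} (hm : SU m) (hn : SU n) : SU (m * n) := by
  refine ⟨mul_ne_zero hm.1 hn.1, fun q hq hd => ?_⟩
  rcases (Nat.prime_iff_prime_int.mp hq).dvd_or_dvd hd with h | h
  exacts [hm.2 q hq h, hn.2 q hq h]

lemma SU.sq {n : ℤ} (h : SU n) : SU (n ^ 2) := by rw [_root_.sq]; exact h.mul h

/-- A sign-free form of `SU.exists_pow`. -/
lemma SU.exists_pow_abs {n : ℤ} (h : SU n) : ∃ i j k : ℕ, (n = 2 ^ i * 11 ^ j * 19 ^ k ∨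
    n = -(2 ^ i * 11 ^ j * 19 ^ k)) ∧ (¬ (2 : ℤ) ∣ n → i = 0) ∧ (¬ (11 : ℤ) ∣ n → j = 0) ∧
    (¬ (19 : ℤ) ∣ n → k = 0) := by
  rcases h.1.lt_or_gt with h0 | h0
  · obtain ⟨i, j, k, hijk, h2, h11, h19⟩ := h.neg.exists_pow_of_pos (by linarith)
    simp only [dvd_neg] at h2 h11 h19
    exact ⟨i, j, k, Or.inr (by linarith), h2, h11, h19⟩
  · obtain ⟨i, j, k, hijk, h⟩ := h.exists_pow_of_pos h0
    exact ⟨i, j, k, Or.inl hijk, h⟩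

lemma eq_pow_of_mul_eq {q : ℕ} (hq : q.Prime) {U V : ℤ} {u : ℕ}
    (h : U * V = q ^ u ∨ U * V = -q ^ u) (hn : (q : ℤ) ∣ U → ¬ (q : ℤ) ∣ V) :
    ((U = 1 ∨ U = -1) ∧ (V = q ^ u ∨ V = -q ^ u)) ∨
    ((V = 1 ∨ V = -1) ∧ (U = q ^ u ∨ U = -q ^ u)) := by
  have hqi := Nat.prime_iff_prime_int.mp hq
  have hU : U ∣ q ^ u := by
    rcases h with h | h
    · exact ⟨V, h.symm⟩
    · exact ⟨-V, by linarith⟩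
  obtain ⟨a, -, ha⟩ := (dvd_prime_pow hqi _).mp hU
  have hV : V ∣ q ^ u := by
    rcases h with h | h
    · exact ⟨U, by linarith⟩
    · exact ⟨-U, by linarith⟩
  rw [Int.associated_iff] at ha
  rcases Nat.eq_zero_or_pos a with rfl | ha0
  · rw [pow_zero] at ha
    refine Or.inl ⟨ha, ?_⟩
    rcases ha with rfl | rfl <;> rcases h with h | h
    · left; linarith
    · right; linarith
    · right; linarith
    · left; linarith
  · have hqU : (q : ℤ) ∣ U := by
      rcases ha with rfl | rfl
      · exact dvd_pow_self _ ha0.ne'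
      · exact (dvd_pow_self _ ha0.ne').neg_right
    obtain ⟨b, -, hb⟩ := (dvd_prime_pow hqi _).mp hV
    rw [Int.associated_iff] at hb
    rcases Nat.eq_zero_or_pos b with rfl | hb0
    · rw [pow_zero] at hb
      refine Or.inr ⟨hb, ?_⟩
      rcases hb with rfl | rfl <;> rcases h with h | h
      · left; linarith
      · right; linarith
      · right; linarith
      · left; linarith
    · refine absurd ?_ (hn hqU)
      rcases hb with rfl | rfl
      · exact dvd_pow_self _ hb0.ne'
      · exact (dvd_pow_self _ hb0.ne').neg_right

/-- Data of a cube root for an exponent divisible by `6`. -/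
lemma Sol.root_six (h : Sol d x z y 6) {w : QuadraticAlgebra ℤ (-d) 0} (hw : w.norm = y ^ 2)
    (hw3 : w ^ 3 = ⟨x, z⟩) : w.re ^ 2 + d * w.im ^ 2 = y ^ 2 ∧
    z = w.im * (4 * w.re ^ 2 - y ^ 2) ∧ SU w.im ∧ SU (4 * w.re ^ 2 - y ^ 2) ∧
    ¬ (2 : ℤ) ∣ 4 * w.re ^ 2 - y ^ 2 := by
  rw [norm_def] at hw
  have hy : w.re ^ 2 + d * w.im ^ 2 = y ^ 2 := by rw [← hw]; ring
  obtain ⟨-, hz⟩ := cube_coords hw3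
  rw [show 3 * w.re ^ 2 - d * w.im ^ 2 = 4 * w.re ^ 2 - y ^ 2 by linarith] at hz
  refine ⟨hy, hz, h.su.dvd (hz ▸ Dvd.intro _ rfl), h.su.dvd (hz ▸ Dvd.intro_left _ rfl), ?_⟩
  intro h2
  have : (2 : ℤ) ∣ y ^ 2 := by omega
  exact h.odd (Int.prime_two.dvd_of_dvd_pow this)

lemma no_six_twentytwo : ¬ Sol 22 x z y 6 := by
  intro h
  have h' := h.root (j := 3) (by norm_num) (by norm_num)
  norm_num at h'
  obtain ⟨w, hw, hw3⟩ := root_neg_twentytwo h'.pos (by decide) h'.eq h'.coprime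
    (h'.not_dvd 11 (by simp) (by norm_num))
  obtain ⟨hy, -, hB, hr, h2⟩ := h.root_six hw hw3
  have h11 : ¬ (11 : ℤ) ∣ 4 * w.re ^ 2 - y ^ 2 := by
    intro h11
    refine h'.not_dvd 11 (by simp) (by norm_num) ?_
    push_cast
    have : (11 : ℤ) ∣ w.re ^ 2 := by omega
    omega
  obtain ⟨i, j, k, hijk, hi, hj, -⟩ := hr.exists_pow_abs
  obtain rfl := hi h2
  obtain rfl := hj h11
  simp only [pow_zero, one_mul] at hijk
  have hy11 := intCast_ne_zero_of_not_dvd (q := 11) (h.not_dvd 11 (by simp) (by norm_num))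
  have hB3 := intCast_ne_zero_of_not_dvd (q := 3) (three_not_dvd_of_SU hB)
  have e3 := congrArg (Int.cast : ℤ → ZMod 3) hy
  push_cast at e3
  replace hijk : 4 * w.re ^ 2 - y ^ 2 = -19 ^ k := by
    refine hijk.resolve_left fun hk => ?_
    have h3 : ∀ A B y : ZMod 3, B ≠ 0 → A ^ 2 + 22 * B ^ 2 = y ^ 2 → 4 * A ^ 2 - y ^ 2 ≠ 1 := by
      decide
    refine h3 _ _ _ hB3 e3 ?_
    have := congrArg (Int.cast : ℤ → ZMod 3) hk
    push_cast at this
    rw [this, show (19 : ZMod 3) = 1 by decide, one_pow]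
  rcases Nat.even_or_odd' k with ⟨m, rfl | rfl⟩
  · have e11 := congrArg (Int.cast : ℤ → ZMod 11) hijk
    have e11' := congrArg (Int.cast : ℤ → ZMod 11) hy
    push_cast at e11 e11'
    have : ∀ A B y c : ZMod 11, y ≠ 0 → A ^ 2 = y ^ 2 → 4 * A ^ 2 - y ^ 2 ≠ -c ^ 2 := by
      decide +kernel
    refine this w.re w.im y (19 ^ m) hy11 ?_ (by rw [e11, mul_comm 2 m, pow_mul])
    rw [← e11', show (22 : ZMod 11) = 0 by decide]; ring
  · have e8 := congrArg (Int.cast : ℤ → ZMod 8) hijk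
    push_cast at e8
    have h8 : (19 : ZMod 8) ^ 2 = 1 := by decide
    have : ∀ A y : ZMod 8, 4 * A ^ 2 - y ^ 2 ≠ -19 := by decide
    exact this _ _ (by rw [e8, pow_succ, pow_mul, h8, one_pow, one_mul])

/-- The two linear factors of `4 A² - y²` when it is a prime power up to sign. -/
lemma linear_factors {q : ℕ} (hq : q.Prime) {A y : ℤ} {u : ℕ} (hy : 0 < y)
    (h : 4 * A ^ 2 - y ^ 2 = q ^ u ∨ 4 * A ^ 2 - y ^ 2 = -q ^ u)
    (hn : (q : ℤ) ∣ 4 * A ^ 2 - y ^ 2 → ¬ (q : ℤ) ∣ 2 * y) :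
    (4 * A ^ 2 - y ^ 2 = q ^ u ∧ 2 * y = q ^ u - 1 ∧ (4 * A = q ^ u + 1 ∨ 4 * A = -(q ^ u + 1))) ∨
    (4 * A ^ 2 - y ^ 2 = -q ^ u ∧ 2 * y = q ^ u + 1 ∧
      (4 * A = q ^ u - 1 ∨ 4 * A = -(q ^ u - 1))) := by
  have e : (2 * A - y) * (2 * A + y) = 4 * A ^ 2 - y ^ 2 := by ring
  have hq0 : (0 : ℤ) < q ^ u := pow_pos (by exact_mod_cast hq.pos) _
  rw [← e] at h hn ⊢
  have := eq_pow_of_mul_eq hq h fun h1 h2 => by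
    refine hn (h1.mul_right _) ?_
    have := dvd_sub h2 h1
    rwa [show 2 * A + y - (2 * A - y) = 2 * y by ring] at this
  set t := (q : ℤ) ^ u
  rcases this with ⟨h1 | h1, h2 | h2⟩ | ⟨h1 | h1, h2 | h2⟩ <;> rw [h1, h2] <;> omega

lemma pow_mod_eight {q : ℤ} (hq : q % 8 = 3) (u : ℕ) : q ^ u % 8 = 1 ∨ q ^ u % 8 = 3 := by
  induction u with
  | zero => simp
  | succ u ih => rw [pow_succ, Int.mul_emod, hq]; omega

lemma eq_one_or_dvd_pow (q : ℤ) (u : ℕ) : q ^ u = 1 ∨ q ∣ q ^ u := by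
  rcases Nat.eq_zero_or_pos u with rfl | hu
  · simp
  · exact Or.inr (dvd_pow_self q hu.ne')

lemma nineteen_pow_mod_nine (e : ℕ) : (19 : ℤ) ^ e % 9 = 1 := by
  have : (19 : ℤ) ^ e ≡ 1 ^ e [ZMOD 9] := Int.ModEq.pow e (by decide)
  rwa [one_pow] at this

lemma three_dvd_of_three_mul_add_one {X : ℤ} {e : ℕ} (h : 3 * X + 1 = 19 ^ e) : (3 : ℤ) ∣ X := by
  have := nineteen_pow_mod_nine e
  omega

lemma eq_one_of_sq_eq {X B : ℤ} (hX0 : 0 < X) (hB : SU B) (hBX : B ^ 2 = 4 * X * (3 * X + 1))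
    (h11 : ¬ (11 : ℤ) ∣ X) (h11' : ¬ (11 : ℤ) ∣ 3 * X + 1) : X = 1 := by
  have hX := hB.sq.dvd (hBX ▸ (Dvd.intro_left _ rfl).mul_right _ : X ∣ B ^ 2)
  have hX' := hB.sq.dvd (hBX ▸ Dvd.intro_left _ rfl : 3 * X + 1 ∣ B ^ 2)
  obtain ⟨a, b, c, hXe, ha, hb, hc⟩ := hX.exists_pow_of_pos hX0
  obtain rfl := hb h11
  obtain ⟨a', b', c', hXe', ha', hb', hc'⟩ := hX'.exists_pow_of_pos (by omega)
  obtain rfl := hb' h11'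
  rcases Int.even_or_odd' X with ⟨s, hs | hs⟩
  · obtain rfl := ha' (by omega)
    exact absurd (three_dvd_of_three_mul_add_one (by simpa using hXe'))
      (three_not_dvd_of_SU hX)
  · obtain rfl := ha (by omega)
    simp only [pow_zero, one_mul, mul_one] at hXe hXe'
    rcases eq_one_or_dvd_pow 19 c with h1 | h1
    · rw [hXe, h1]
    · rw [← hXe] at h1
      obtain rfl := hc' (by omega)
      rw [pow_zero, mul_one] at hXe'
      exfalso
      rw [hXe] at hXe' h1
      have h19 := intCast_eq_zero_of_dvd (q := 19) h1
      have e19 := congrArg (Int.cast : ℤ → ZMod 19) hXe'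
      have e9 := congrArg (Int.cast : ℤ → ZMod 9) hXe'
      push_cast at h19 e19 e9
      rw [h19, pow_eq_pow_mod a' (by decide : (2 : ZMod 19) ^ 18 = 1)] at e19
      rw [show (19 : ZMod 9) = 1 by decide, one_pow,
        pow_eq_pow_mod a' (by decide : (2 : ZMod 9) ^ 18 = 1)] at e9
      have : ∀ i : Fin 18, 3 * 0 + 1 = (2 : ZMod 19) ^ (i : ℕ) →
        3 * 1 + 1 ≠ (2 : ZMod 9) ^ (i : ℕ) := by decide
      exact this ⟨a' % 18, Nat.mod_lt _ (by norm_num)⟩ e19 e9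

lemma eq_zero_of_sq_eq {s B : ℤ} (hs : 0 ≤ s) (hB : SU B) (hBs : B ^ 2 = (2 * s + 1) * (6 * s + 1))
    (h11 : ¬ (11 : ℤ) ∣ 2 * s + 1) (h11' : ¬ (11 : ℤ) ∣ 6 * s + 1) : s = 0 := by
  obtain ⟨a, b, c, hXe, ha, hb, hc⟩ :=
    (hB.sq.dvd (hBs ▸ Dvd.intro _ rfl : 2 * s + 1 ∣ B ^ 2)).exists_pow_of_pos (by omega)
  obtain rfl := hb h11
  obtain rfl := ha (by omega)
  obtain ⟨a', b', c', hXe', ha', hb', hc'⟩ :=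
    (hB.sq.dvd (hBs ▸ Dvd.intro_left _ rfl : 6 * s + 1 ∣ B ^ 2)).exists_pow_of_pos (by omega)
  obtain rfl := hb' h11'
  obtain rfl := ha' (by omega)
  simp only [pow_zero, one_mul, mul_one] at hXe hXe'
  have h1 := eq_one_or_dvd_pow 19 c
  have h2 := eq_one_or_dvd_pow 19 c'
  omega

lemma six_one (h : Sol 1 x z y 6) : x = 117 ∧ y = 5 := by
  have h' := h.root (j := 3) (by norm_num) (by norm_num)
  norm_num at h'
  obtain ⟨w, hw, hw3⟩ := root_neg_one (n := 3) h'.pos (by decide) (by simpa using h'.eq) h'.coprime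
  obtain ⟨hy, hz, hB, hr, h2⟩ := h.root_six hw hw3
  have h19 : ¬ (19 : ℤ) ∣ 4 * w.re ^ 2 - y ^ 2 := by
    intro h19
    have hy' := intCast_ne_zero_of_not_dvd (h.cop_self 19 (by simp)
      (h19.trans (hz ▸ Dvd.intro_left _ rfl)))
    have : ∀ A B y : ZMod 19, A ^ 2 + 1 * B ^ 2 = y ^ 2 → 4 * A ^ 2 - y ^ 2 = 0 → y = 0 := by
      decide +kernel
    refine hy' (this w.re w.im y ?_ ?_)
    · exact_mod_cast congrArg (Int.cast : ℤ → ZMod 19) hy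
    · exact_mod_cast intCast_eq_zero_of_dvd (q := 19) h19
  obtain ⟨i, u, k, hijk, hi, -, hk⟩ := hr.exists_pow_abs
  obtain rfl := hi h2
  obtain rfl := hk h19
  simp only [pow_zero, one_mul, mul_one] at hijk
  have hB11 : (11 : ℤ) ∣ 4 * w.re ^ 2 - y ^ 2 → ¬ (11 : ℤ) ∣ y := fun hd =>
    h.cop_self 11 (by simp) (hd.trans (hz ▸ Dvd.intro_left _ rfl))
  have := linear_factors (q := 11) (by norm_num) h.pos (by exact_mod_cast hijk)
    (fun hd h2 => hB11 hd (by push_cast at h2; omega))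
  push_cast at this
  have h3 := h.three_le
  have ht8 := pow_mod_eight (by norm_num : (11 : ℤ) % 8 = 3) u
  have ht0 := eq_one_or_dvd_pow 11 u
  generalize (11 : ℤ) ^ u = t at *
  rcases this with ⟨-, hty, htA⟩ | ⟨-, hty, htA⟩
  · obtain ⟨X, rfl⟩ : ∃ X, t = 8 * X + 3 := ⟨t / 8, by omega⟩
    have hA2 : 16 * w.re ^ 2 = (8 * X + 4) ^ 2 := by
      rcases htA with h | h
      · linear_combination (4 * w.re + 8 * X + 4) * h
      · linear_combination (4 * w.re - 8 * X - 4) * h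
    have hBX : w.im ^ 2 = 4 * X * (3 * X + 1) := by
      obtain rfl : y = 4 * X + 1 := by omega
      linarith
    obtain rfl := eq_one_of_sq_eq (by omega) hB hBX (by omega) (by omega)
    have hy5 : y = 5 := by omega
    have : x ^ 2 = 117 ^ 2 := by
      have := h.eq
      have hA9 : w.re ^ 2 = 9 := by linarith
      rw [hz, mul_pow, hBX, hA9, hy5] at this
      linarith
    exact ⟨by nlinarith [h.x_pos], hy5⟩
  · exfalso
    obtain ⟨s, rfl⟩ : ∃ s, t = 8 * s + 1 := ⟨t / 8, by omega⟩
    have hA2 : 16 * w.re ^ 2 = (8 * s) ^ 2 := by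
      rcases htA with h | h
      · linear_combination (4 * w.re + 8 * s) * h
      · linear_combination (4 * w.re - 8 * s) * h
    have hBs : w.im ^ 2 = (2 * s + 1) * (6 * s + 1) := by
      obtain rfl : y = 4 * s + 1 := by omega
      linarith
    obtain rfl := eq_zero_of_sq_eq (by omega) hB hBs (by omega) (by omega)
    omega

lemma sq_ne_two_mul {X B : ℤ} (hX0 : 0 < X) (hB : SU B) (h19 : ¬ (19 : ℤ) ∣ X)
    (h19' : ¬ (19 : ℤ) ∣ 3 * X + 1) (h9 : X % 9 = 2) : B ^ 2 ≠ 2 * X * (3 * X + 1) := by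
  intro hBX
  have hX := hB.sq.dvd (hBX ▸ (Dvd.intro_left _ rfl).mul_right _ : X ∣ B ^ 2)
  have hX' := hB.sq.dvd (hBX ▸ Dvd.intro_left _ rfl : 3 * X + 1 ∣ B ^ 2)
  obtain ⟨a, b, c, hXe, ha, hb, hc⟩ := hX.exists_pow_of_pos hX0
  obtain rfl := hc h19
  obtain ⟨a', b', c', hXe', ha', hb', hc'⟩ := hX'.exists_pow_of_pos (by omega)
  obtain rfl := hc' h19'
  have hb1 := eq_one_or_dvd_pow 11 b
  rcases Int.even_or_odd' X with ⟨s, hs | hs⟩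
  · obtain rfl := ha' (by omega)
    obtain rfl : b = 0 := by
      by_contra h0
      have hd : (11 : ℤ) ∣ X := hXe ▸ ((dvd_pow_self 11 h0).mul_left _).mul_right _
      obtain rfl := hb' (by omega)
      simp at hXe'
      omega
    simp only [pow_zero, one_mul, mul_one] at hXe hXe'
    have h7 : (7 : ℤ) ∣ 3 * X + 1 := by
      have e9 := congrArg (Int.cast : ℤ → ZMod 9) hXe
      rw [← Int.emod_add_mul_ediv X 9, h9] at e9
      push_cast at e9
      rw [show (9 : ZMod 9) = 0 by decide, zero_mul, add_zero,
        pow_eq_pow_mod a (by decide : (2 : ZMod 9) ^ 6 = 1)] at e9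
      refine (ZMod.intCast_zmod_eq_zero_iff_dvd _ 7).mp ?_
      rw [hXe]
      push_cast
      rw [pow_eq_pow_mod a (by decide : (2 : ZMod 7) ^ 6 = 1)]
      have : ∀ i : Fin 6, 2 = (2 : ZMod 9) ^ (i : ℕ) → 3 * (2 : ZMod 7) ^ (i : ℕ) + 1 = 0 := by
        decide
      exact this ⟨a % 6, Nat.mod_lt _ (by norm_num)⟩ e9
    have := hX'.2 7 (by norm_num) h7
    omega
  · obtain rfl := ha (by omega)
    simp only [pow_zero, one_mul, mul_one] at hXe hXe'
    rw [← hXe] at hb1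
    obtain rfl := hb' (by omega)
    rw [pow_zero, mul_one] at hXe'
    obtain ⟨m, rfl | rfl⟩ := Nat.even_or_odd' a'
    · rw [mul_comm 2 m, pow_mul] at hXe'
      rw [hXe'] at hBX
      obtain ⟨C, rfl⟩ : (2 ^ m : ℤ) ∣ B := by
        rw [← Int.pow_dvd_pow_iff two_ne_zero]
        exact ⟨_, by rw [hBX, mul_comm]⟩
      have hC : C ^ 2 = 2 * X := by
        have h0 : ((2 : ℤ) ^ m) ^ 2 ≠ 0 := by positivity
        exact mul_left_cancel₀ h0 (by linarith)
      rcases Int.even_or_odd' C with ⟨k, rfl | rfl⟩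
      · have : 2 * k ^ 2 = X := by linarith
        omega
      · have : 4 * (k ^ 2 + k) + 1 = 2 * X := by linarith
        omega
    · have e9 := congrArg (Int.cast : ℤ → ZMod 9) hXe'
      rw [← Int.emod_add_mul_ediv X 9, h9] at e9
      push_cast at e9
      rw [show (9 : ZMod 9) = 0 by decide, zero_mul, add_zero, pow_succ, pow_mul,
        pow_eq_pow_mod m (by decide : ((2 : ZMod 9) ^ 2) ^ 3 = 1)] at e9
      have : ∀ i : Fin 3, 3 * 2 + 1 ≠ ((2 : ZMod 9) ^ 2) ^ (i : ℕ) * 2 := by decide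
      exact this ⟨m % 3, Nat.mod_lt _ (by norm_num)⟩ e9

lemma no_six_two : ¬ Sol 2 x z y 6 := by
  intro h
  have h' := h.root (j := 3) (by norm_num) (by norm_num)
  norm_num at h'
  obtain ⟨w, hw, hw3⟩ := root_neg_two h'.pos (by decide) h'.eq h'.coprime
  obtain ⟨hy, hz, hB, hr, h2⟩ := h.root_six hw hw3
  have h11 : ¬ (11 : ℤ) ∣ 4 * w.re ^ 2 - y ^ 2 := by
    intro h11
    have hy' := intCast_ne_zero_of_not_dvd (h.cop_self 11 (by simp)
      (h11.trans (hz ▸ Dvd.intro_left _ rfl)))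
    have : ∀ A B y : ZMod 11, A ^ 2 + 2 * B ^ 2 = y ^ 2 → 4 * A ^ 2 - y ^ 2 = 0 → y = 0 := by
      decide +kernel
    refine hy' (this w.re w.im y ?_ ?_)
    · exact_mod_cast congrArg (Int.cast : ℤ → ZMod 11) hy
    · exact_mod_cast intCast_eq_zero_of_dvd (q := 11) h11
  obtain ⟨i, j, u, hijk, hi, hj, -⟩ := hr.exists_pow_abs
  obtain rfl := hi h2
  obtain rfl := hj h11
  simp only [pow_zero, one_mul] at hijk
  have hB19 : (19 : ℤ) ∣ 4 * w.re ^ 2 - y ^ 2 → ¬ (19 : ℤ) ∣ y := fun hd =>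
    h.cop_self 19 (by simp) (hd.trans (hz ▸ Dvd.intro_left _ rfl))
  have := linear_factors (q := 19) (by norm_num) h.pos (by exact_mod_cast hijk)
    (fun hd h2 => hB19 hd (by push_cast at h2; omega))
  push_cast at this
  have h3 := h.three_le
  have ht8 := pow_mod_eight (by norm_num : (19 : ℤ) % 8 = 3) u
  have ht9 := nineteen_pow_mod_nine u
  have ht0 := eq_one_or_dvd_pow 19 u
  generalize (19 : ℤ) ^ u = t at *
  rcases this with ⟨-, hty, htA⟩ | ⟨ht, -⟩
  · obtain ⟨X, rfl⟩ : ∃ X, t = 8 * X + 3 := ⟨t / 8, by omega⟩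
    have hA2 : 16 * w.re ^ 2 = (8 * X + 4) ^ 2 := by
      rcases htA with h | h
      · linear_combination (4 * w.re + 8 * X + 4) * h
      · linear_combination (4 * w.re - 8 * X - 4) * h
    refine sq_ne_two_mul (X := X) (by omega) hB (by omega) (by omega) (by omega) ?_
    obtain rfl : y = 4 * X + 1 := by omega
    linarith
  · have hB3 := intCast_ne_zero_of_not_dvd (q := 3) (three_not_dvd_of_SU hB)
    have : ∀ A B y : ZMod 3, B ≠ 0 → A ^ 2 + 2 * B ^ 2 = y ^ 2 → 4 * A ^ 2 - y ^ 2 ≠ -1 := by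
      decide
    refine this w.re w.im y hB3 (by exact_mod_cast congrArg (Int.cast : ℤ → ZMod 3) hy) ?_
    obtain ⟨T, rfl⟩ : ∃ T, t = 3 * T + 1 := ⟨t / 3, by omega⟩
    have := congrArg (Int.cast : ℤ → ZMod 3) ht
    push_cast at this
    rw [this, show (3 : ZMod 3) = 0 by decide, zero_mul, zero_add]

lemma sq_sub_sq_eq_two_pow {P : ℤ} (hy3 : 3 ≤ y) (hodd : ¬ (2 : ℤ) ∣ y) {e : ℕ}
    (h : P ^ 2 - y ^ 2 = 2 ^ e ∨ P ^ 2 - y ^ 2 = -2 ^ e) : ∃ f : ℕ,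
    (P ^ 2 - y ^ 2 = 4 * 2 ^ f ∧ y = 2 ^ f - 1) ∨ (P ^ 2 - y ^ 2 = -(4 * 2 ^ f) ∧ y = 2 ^ f + 1) := by
  have e0 : P ^ 2 - y ^ 2 = (P - y) * (P + y) := by ring
  obtain ⟨b, rfl⟩ : ∃ b, y = 2 * b + 1 := ⟨y / 2, by omega⟩
  rcases Int.even_or_odd' P with ⟨a, rfl | rfl⟩
  · have h2 : e = 0 := by
      by_contra h0
      obtain ⟨e, rfl⟩ := Nat.exists_eq_succ_of_ne_zero h0
      have e1 : (2 * a) ^ 2 - (2 * b + 1) ^ 2 = 2 * (2 * a ^ 2 - 2 * b ^ 2 - 2 * b) - 1 := by ring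
      rw [e1, pow_succ] at h
      omega
    subst h2
    rw [e0] at h
    rcases h with h | h
    · rcases Int.eq_one_or_neg_one_of_mul_eq_one' h with h | h <;> omega
    · rcases Int.eq_one_or_neg_one_of_mul_eq_neg_one' h with h | h <;> omega
  · have e1 : (2 * a + 1) ^ 2 - (2 * b + 1) ^ 2 = 4 * ((a - b) * (a + b + 1)) := by ring
    rw [e1] at h
    match e with
    | 0 => omega
    | 1 => omega
    | f + 2 =>
      have := eq_pow_of_mul_eq (q := 2) (by norm_num) (U := a - b) (V := a + b + 1) (u := f)
        (by push_cast; rw [pow_add] at h; omega) (by push_cast; omega)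
      push_cast at this
      refine ⟨f, ?_⟩
      rw [e1]
      have h0 : (0 : ℤ) < 2 ^ f := by positivity
      rcases this with ⟨h1 | h1, h2 | h2⟩ | ⟨h1 | h1, h2 | h2⟩ <;> rw [h1, h2] <;> omega

lemma SU.exists_pow_of_odd {X : ℤ} (h : SU X) (h0 : 0 < X) (h2 : ¬ (2 : ℤ) ∣ X) :
    ∃ b c : ℕ, X = 11 ^ b * 19 ^ c ∧ X % 9 = 2 ^ (b % 6) % 9 ∧ (b = 0 ∨ 11 ∣ X) ∧
      (c = 0 ∨ 19 ∣ X) := by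
  obtain ⟨a, b, c, hX, ha, hb, hc⟩ := h.exists_pow_of_pos h0
  obtain rfl := ha h2
  refine ⟨b, c, by rw [hX]; ring, ?_, or_iff_not_imp_right.mpr hb, or_iff_not_imp_right.mpr hc⟩
  refine (ZMod.intCast_eq_intCast_iff _ _ 9).mp ?_
  rw [hX]
  push_cast
  rw [show (19 : ZMod 9) = 1 by decide, show (11 : ZMod 9) = 2 by decide, one_pow, mul_one,
    one_mul, pow_eq_pow_mod b (by decide : (2 : ZMod 9) ^ 6 = 1)]

lemma eleven_pow_mod {T : ℤ} {b : ℕ} (hT : T = 11 ^ b) :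
    (T % 9 = 2 → T % 19 = 11) ∧ (T % 9 = 4 → T % 19 = 7) := by
  have h : T % 171 = 11 ^ (b % 6) % 171 := by
    refine (ZMod.intCast_eq_intCast_iff _ _ 171).mp ?_
    rw [hT]
    push_cast
    exact pow_eq_pow_mod b (by decide)
  have hbl : b % 6 < 6 := Nat.mod_lt _ (by norm_num)
  clear hT
  interval_cases b % 6 <;> norm_num at h <;> omega

lemma SU.mul_sq {q : ℕ} (hq : q = 2 ∨ q = 11 ∨ q = 19) {v : ℤ} (hv : SU v) : SU (q * v ^ 2) := by
  have hqp : q.Prime := by rcases hq with rfl | rfl | rfl <;> norm_num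
  refine SU.mul ⟨by exact_mod_cast hqp.ne_zero, fun p hp hd => ?_⟩ hv.sq
  rwa [(Nat.prime_dvd_prime_iff_eq hp hqp).mp (by exact_mod_cast hd)]

lemma SU.sq_mod_three {v : ℤ} (hv : SU v) : v ^ 2 % 3 = 1 := by
  have := three_not_dvd_of_SU hv
  rcases (by omega : v % 3 = 1 ∨ v % 3 = 2) with h | h <;> rw [pow_two, Int.mul_emod, h] <;> norm_num

/-- Data of a cube root in the maximal order for an exponent divisible by `6`. -/
lemma Sol.root_six_half (h : Sol d x z y 6) {a b : ℤ} (hab : b ^ 2 + 4 * a = -d)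
    {w : QuadraticAlgebra ℤ a b} (hw : w.norm = y ^ 2)
    (hw3 : (w ^ 3).im = 2 * z) (h11 : ∀ y v : ZMod 11, 3 * y ^ 2 - d * v ^ 2 = 0 → y = 0)
    (h19 : ∀ y v : ZMod 19, 3 * y ^ 2 - d * v ^ 2 = 0 → y = 0) : 2 * z = w.im * (3 * y ^ 2 - d * w.im ^ 2) ∧
    SU w.im ∧ ∃ f : ℕ, (3 * y ^ 2 - d * w.im ^ 2 = 4 * 2 ^ f ∧ y = 2 ^ f - 1) ∨
      (3 * y ^ 2 - d * w.im ^ 2 = -(4 * 2 ^ f) ∧ y = 2 ^ f + 1) := by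
  have hP2 : tr w ^ 2 = 4 * y ^ 2 - d * w.im ^ 2 := by rw [tr_sq, hw, hab]; ring
  have hP : tr w ^ 2 - y ^ 2 = 3 * y ^ 2 - d * w.im ^ 2 := by rw [hP2]; ring
  have hZ : 2 * z = w.im * (3 * y ^ 2 - d * w.im ^ 2) := by
    rw [← hw3, im_pow_eq, luc_three, hw, hP]
  have hr := h.su.two_mul.dvd (hZ ▸ Dvd.intro_left _ rfl : 3 * y ^ 2 - d * w.im ^ 2 ∣ 2 * z)
  have key : ∀ q : ℕ, (q = 11 ∨ q = 19) →
      (∀ y v : ZMod q, 3 * y ^ 2 - d * v ^ 2 = 0 → y = 0) → ¬ (q : ℤ) ∣ 3 * y ^ 2 - d * w.im ^ 2 := by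
    intro q hq hz hd
    refine h.cop_two_mul q (by tauto) (hZ ▸ hd.mul_left _) ?_
    refine (ZMod.intCast_zmod_eq_zero_iff_dvd _ q).mp (hz y w.im ?_)
    exact_mod_cast intCast_eq_zero_of_dvd (q := q) hd
  obtain ⟨e, j, k, he, -, hj, hk⟩ := hr.exists_pow_abs
  obtain rfl := hj (key 11 (by simp) h11)
  obtain rfl := hk (key 19 (by simp) h19)
  simp only [pow_zero, mul_one] at he
  rw [← hP] at he ⊢
  exact ⟨by rw [hP]; exact hZ, h.su.two_mul.dvd (hZ ▸ Dvd.intro _ rfl),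
    sq_sub_sq_eq_two_pow h.three_le h.odd he⟩

lemma eq_four_of_SU {g : ℤ} (hg0 : 3 < g) (h2 : 2 ∣ g) (hg : g % 3 = 1) (h : SU (g - 3))
    (h' : SU (3 * g - 1)) : g = 4 := by
  obtain ⟨b, c, hX, hX9, hb, hc⟩ := h.exists_pow_of_odd (by omega) (by omega)
  obtain ⟨b', c', hX', hX9', hb', hc'⟩ := h'.exists_pow_of_odd (by omega) (by omega)
  by_contra hg4
  have hb1 : b' ≠ 0 := by rintro rfl; clear hb hc hc'; norm_num at hX9'; omega
  have hb2 := hb'.resolve_left hb1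
  obtain rfl := hb.resolve_right (by clear hb hc hc' hb'; omega)
  have hc1 : c ≠ 0 := by rintro rfl; norm_num at hX; clear hb hc hb' hc'; omega
  have hc2 := hc.resolve_left hc1
  obtain rfl := hc'.resolve_right (by clear hb hc hc' hb'; omega)
  norm_num at hX9
  clear hX hX9' hb hc hb' hc'
  rw [pow_zero, mul_one] at hX'
  have h9 : (3 * g - 1) % 9 = 2 := by clear hX' hb2 hc2 hg h2; omega
  have h19 := (eleven_pow_mod hX').1 h9
  clear hX' hX9 h9 hb2 h2 hg
  omega

lemma not_SU_of_mod_three_eq_two {g : ℤ} (hg0 : 0 < g) (h2 : 2 ∣ g) (hg : g % 3 = 2)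
    (h : SU (g + 3)) (h' : SU (3 * g + 1)) : False := by
  obtain ⟨b, c, hX, hX9, hb, hc⟩ := h.exists_pow_of_odd (by omega) (by omega)
  obtain ⟨b', c', hX', hX9', hb', hc'⟩ := h'.exists_pow_of_odd (by omega) (by omega)
  have hb1 : b ≠ 0 := by rintro rfl; clear hb' hc hc'; norm_num at hX9; omega
  have hb2 := hb.resolve_left hb1
  obtain rfl := hb'.resolve_right (by clear hb hc hc' hb'; omega)
  clear hb hc hb' hc'
  norm_num at hX9'
  omega

lemma not_SU_of_mod_three_eq_two' {g : ℤ} (hg0 : 3 < g) (h2 : 2 ∣ g) (hg : g % 3 = 2)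
    (h : SU (g - 3)) (h' : SU (3 * g - 1)) : False := by
  obtain ⟨b, c, hX, hX9, hb, hc⟩ := h.exists_pow_of_odd (by omega) (by omega)
  obtain ⟨b', c', hX', hX9', hb', hc'⟩ := h'.exists_pow_of_odd (by omega) (by omega)
  have hb1 : b ≠ 0 := by rintro rfl; clear hb' hc hc'; norm_num at hX9; omega
  have hb2 := hb.resolve_left hb1
  have hb1' : b' ≠ 0 := by rintro rfl; clear hb hc hc'; norm_num at hX9'; omega
  have hb2' := hb'.resolve_left hb1'
  clear hb hc hb' hc'
  omega

lemma not_SU_of_mod_three_eq_one {g : ℤ} (hg0 : 0 < g) (h2 : 2 ∣ g) (hg : g % 3 = 1)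
    (h : SU (g + 3)) (h' : SU (3 * g + 1)) : False := by
  obtain ⟨b, c, hX, hX9, hb, hc⟩ := h.exists_pow_of_odd (by omega) (by omega)
  obtain ⟨b', c', hX', hX9', hb', hc'⟩ := h'.exists_pow_of_odd (by omega) (by omega)
  have hb1 : b' ≠ 0 := by rintro rfl; clear hb hc hc'; norm_num at hX9'; omega
  have hb2 := hb'.resolve_left hb1
  obtain rfl := hb.resolve_right (by clear hb hc hc' hb'; omega)
  have hc1 : c ≠ 0 := by rintro rfl; norm_num at hX; clear hb hc hb' hc'; omega
  have hc2 := hc.resolve_left hc1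
  obtain rfl := hc'.resolve_right (by clear hb hc hc' hb'; omega)
  norm_num at hX9
  clear hX hX9' hb hc hb' hc'
  rw [pow_zero, mul_one] at hX'
  have h9 : (3 * g + 1) % 9 = 4 := by clear hX' hb2 hc2 hg h2; omega
  have h19 := (eleven_pow_mod hX').2 h9
  clear hX' hX9 h9 hb2 h2 hg
  omega

lemma six_eleven (h : Sol 11 x z y 6) : x = 5 ∧ y = 3 := by
  have h' := h.root (j := 3) (by norm_num) (by norm_num)
  norm_num at h'
  obtain ⟨w, hw, hw3⟩ := root_neg_eleven h'.pos (by decide) h'.eq h'.coprime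
    (by have := h'.odd; rw [Int.odd_iff]; omega)
  obtain ⟨hZ, hv, f, hf⟩ := h.root_six_half (by norm_num) hw (by rw [hw3]) (by decide +kernel)
    (by decide +kernel)
  have hy3 := h.three_le
  have h2f : 2 ∣ (2 : ℤ) ^ f := dvd_pow_self 2 (by rintro rfl; omega)
  have hsu := hv.mul_sq (q := 11) (by simp)
  have hv3 := hv.sq_mod_three
  push_cast at hsu
  generalize (2 : ℤ) ^ f = g at *
  rcases hf with ⟨hr, rfl⟩ | ⟨hr, rfl⟩
  · have e : 11 * w.im ^ 2 = (g - 3) * (3 * g - 1) := by linear_combination -hr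
    have hv2 : g = 4 := eq_four_of_SU (by omega) h2f (by omega) (hsu.dvd (e ▸ Dvd.intro _ rfl))
      (hsu.dvd (e ▸ Dvd.intro_left _ rfl))
    subst hv2
    have hz : 4 * z ^ 2 = w.im ^ 2 * 16 ^ 2 := by
      rw [show 4 * z ^ 2 = (2 * z) ^ 2 by ring, hZ, hr]; ring
    have hx : x ^ 2 = 5 ^ 2 := by linarith [h.eq]
    exact ⟨(pow_left_inj₀ h.x_pos.le (by norm_num) two_ne_zero).mp hx, by norm_num⟩
  · have e : 11 * w.im ^ 2 = (g + 3) * (3 * g + 1) := by linear_combination -hr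
    exact (not_SU_of_mod_three_eq_two (by omega) h2f (by omega) (hsu.dvd (e ▸ Dvd.intro _ rfl))
      (hsu.dvd (e ▸ Dvd.intro_left _ rfl))).elim

lemma no_six_nineteen : ¬ Sol 19 x z y 6 := by
  intro h
  have h' := h.root (j := 3) (by norm_num) (by norm_num)
  norm_num at h'
  obtain ⟨w, hw, hw3⟩ := root_neg_nineteen h'.pos (by decide) h'.eq h'.coprime
    (by have := h'.odd; rw [Int.odd_iff]; omega)
  obtain ⟨hZ, hv, f, hf⟩ := h.root_six_half (by norm_num) hw (by rw [hw3]) (by decide +kernel)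
    (by decide +kernel)
  have hy3 := h.three_le
  have h2f : 2 ∣ (2 : ℤ) ^ f := dvd_pow_self 2 (by rintro rfl; omega)
  have hsu := hv.mul_sq (q := 19) (by simp)
  have hv3 := hv.sq_mod_three
  push_cast at hsu
  generalize (2 : ℤ) ^ f = g at *
  rcases hf with ⟨hr, rfl⟩ | ⟨hr, rfl⟩
  · have e : 19 * w.im ^ 2 = (g - 3) * (3 * g - 1) := by linear_combination -hr
    exact not_SU_of_mod_three_eq_two' (by omega) h2f (by omega) (hsu.dvd (e ▸ Dvd.intro _ rfl))
      (hsu.dvd (e ▸ Dvd.intro_left _ rfl))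
  · have e : 19 * w.im ^ 2 = (g + 3) * (3 * g + 1) := by linear_combination -hr
    exact not_SU_of_mod_three_eq_one (by omega) h2f (by omega) (hsu.dvd (e ▸ Dvd.intro _ rfl))
      (hsu.dvd (e ▸ Dvd.intro_left _ rfl))

end Six

section Thirty
variable {x z y : ℤ}

lemma pow_mul_pow_mul_pow_injective {i j k i' j' k' : ℕ}
    (h : 2 ^ i * 11 ^ j * 19 ^ k = 2 ^ i' * 11 ^ j' * 19 ^ k') : i = i' ∧ j = j' ∧ k = k' := by
  have key : ∀ p : ℕ, p.Prime → ∀ i j k : ℕ, padicValNat p (2 ^ i * 11 ^ j * 19 ^ k) =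
      i * padicValNat p 2 + j * padicValNat p 11 + k * padicValNat p 19 := by
    intro p hp i j k
    have := Fact.mk hp
    rw [padicValNat.mul (by positivity) (by positivity), padicValNat.mul (by positivity)
      (by positivity), padicValNat.pow, padicValNat.pow, padicValNat.pow]
  have h2 := congrArg (padicValNat 2) h
  have h11 := congrArg (padicValNat 11) h
  have h19 := congrArg (padicValNat 19) h
  have f2 : Fact (Nat.Prime 2) := ⟨by norm_num⟩
  have f11 : Fact (Nat.Prime 11) := ⟨by norm_num⟩
  have f19 : Fact (Nat.Prime 19) := ⟨by norm_num⟩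
  have e : ∀ {p n : ℕ}, ¬ p ∣ n → padicValNat p n = 0 := fun h => padicValNat.eq_zero_of_not_dvd h
  rw [key _ f2.1, key _ f2.1, padicValNat_self, e (by norm_num), e (by norm_num)] at h2
  rw [key _ f11.1, key _ f11.1, padicValNat_self, e (by norm_num), e (by norm_num)] at h11
  rw [key _ f19.1, key _ f19.1, padicValNat_self, e (by norm_num), e (by norm_num)] at h19
  omega

/-- Splitting `y ^ 6 - x ^ 2` into two coprime factors. -/
lemma Sol.split_thirtyeight (h : Sol 38 x z y 6) : ∃ U V : ℤ, ∃ j l m : ℕ, Odd j ∧ Even l ∧ Odd m ∧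
    U + V = y ^ 3 ∧ (x = U - V ∨ x = V - U) ∧
    ((U = 1 ∧ V = 2 ^ j * 11 ^ l * 19 ^ m) ∨ (U = 2 ^ j ∧ V = 11 ^ l * 19 ^ m) ∨
      (U = 2 ^ j * 11 ^ l ∧ V = 19 ^ m) ∨ (l ≠ 0 ∧ U = 11 ^ l ∧ V = 2 ^ j * 19 ^ m)) := by
  have he := h.eq
  have hy2 : y ^ 3 % 2 = 1 := Int.odd_iff.mp (Odd.pow (by have := h.odd; rw [Int.odd_iff]; omega))
  have hx2 : x % 2 = 1 := by
    by_contra hx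
    have e1 : (y ^ 3) ^ 2 % 2 = 1 := by rw [pow_two, Int.mul_emod, hy2]; norm_num
    have e2 : x ^ 2 % 2 = 0 := by rw [pow_two, Int.mul_emod, (by omega : x % 2 = 0)]; norm_num
    rw [← pow_mul] at e1
    norm_num at e1
    omega
  obtain ⟨U, hU⟩ : ∃ U, y ^ 3 - x = 2 * U := ⟨(y ^ 3 - x) / 2, by omega⟩
  obtain ⟨V, hV⟩ : ∃ V, y ^ 3 + x = 2 * V := ⟨(y ^ 3 + x) / 2, by omega⟩
  have hUV : 38 * z ^ 2 = 4 * (U * V) := by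
    rw [show 4 * (U * V) = (2 * U) * (2 * V) by ring, ← hU, ← hV]; linarith
  have hz0 := h.z_pos
  have hy0 := h.pos
  have hV0 : 0 < V := by have := h.x_pos; have : 0 < y ^ 3 := by positivity
                         linarith
  have hU0 : 0 < U := by
    have : 0 < 4 * (U * V) := by rw [← hUV]; positivity
    exact pos_of_mul_pos_left (by linarith) hV0.le
  obtain ⟨t, rfl⟩ : (2 : ℤ) ∣ z := by
    refine Int.prime_two.dvd_of_dvd_pow (n := 2) ?_
    omega
  have hUV' : U * V = 38 * t ^ 2 := by linarith
  have ht0 : 0 < t := by linarith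
  have ht := h.su.dvd (Dvd.intro_left 2 rfl)
  have hsu : SU (38 * t ^ 2) := by
    have := (ht.mul_sq (q := 2) (by simp)).mul_sq (q := 19) (by simp)
    refine this.dvd ⟨2 * t ^ 2, ?_⟩
    push_cast
    ring
  have hne : ∀ q : ℕ, (q = 2 ∨ q = 11 ∨ q = 19) → (q : ℤ) ∣ U → ¬ (q : ℤ) ∣ V := by
    intro q hq hqU hqV
    have hqp : q.Prime := by rcases hq with rfl | rfl | rfl <;> norm_num
    refine h.cop q hq ?_ ((Nat.prime_iff_prime_int.mp hqp).dvd_of_dvd_pow (n := 3) ?_)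
    · rcases (Nat.prime_iff_prime_int.mp hqp).dvd_or_dvd (hUV' ▸ hqU.mul_right V) with h1 | h1
      · exact h1.mul_right _
      · exact (((Nat.prime_iff_prime_int.mp hqp).dvd_of_dvd_pow h1).mul_left 2).mul_left 38
    · rw [show y ^ 3 = U + V by linarith]
      exact dvd_add hqU hqV
  obtain ⟨a, b, c, hte, -⟩ := ht.exists_pow_of_pos ht0
  obtain ⟨i, j, k, hUe, hi, hj, hk⟩ := (hsu.dvd (hUV' ▸ Dvd.intro _ rfl)).exists_pow_of_pos hU0
  obtain ⟨i', j', k', hVe, hi', hj', hk'⟩ :=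
    (hsu.dvd (hUV' ▸ Dvd.intro_left _ rfl)).exists_pow_of_pos hV0
  have hexp : i + i' = 1 + 2 * a ∧ j + j' = 2 * b ∧ k + k' = 1 + 2 * c := by
    apply pow_mul_pow_mul_pow_injective
    zify
    calc (2 : ℤ) ^ (i + i') * 11 ^ (j + j') * 19 ^ (k + k') = U * V := by rw [hUe, hVe]; ring
      _ = _ := by rw [hUV', hte]; ring
  have h2 : i = 0 ∨ i' = 0 := by
    by_cases hd : (2 : ℤ) ∣ U
    exacts [Or.inr (hi' (hne 2 (by simp) hd)), Or.inl (hi hd)]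
  have h11 : j = 0 ∨ j' = 0 := by
    by_cases hd : (11 : ℤ) ∣ U
    exacts [Or.inr (hj' (hne 11 (by simp) hd)), Or.inl (hj hd)]
  have h19 : k = 0 ∨ k' = 0 := by
    by_cases hd : (19 : ℤ) ∣ U
    exacts [Or.inr (hk' (hne 19 (by simp) hd)), Or.inl (hk hd)]
  clear hi hj hk hi' hj' hk' hsu hne
  have ho1 : Odd (i + i') := ⟨a, by omega⟩
  have ho2 : Even (j + j') := ⟨b, by omega⟩
  have ho3 : Odd (k + k') := ⟨c, by omega⟩
  have hs : U + V = y ^ 3 := by linarith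
  have hs' : V + U = y ^ 3 := by linarith
  have hx : x = V - U := by linarith
  rcases h19 with rfl | rfl
  · refine ⟨U, V, i + i', j + j', 0 + k', ho1, ho2, ho3, hs, Or.inr hx, ?_⟩
    by_cases hjj : j + j' = 0
    · obtain ⟨rfl, rfl⟩ : j = 0 ∧ j' = 0 := by omega
      rcases h2 with rfl | rfl
      · left; simp [hUe, hVe]
      · right; left; simp [hUe, hVe]
    rcases h2 with rfl | rfl <;> rcases h11 with rfl | rfl
    · left; simp [hUe, hVe]
    · right; right; right; refine ⟨hjj, ?_⟩; simp [hUe, hVe]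
    · right; left; simp [hUe, hVe]
    · right; right; left; simp [hUe, hVe]
  · refine ⟨V, U, i + i', j + j', k + 0, ho1, ho2, ho3, hs', Or.inl hx, ?_⟩
    by_cases hjj : j + j' = 0
    · obtain ⟨rfl, rfl⟩ : j = 0 ∧ j' = 0 := by omega
      rcases h2 with rfl | rfl
      · right; left; simp [hUe, hVe]
      · left; simp [hUe, hVe]
    rcases h2 with rfl | rfl <;> rcases h11 with rfl | rfl
    · right; right; left; simp [hUe, hVe]
    · right; left; simp [hUe, hVe]
    · right; right; right; refine ⟨hjj, ?_⟩; simp [hUe, hVe]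
    · left; simp [hUe, hVe]

lemma SU.two_pow_mul (j l m : ℕ) : SU (2 ^ j * 11 ^ l * 19 ^ m) := by
  refine ⟨by positivity, fun q hq hd => ?_⟩
  have hqi := Nat.prime_iff_prime_int.mp hq
  have key : ∀ p : ℕ, p.Prime → (q : ℤ) ∣ p → q = p := fun p hp h =>
    (Nat.prime_dvd_prime_iff_eq hq hp).mp (by exact_mod_cast h)
  rcases hqi.dvd_or_dvd hd with h | h
  · rcases hqi.dvd_or_dvd h with h | h
    · exact Or.inl (key 2 (by norm_num) (hqi.dvd_of_dvd_pow h))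
    · exact Or.inr (Or.inl (key 11 (by norm_num) (hqi.dvd_of_dvd_pow h)))
  · exact Or.inr (Or.inr (key 19 (by norm_num) (hqi.dvd_of_dvd_pow h)))

lemma cube_sub_cube_eq {T : ℤ} {j l m : ℕ} (hT : 0 < T) (hTy : T < y)
    (h : y ^ 3 - T ^ 3 = 2 ^ j * 11 ^ l * 19 ^ m) (h2 : ¬ (2 : ℤ) ∣ y)
    (h11 : ¬ ((11 : ℤ) ∣ y ∧ (11 : ℤ) ∣ T)) (h19 : ¬ (19 : ℤ) ∣ y) :
    y - T = 2 ^ j * 11 ^ l ∧ y ^ 2 + y * T + T ^ 2 = 19 ^ m := by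
  have e : (y - T) * (y ^ 2 + y * T + T ^ 2) = 2 ^ j * 11 ^ l * 19 ^ m := by rw [← h]; ring
  have hsu := SU.two_pow_mul j l m
  obtain ⟨a, b, c, hD, -, -, hc⟩ := (hsu.dvd (e ▸ Dvd.intro _ rfl)).exists_pow_of_pos
    (by linarith : 0 < y - T)
  obtain ⟨a', b', c', hQ, ha', hb', hc'⟩ := (hsu.dvd (e ▸ Dvd.intro_left _ rfl)).exists_pow_of_pos
    (by nlinarith : 0 < y ^ 2 + y * T + T ^ 2)
  obtain rfl := ha' (by
    intro hd
    have hy := intCast_ne_zero_of_not_dvd (q := 2) h2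
    have := intCast_eq_zero_of_dvd (q := 2) hd
    push_cast at this
    revert this hy
    generalize (y : ZMod 2) = u; generalize (T : ZMod 2) = v
    revert u v; decide)
  obtain rfl := hb' (by
    intro hd
    have := intCast_eq_zero_of_dvd (q := 11) hd
    push_cast at this
    have hf : ∀ u v : ZMod 11, u ^ 2 + u * v + v ^ 2 = 0 → u = 0 ∧ v = 0 := by decide +kernel
    have := hf _ _ this
    exact h11 ⟨(ZMod.intCast_zmod_eq_zero_iff_dvd _ 11).mp this.1,
      (ZMod.intCast_zmod_eq_zero_iff_dvd _ 11).mp this.2⟩)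
  simp only [pow_zero, one_mul] at hQ
  have hc'0 : c' ≠ 0 := by
    rintro rfl
    nlinarith
  have hQ19 : (19 : ℤ) ∣ y ^ 2 + y * T + T ^ 2 := hQ ▸ dvd_pow_self _ hc'0
  obtain rfl := hc (by
    intro hd
    have h1 := intCast_eq_zero_of_dvd (q := 19) hd
    have h2 := intCast_eq_zero_of_dvd (q := 19) hQ19
    have hy := intCast_ne_zero_of_not_dvd (q := 19) h19
    push_cast at h1 h2
    rw [← sub_eq_zero.mp h1] at h2
    revert h2 hy
    generalize (y : ZMod 19) = u
    revert u; decide)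
  have hinj : a = j ∧ b = l ∧ c' = m := by
    apply pow_mul_pow_mul_pow_injective
    zify
    rw [← e, hD, hQ]
    ring
  obtain ⟨rfl, rfl, rfl⟩ := hinj
  exact ⟨by rw [hD]; ring, hQ⟩

lemma nineteen_pow_mod_eight {m : ℕ} (hm : Odd m) : (19 : ℤ) ^ m % 8 = 3 := by
  obtain ⟨t, rfl⟩ := hm
  refine (ZMod.intCast_eq_intCast_iff _ 3 8).mp ?_
  push_cast
  rw [pow_succ, pow_mul, (by decide : (19 : ZMod 8) ^ 2 = 1), one_pow]
  decide

lemma zmod_pow_ne_zero {q : ℕ} (hq : q.Prime) {a : ZMod q} (ha : a ≠ 0) (n : ℕ) : a ^ n ≠ 0 := by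
  have : Fact q.Prime := ⟨hq⟩
  exact pow_ne_zero n ha

/-- `-19` is a square modulo `11`, hence an odd power of `19` is minus a nonzero square. -/
lemma nineteen_pow_mod_eleven {m : ℕ} (hm : Odd m) (c : ZMod 11) : c ^ 2 ≠ 19 ^ m := by
  obtain ⟨t, rfl⟩ := hm
  rw [pow_succ 19, mul_comm 2 t, pow_mul]
  have h0 : (19 : ZMod 11) ^ t ≠ 0 := zmod_pow_ne_zero (by norm_num) (by decide) t
  revert h0
  generalize (19 : ZMod 11) ^ t = u
  revert u c
  decide +kernel

lemma no_cube_eq_one_add {j l m : ℕ} (hj : Odd j) (hm : Odd m) (h19 : ¬ (19 : ℤ) ∣ y)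
    (h2 : ¬ (2 : ℤ) ∣ y) (hy : 1 < y) : 1 + 2 ^ j * 11 ^ l * 19 ^ m ≠ y ^ 3 := by
  intro h
  obtain ⟨hD, hQ⟩ := cube_sub_cube_eq (T := 1) one_pos hy (by linarith) h2 (by omega) h19
  rcases Nat.eq_zero_or_pos l with rfl | hl
  · obtain ⟨D, rfl⟩ : ∃ D, y = D + 1 := ⟨y - 1, by ring⟩
    obtain ⟨t, rfl⟩ := hj
    have hD' : D = 2 ^ (2 * t + 1) := by linarith
    have red : ∀ q : ℕ, ((2 : ZMod q) ^ 2) ^ 3 = 1 → ((2 : ZMod q) ^ 2) ^ (t % 3) * 2 = (D : ZMod q) := by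
      intro q hq
      rw [hD']
      push_cast
      rw [pow_succ _ (2 * t), pow_mul 2 2 t, pow_eq_pow_mod t hq]
    have e9 := congrArg (Int.cast : ℤ → ZMod 9) hQ
    have e7 := congrArg (Int.cast : ℤ → ZMod 7) hQ
    push_cast at e9 e7
    rw [← red 9 (by decide), (by decide : (19 : ZMod 9) = 1), one_pow] at e9
    rw [← red 7 (by decide)] at e7
    have h7 : (19 : ZMod 7) ^ m ≠ 0 := zmod_pow_ne_zero (by norm_num) (by decide) m
    rw [← e7] at h7
    revert e9 h7
    have ht : t % 3 < 3 := Nat.mod_lt _ (by norm_num)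
    generalize t % 3 = i at *
    clear red hD' hQ hD e7
    revert i
    decide
  · have h11 : (y : ZMod 11) = 1 := by
      have := congrArg (Int.cast : ℤ → ZMod 11) hD
      push_cast at this
      rw [(by decide : (11 : ZMod 11) = 0), zero_pow hl.ne', mul_zero, sub_eq_zero] at this
      exact this
    have e := congrArg (Int.cast : ℤ → ZMod 11) hQ
    push_cast at e
    rw [h11] at e
    exact nineteen_pow_mod_eleven hm 5 (by rw [← e]; decide)

lemma eight_dvd_two_pow {a : ℕ} (ha : Odd a) (h1 : a ≠ 1) : (2 : ℤ) ^ a = 8 * 2 ^ (a - 3) := by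
  obtain ⟨t, rfl⟩ := ha
  rw [show 2 * t + 1 = (2 * t + 1 - 3) + 3 by omega, pow_add]
  simp
  ring

lemma eleven_pow_mod_eight {l : ℕ} (hl : Even l) : (11 : ZMod 8) ^ l = 1 := by
  obtain ⟨t, rfl⟩ := hl
  rw [← two_mul, pow_mul, (by decide : (11 : ZMod 8) ^ 2 = 1), one_pow]

lemma eq_three_of_two_pow {j l m : ℕ} (hj : Odd j) (hl : Even l) (hm : Odd m) (h19 : ¬ (19 : ℤ) ∣ y)
    (h2 : ¬ (2 : ℤ) ∣ y) (hy : 1 < y) (h : 2 ^ j + 11 ^ l * 19 ^ m = y ^ 3) :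
    y = 3 ∧ (2 : ℤ) ^ j = 8 := by
  have e19 := congrArg (Int.cast : ℤ → ZMod 19) h
  push_cast at e19
  rw [(by decide : (19 : ZMod 19) = 0), zero_pow hm.pos.ne', mul_zero, add_zero,
    pow_eq_pow_mod j (by decide : (2 : ZMod 19) ^ 18 = 1)] at e19
  have hf : ∀ u : ZMod 19, ∀ i : Fin 18, 2 ^ (i : ℕ) = u ^ 3 → (i : ℕ) % 3 = 0 := by decide +kernel
  have hj3 := hf _ ⟨j % 18, Nat.mod_lt _ (by norm_num)⟩ e19
  simp only at hj3
  obtain ⟨a, rfl⟩ : ∃ a, j = a * 3 := ⟨j / 3, by omega⟩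
  rw [pow_mul] at h ⊢
  have ha : Odd a := (Nat.odd_mul.mp hj).1
  have hT : (0 : ℤ) < 2 ^ a := by positivity
  have hTy : (2 : ℤ) ^ a < y := by
    refine lt_of_pow_lt_pow_left₀ 3 (by linarith) ?_
    rw [← h]
    exact lt_add_of_pos_right _ (by positivity)
  obtain ⟨hD, hQ⟩ := cube_sub_cube_eq (j := 0) (l := l) (m := m) hT hTy (by rw [← h]; ring) h2
    (fun hd => by
      have := (Int.prime_iff_natAbs_prime.mpr (by norm_num) : Prime (11 : ℤ)).dvd_of_dvd_pow hd.2
      norm_num at this) h19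
  rw [pow_zero, one_mul] at hD
  have ha1 : a = 1 := by
    by_contra ha1
    have hT8 := eight_dvd_two_pow ha ha1
    have e8 := congrArg (Int.cast : ℤ → ZMod 8) hQ
    have m8 := (ZMod.intCast_eq_intCast_iff (19 ^ m) 3 8).mpr (nineteen_pow_mod_eight hm)
    have d8 := congrArg (Int.cast : ℤ → ZMod 8) hD
    rw [hT8] at e8 d8
    push_cast at e8 m8 d8
    rw [(by decide : (8 : ZMod 8) = 0), zero_mul] at e8 d8
    rw [sub_zero, eleven_pow_mod_eight hl] at d8
    rw [d8, m8] at e8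
    revert e8
    decide
  subst ha1
  rcases Nat.eq_zero_or_pos l with rfl | hl0
  · norm_num at hD ⊢
    linarith
  · exfalso
    have h11 := congrArg (Int.cast : ℤ → ZMod 11) hD
    have e := congrArg (Int.cast : ℤ → ZMod 11) hQ
    push_cast at h11 e
    rw [(by decide : (11 : ZMod 11) = 0), zero_pow hl0.ne', sub_eq_zero] at h11
    rw [h11] at e
    exact nineteen_pow_mod_eleven hm 1 (by rw [← e]; decide)

lemma eq_three_of_nineteen_pow {j l m : ℕ} (hj : Odd j) (hl : Even l) (hm : Odd m)
    (h19 : ¬ (19 : ℤ) ∣ y) (h2 : ¬ (2 : ℤ) ∣ y) (hy : 1 < y)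
    (h : 2 ^ j * 11 ^ l + 19 ^ m = y ^ 3) : y = 3 ∧ (2 : ℤ) ^ j * 11 ^ l = 8 := by
  have hj3 : j % 3 = 0 := by
    have e19 := congrArg (Int.cast : ℤ → ZMod 19) h
    push_cast at e19
    rw [(by decide : (19 : ZMod 19) = 0), zero_pow hm.pos.ne', add_zero,
      pow_eq_pow_mod j (by decide : (2 : ZMod 19) ^ 18 = 1),
      pow_eq_pow_mod l (by decide : (11 : ZMod 19) ^ 3 = 1)] at e19
    have hf : ∀ u : ZMod 19, ∀ k : Fin 3, ∀ i : Fin 18, 2 ^ (i : ℕ) * 11 ^ (k : ℕ) = u ^ 3 →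
      (i : ℕ) % 3 = 0 := by decide +kernel
    have := hf _ ⟨l % 3, Nat.mod_lt _ (by norm_num)⟩ ⟨j % 18, Nat.mod_lt _ (by norm_num)⟩ e19
    simp only at this
    omega
  have hl3 : l % 3 = 0 := by
    have e9 := congrArg (Int.cast : ℤ → ZMod 9) h
    push_cast at e9
    rw [(by decide : (19 : ZMod 9) = 1), one_pow, (by decide : (11 : ZMod 9) = 2), ← pow_add,
      pow_eq_pow_mod (j + l) (by decide : (2 : ZMod 9) ^ 6 = 1)] at e9
    have hf : ∀ u : ZMod 9, ∀ i : Fin 6, 2 ^ (i : ℕ) + 1 = u ^ 3 → (i : ℕ) = 3 ∨ (i : ℕ) = 4 := by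
      decide +kernel
    have := hf _ ⟨(j + l) % 6, Nat.mod_lt _ (by norm_num)⟩ e9
    have ho := hj.add_even hl
    rw [Nat.odd_iff] at ho
    simp only at this
    omega
  obtain ⟨a, rfl⟩ : ∃ a, j = a * 3 := ⟨j / 3, by omega⟩
  obtain ⟨b, rfl⟩ : ∃ b, l = b * 3 := ⟨l / 3, by omega⟩
  rw [pow_mul, pow_mul, ← mul_pow] at h ⊢
  have ha : Odd a := (Nat.odd_mul.mp hj).1
  have hb : Even b := (Nat.even_mul.mp hl).resolve_right (by decide)
  have hTy : (2 : ℤ) ^ a * 11 ^ b < y := by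
    refine lt_of_pow_lt_pow_left₀ 3 (by linarith) ?_
    rw [← h]
    exact lt_add_of_pos_right _ (by positivity)
  have p11 : Prime (11 : ℤ) := Int.prime_iff_natAbs_prime.mpr (by norm_num)
  obtain ⟨hD, hQ⟩ := cube_sub_cube_eq (j := 0) (l := 0) (m := m) (by positivity) hTy
    (by rw [← h]; ring) h2
    (fun hd => by
      have h1 : (11 : ℤ) ∣ 19 ^ m := by
        rw [show (19 : ℤ) ^ m = y ^ 3 - (2 ^ a * 11 ^ b) ^ 3 by rw [← h]; ring]
        exact dvd_sub (dvd_pow hd.1 three_ne_zero) (dvd_pow hd.2 three_ne_zero)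
      have := p11.dvd_of_dvd_pow h1
      norm_num at this) h19
  rw [pow_zero, one_mul, pow_zero] at hD
  have ha1 : a = 1 := by
    by_contra ha1
    have hT8 := eight_dvd_two_pow ha ha1
    have e8 := congrArg (Int.cast : ℤ → ZMod 8) hQ
    have m8 := (ZMod.intCast_eq_intCast_iff (19 ^ m) 3 8).mpr (nineteen_pow_mod_eight hm)
    have d8 := congrArg (Int.cast : ℤ → ZMod 8) hD
    rw [hT8] at e8 d8
    push_cast at e8 m8 d8
    rw [(by decide : (8 : ZMod 8) = 0), zero_mul, zero_mul] at e8 d8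
    rw [sub_zero] at d8
    rw [d8, m8] at e8
    revert e8
    decide
  subst ha1
  rcases Nat.eq_zero_or_pos b with rfl | hb0
  · norm_num at hD ⊢
    linarith
  · exfalso
    have h11 := congrArg (Int.cast : ℤ → ZMod 11) hD
    have e := congrArg (Int.cast : ℤ → ZMod 11) hQ
    push_cast at h11 e
    rw [(by decide : (11 : ZMod 11) = 0), zero_pow hb0.ne', mul_zero] at e h11
    rw [sub_zero] at h11
    rw [h11] at e
    exact nineteen_pow_mod_eleven hm 1 (by rw [← e]; decide)

/-- The remaining exponent patterns, after removing cubes. -/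
lemma cube_eq_eleven_pow_add {j l m : ℕ} (hj : Odd j) (hl : Even l) (hl0 : l ≠ 0) (hm : Odd m)
    (h19 : ¬ (19 : ℤ) ∣ y) (h2 : ¬ (2 : ℤ) ∣ y) (hy : 1 < y)
    (h : 11 ^ l + 2 ^ j * 19 ^ m = y ^ 3) : l % 6 = 2 ∧ j % 6 = 5 ∧ (m % 6 = 1 ∨ m % 6 = 5) := by
  have hl3 : l % 3 ≠ 0 := by
    intro hl3
    obtain ⟨b, rfl⟩ : ∃ b, l = b * 3 := ⟨l / 3, by omega⟩
    rw [pow_mul] at h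
    have hb0 : b ≠ 0 := by rintro rfl; simp at hl0
    have hTy : (11 : ℤ) ^ b < y := by
      refine lt_of_pow_lt_pow_left₀ 3 (by linarith) ?_
      rw [← h]
      exact lt_add_of_pos_right _ (by positivity)
    obtain ⟨hD, hQ⟩ := cube_sub_cube_eq (j := j) (l := 0) (m := m) (by positivity) hTy
      (by rw [← h]; ring) h2
      (fun hd => by
        have p11 : Prime (11 : ℤ) := Int.prime_iff_natAbs_prime.mpr (by norm_num)
        have h1 : (11 : ℤ) ∣ 2 ^ j * 19 ^ m := by
          rw [show (2 : ℤ) ^ j * 19 ^ m = y ^ 3 - (11 ^ b) ^ 3 by rw [← h]; ring]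
          exact dvd_sub (dvd_pow hd.1 three_ne_zero) (dvd_pow hd.2 three_ne_zero)
        rcases p11.dvd_or_dvd h1 with h1 | h1
        · have := p11.dvd_of_dvd_pow h1; norm_num at this
        · have := p11.dvd_of_dvd_pow h1; norm_num at this) h19
    have e := congrArg (Int.cast : ℤ → ZMod 11) hQ
    push_cast at e
    rw [(by decide : (11 : ZMod 11) = 0), zero_pow hb0] at e
    exact nineteen_pow_mod_eleven hm y (by rw [← e]; ring)
  have e9 := congrArg (Int.cast : ℤ → ZMod 9) h
  have e7 := congrArg (Int.cast : ℤ → ZMod 7) h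
  have e13 := congrArg (Int.cast : ℤ → ZMod 13) h
  push_cast at e9 e7 e13
  rw [(by decide : (19 : ZMod 9) = 1), one_pow, mul_one,
    pow_eq_pow_mod j (by decide : (2 : ZMod 9) ^ 12 = 1),
    pow_eq_pow_mod l (by decide : (11 : ZMod 9) ^ 12 = 1)] at e9
  rw [pow_eq_pow_mod j (by decide : (2 : ZMod 7) ^ 12 = 1),
    pow_eq_pow_mod l (by decide : (11 : ZMod 7) ^ 12 = 1),
    pow_eq_pow_mod m (by decide : (19 : ZMod 7) ^ 12 = 1)] at e7
  rw [pow_eq_pow_mod j (by decide : (2 : ZMod 13) ^ 12 = 1),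
    pow_eq_pow_mod l (by decide : (11 : ZMod 13) ^ 12 = 1),
    pow_eq_pow_mod m (by decide : (19 : ZMod 13) ^ 12 = 1)] at e13
  have c9 : ∀ u : ZMod 9, u ^ 3 = 0 ∨ u ^ 3 = 1 ∨ u ^ 3 = -1 := by decide
  have c7 : ∀ u : ZMod 7, u ^ 3 = 0 ∨ (u ^ 3) ^ 2 = 1 := by decide
  have c13 : ∀ u : ZMod 13, u ^ 3 = 0 ∨ (u ^ 3) ^ 4 = 1 := by decide
  replace c9 := c9 y
  replace c7 := c7 y
  replace c13 := c13 y
  rw [← e9] at c9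
  rw [← e7] at c7
  rw [← e13] at c13
  have hf : ∀ l : Fin 12, ∀ j : Fin 12, ∀ m : Fin 12, (l : ℕ) % 2 = 0 → (j : ℕ) % 2 = 1 →
      (m : ℕ) % 2 = 1 → (l : ℕ) % 3 ≠ 0 →
      ((11 : ZMod 9) ^ (l : ℕ) + 2 ^ (j : ℕ) = 0 ∨ (11 : ZMod 9) ^ (l : ℕ) + 2 ^ (j : ℕ) = 1 ∨
        (11 : ZMod 9) ^ (l : ℕ) + 2 ^ (j : ℕ) = -1) →
      ((11 : ZMod 7) ^ (l : ℕ) + 2 ^ (j : ℕ) * 19 ^ (m : ℕ) = 0 ∨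
        ((11 : ZMod 7) ^ (l : ℕ) + 2 ^ (j : ℕ) * 19 ^ (m : ℕ)) ^ 2 = 1) →
      ((11 : ZMod 13) ^ (l : ℕ) + 2 ^ (j : ℕ) * 19 ^ (m : ℕ) = 0 ∨
        ((11 : ZMod 13) ^ (l : ℕ) + 2 ^ (j : ℕ) * 19 ^ (m : ℕ)) ^ 4 = 1) →
      (l : ℕ) % 6 = 2 ∧ (j : ℕ) % 6 = 5 ∧ ((m : ℕ) % 6 = 1 ∨ (m : ℕ) % 6 = 5) := by
    decide +kernel
  have hl2 := Nat.even_iff.mp hl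
  have hj2 := Nat.odd_iff.mp hj
  have hm2 := Nat.odd_iff.mp hm
  have := hf ⟨l % 12, Nat.mod_lt _ (by norm_num)⟩ ⟨j % 12, Nat.mod_lt _ (by norm_num)⟩
    ⟨m % 12, Nat.mod_lt _ (by norm_num)⟩ (by simp only; omega) (by simp only; omega)
    (by simp only; omega) (by simp only; omega) c9 c7 c13
  simp only at this
  omega

end Thirty

/-- The ring `ℤ[ϑ]` with `ϑ ^ 3 = m`; the element `⟨a, b, c⟩` is `a + b ϑ + c ϑ ^ 2`. -/
@[ext] structure PureCubic (m : ℤ) where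
  a : ℤ
  b : ℤ
  c : ℤ

namespace PureCubic

variable {m : ℤ}

instance : Zero (PureCubic m) := ⟨⟨0, 0, 0⟩⟩
instance : One (PureCubic m) := ⟨⟨1, 0, 0⟩⟩
instance : Add (PureCubic m) := ⟨fun α β => ⟨α.a + β.a, α.b + β.b, α.c + β.c⟩⟩
instance : Neg (PureCubic m) := ⟨fun α => ⟨-α.a, -α.b, -α.c⟩⟩
instance : Mul (PureCubic m) := ⟨fun α β => ⟨α.a * β.a + m * (α.b * β.c + α.c * β.b),
  α.a * β.b + α.b * β.a + m * (α.c * β.c), α.a * β.c + α.b * β.b + α.c * β.a⟩⟩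
instance : NatCast (PureCubic m) := ⟨fun n => ⟨n, 0, 0⟩⟩
instance : IntCast (PureCubic m) := ⟨fun n => ⟨n, 0, 0⟩⟩

@[simp] lemma zero_a : (0 : PureCubic m).a = 0 := rfl
@[simp] lemma zero_b : (0 : PureCubic m).b = 0 := rfl
@[simp] lemma zero_c : (0 : PureCubic m).c = 0 := rfl
@[simp] lemma one_a : (1 : PureCubic m).a = 1 := rfl
@[simp] lemma one_b : (1 : PureCubic m).b = 0 := rfl
@[simp] lemma one_c : (1 : PureCubic m).c = 0 := rfl
@[simp] lemma add_a (α β : PureCubic m) : (α + β).a = α.a + β.a := rfl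
@[simp] lemma add_b (α β : PureCubic m) : (α + β).b = α.b + β.b := rfl
@[simp] lemma add_c (α β : PureCubic m) : (α + β).c = α.c + β.c := rfl
@[simp] lemma neg_a (α : PureCubic m) : (-α).a = -α.a := rfl
@[simp] lemma neg_b (α : PureCubic m) : (-α).b = -α.b := rfl
@[simp] lemma neg_c (α : PureCubic m) : (-α).c = -α.c := rfl
@[simp] lemma mul_a (α β : PureCubic m) :
    (α * β).a = α.a * β.a + m * (α.b * β.c + α.c * β.b) := rfl
@[simp] lemma mul_b (α β : PureCubic m) :
    (α * β).b = α.a * β.b + α.b * β.a + m * (α.c * β.c) := rfl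
@[simp] lemma mul_c (α β : PureCubic m) :
    (α * β).c = α.a * β.c + α.b * β.b + α.c * β.a := rfl
@[simp] lemma intCast_a (n : ℤ) : (n : PureCubic m).a = n := rfl
@[simp] lemma intCast_b (n : ℤ) : (n : PureCubic m).b = 0 := rfl
@[simp] lemma intCast_c (n : ℤ) : (n : PureCubic m).c = 0 := rfl
@[simp] lemma natCast_a (n : ℕ) : (n : PureCubic m).a = n := rfl
@[simp] lemma natCast_b (n : ℕ) : (n : PureCubic m).b = 0 := rfl
@[simp] lemma natCast_c (n : ℕ) : (n : PureCubic m).c = 0 := rfl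

instance : CommRing (PureCubic m) where
  add_assoc _ _ _ := by ext <;> simp <;> ring
  zero_add _ := by ext <;> simp
  add_zero _ := by ext <;> simp
  add_comm _ _ := by ext <;> simp <;> ring
  mul_assoc _ _ _ := by ext <;> simp <;> ring
  one_mul _ := by ext <;> simp
  mul_one _ := by ext <;> simp
  zero_mul _ := by ext <;> simp
  mul_zero _ := by ext <;> simp
  left_distrib _ _ _ := by ext <;> simp <;> ring
  right_distrib _ _ _ := by ext <;> simp <;> ring
  neg_add_cancel _ := by ext <;> simp
  mul_comm _ _ := by ext <;> simp <;> ring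
  nsmul := nsmulRec
  zsmul := zsmulRec
  natCast_zero := by ext <;> simp
  natCast_succ _ := by ext <;> simp
  intCast_ofNat _ := by ext <;> simp
  intCast_negSucc _ := by ext <;> simp [Int.negSucc_eq]

@[simp] lemma sub_a (α β : PureCubic m) : (α - β).a = α.a - β.a := by simp [sub_eq_add_neg]
@[simp] lemma sub_b (α β : PureCubic m) : (α - β).b = α.b - β.b := by simp [sub_eq_add_neg]
@[simp] lemma sub_c (α β : PureCubic m) : (α - β).c = α.c - β.c := by simp [sub_eq_add_neg]

lemma intCast_mul_eq (n : ℤ) (α : PureCubic m) : (n : PureCubic m) * α = ⟨n * α.a, n * α.b, n * α.c⟩ := by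
  ext <;> simp

lemma intCast_dvd {n : ℤ} {α : PureCubic m} (h : (n : PureCubic m) ∣ α) :
    n ∣ α.a ∧ n ∣ α.b ∧ n ∣ α.c := by
  obtain ⟨β, rfl⟩ := h
  rw [intCast_mul_eq]
  exact ⟨⟨_, rfl⟩, ⟨_, rfl⟩, ⟨_, rfl⟩⟩

/-- Evaluation at a cube root of `m`. -/
def ev {R : Type*} [CommRing R] (ρ : R) (hρ : ρ ^ 3 = m) : PureCubic m →+* R where
  toFun α := α.a + α.b * ρ + α.c * ρ ^ 2
  map_zero' := by simp
  map_one' := by simp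
  map_add' α β := by simp; ring
  map_mul' α β := by
    simp only [mul_a, mul_b, mul_c]
    push_cast
    rw [← hρ]
    ring

lemma ev_apply {R : Type*} [CommRing R] (ρ : R) (hρ : ρ ^ 3 = m) (α : PureCubic m) :
    ev ρ hρ α = α.a + α.b * ρ + α.c * ρ ^ 2 := rfl

/-- The norm `ℤ[ϑ] → ℤ`. -/
def norm : PureCubic m →* ℤ where
  toFun α := α.a ^ 3 + m * α.b ^ 3 + m ^ 2 * α.c ^ 3 - 3 * m * α.a * α.b * α.c
  map_one' := by simp
  map_mul' α β := by
    simp only [mul_a, mul_b, mul_c]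
    ring

lemma norm_apply (α : PureCubic m) :
    norm α = α.a ^ 3 + m * α.b ^ 3 + m ^ 2 * α.c ^ 3 - 3 * m * α.a * α.b * α.c := rfl

/-- The absolute value squared of the complex conjugate of `a + b θ + c θ ^ 2`, as a quadratic form. -/
lemma norm_eq_ev_mul {θ : ℝ} (hθ : θ ^ 3 = m) (α : PureCubic m) :
    (norm α : ℝ) = ev θ hθ α * ((α.a - (α.b * θ + α.c * θ ^ 2) / 2) ^ 2
      + 3 / 4 * (α.b * θ - α.c * θ ^ 2) ^ 2) := by
  rw [norm_apply, ev_apply]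
  push_cast
  rw [← hθ]
  ring

lemma ev_pos {θ : ℝ} (hθ : θ ^ 3 = m) {α : PureCubic m} (h : norm α = 1) : 0 < ev θ hθ α := by
  have e := norm_eq_ev_mul hθ α
  rw [h] at e
  by_contra! hn
  have : 0 ≤ (α.a - (α.b * θ + α.c * θ ^ 2) / 2) ^ 2 + 3 / 4 * (α.b * θ - α.c * θ ^ 2) ^ 2 := by
    positivity
  have := mul_nonpos_of_nonpos_of_nonneg hn this
  push_cast at e
  linarith

/-- If the only element of norm one in `[1, ε)` is `1` then the elements of norm one are the powers
of the unit `ε`. -/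
lemma exists_zpow_eq {θ : ℝ} (hθ : θ ^ 3 = m) (ε : (PureCubic m)ˣ) (hε : norm (ε : PureCubic m) = 1)
    (h1 : 1 < ev θ hθ ε)
    (h : ∀ α : PureCubic m, norm α = 1 → 1 ≤ ev θ hθ α → ev θ hθ α < ev θ hθ ε → α = 1)
    {α : PureCubic m} (hα : norm α = 1) : ∃ s : ℤ, α = (ε ^ s : (PureCubic m)ˣ) := by
  obtain ⟨s, hs1, hs2⟩ := exists_mem_Ico_zpow (ev_pos hθ hα) h1
  have hz : ∀ t : ℤ, norm ((ε ^ t : (PureCubic m)ˣ) : PureCubic m) = 1 := by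
    intro t
    have : Units.map norm ε = 1 := Units.ext hε
    have h2 : Units.map norm (ε ^ t) = 1 := by rw [map_zpow, this, one_zpow]
    exact congrArg Units.val h2
  have hv : ∀ t : ℤ, ev θ hθ ((ε ^ t : (PureCubic m)ˣ) : PureCubic m) = ev θ hθ ε ^ t := by
    intro t
    have := congrArg Units.val (map_zpow (Units.map (ev θ hθ : PureCubic m →* ℝ)) ε t)
    rw [Units.val_zpow_eq_zpow_val] at this
    exact this
  refine ⟨s, ?_⟩
  have hpos : 0 < ev θ hθ (ε : PureCubic m) := by linarith
  have key := h (α * (ε ^ (-s) : (PureCubic m)ˣ)) (by rw [map_mul, hα, hz, one_mul]) ?_ ?_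
  · rw [zpow_neg] at key
    exact (Units.mul_inv_eq_one).mp key
  · rw [map_mul, hv, zpow_neg, ← div_eq_mul_inv, le_div_iff₀ (by positivity), one_mul]
    exact hs1
  · rw [map_mul, hv, zpow_neg, ← div_eq_mul_inv, div_lt_iff₀ (by positivity), mul_comm,
      ← zpow_add_one₀ hpos.ne']
    exact hs2

/-- Bounds for an element of norm one in `[1, T)`. -/
lemma coord_bounds {θ T : ℝ} (hθ : θ ^ 3 = m) {α : PureCubic m}
    (hα : norm α = 1) (h1 : 1 ≤ ev θ hθ α) (hT : ev θ hθ α < T) :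
    |(α.b - α.c * θ) * θ| ≤ 1.16 ∧ |α.a - α.c * θ ^ 2| ≤ 1.58 ∧ -2 < 3 * θ ^ 2 * α.c ∧
      3 * θ ^ 2 * α.c < T + 3 := by
  have e := norm_eq_ev_mul hθ α
  rw [hα] at e
  push_cast at e
  set X := (α.a : ℝ) - (α.b * θ + α.c * θ ^ 2) / 2 with hX
  set D := (α.b : ℝ) * θ - α.c * θ ^ 2 with hD
  have hQ : X ^ 2 + 3 / 4 * D ^ 2 ≤ 1 := by
    by_contra! hn
    have : 1 * (X ^ 2 + 3 / 4 * D ^ 2) ≤ ev θ hθ α * (X ^ 2 + 3 / 4 * D ^ 2) := by gcongr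
    linarith
  have hX1 : |X| ≤ 1 := by
    rw [← sq_le_one_iff_abs_le_one]; nlinarith
  have hD1 : |D| ≤ 1.16 := by
    apply abs_le_of_sq_le_sq _ (by norm_num)
    nlinarith
  have hv : ev θ hθ α = 3 * θ ^ 2 * α.c + X + 3 / 2 * D := by
    rw [ev_apply, hX, hD]; ring
  rw [abs_le] at hX1 hD1
  refine ⟨by rw [abs_le]; constructor <;> nlinarith, ?_, by linarith, by linarith⟩
  have ha : (α.a : ℝ) - α.c * θ ^ 2 = X + D / 2 := by rw [hX, hD]; ring
  rw [ha, abs_le]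
  constructor <;> linarith

/-- Divisibility by the square of the degree one prime above `11`. -/
lemma exists_eq_mul_of_dvd_norm {ρ : ℤ} {ξ ξ' g₁ g₂ : PureCubic m} (h3 : (121 : ℤ) ∣ ρ ^ 3 - m)
    (hξ : ξ * ξ' = ⟨121, 0, 0⟩) (hg₁ : ξ * g₁ = ⟨-ρ, 1, 0⟩) (hg₂ : ξ * g₂ = ⟨-ρ ^ 2, 0, 1⟩)
    (hρ : ¬ (11 : ℤ) ∣ ρ) {α : PureCubic m} (hN : (121 : ℤ) ∣ norm α)
    (hα : ¬ ((11 : ℤ) : PureCubic m) ∣ α * ⟨-ρ, 1, 0⟩) : ∃ β, α = ξ * β := by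
  obtain ⟨a, b, c⟩ := α
  set L := a + b * ρ + c * ρ ^ 2 with hL
  set Q := (2 * a - b * ρ - c * ρ ^ 2) ^ 2 + 3 * (b * ρ - c * ρ ^ 2) ^ 2 with hQ
  have hdvd : (121 : ℤ) ∣ L * Q := by
    obtain ⟨t, ht⟩ := h3
    obtain ⟨n, hn⟩ := hN
    rw [norm_apply] at hn
    simp only at hn
    refine ⟨4 * n + 4 * t * (b ^ 3 + c ^ 3 * (ρ ^ 3 + m) - 3 * a * b * c), ?_⟩
    have : m = ρ ^ 3 - 121 * t := by linarith
    subst this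
    rw [hL, hQ]
    linear_combination 4 * hn
  have hQ11 : ¬ (11 : ℤ) ∣ Q := by
    intro hd
    have hz := (ZMod.intCast_zmod_eq_zero_iff_dvd Q 11).mpr hd
    have key : ∀ u v : ZMod 11, u ^ 2 + 3 * v ^ 2 = 0 → u = 0 ∧ v = 0 := by decide
    rw [hQ] at hz
    push_cast at hz
    obtain ⟨hu, hv⟩ := key _ _ hz
    have hu' : (11 : ℤ) ∣ 2 * a - b * ρ - c * ρ ^ 2 :=
      (ZMod.intCast_zmod_eq_zero_iff_dvd _ 11).mp (by push_cast; exact hu)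
    have hv' : (11 : ℤ) ∣ ρ * (b - c * ρ) :=
      (ZMod.intCast_zmod_eq_zero_iff_dvd _ 11).mp (by push_cast; linear_combination hv)
    have hp : Prime (11 : ℤ) := by norm_num
    obtain ⟨v, hv⟩ := (hp.dvd_or_dvd hv').resolve_left hρ
    have ha : (11 : ℤ) ∣ a - b * ρ := by
      have : (11 : ℤ) ∣ 2 * (a - b * ρ) := by
        have : 2 * (a - b * ρ) = (2 * a - b * ρ - c * ρ ^ 2) - 11 * (v * ρ) := by
          linear_combination -ρ * hv
        rw [this]
        exact dvd_sub hu' (dvd_mul_right _ _)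
      exact (hp.dvd_or_dvd this).resolve_left (by norm_num)
    obtain ⟨u, hu⟩ := ha
    obtain ⟨t, ht⟩ := h3
    apply hα
    refine ⟨⟨-u * ρ - v * ρ ^ 2 - 11 * t * c, u, v⟩, ?_⟩
    rw [intCast_mul_eq]
    ext
    · simp
      linear_combination -ρ * hu - ρ ^ 2 * hv - c * ht
    · simp
      linear_combination hu
    · simp
      linear_combination hv
  have hL' : (121 : ℤ) ∣ L := by
    have hc : IsCoprime (121 : ℤ) Q := by
      have : IsCoprime (11 : ℤ) Q := (Prime.coprime_iff_not_dvd (by norm_num)).mpr hQ11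
      simpa using this.pow_left (m := 2)
    exact hc.dvd_of_dvd_mul_right hdvd
  obtain ⟨A, hA⟩ := hL'
  refine ⟨A * ξ' + b * g₁ + c * g₂, ?_⟩
  have : ξ * (A * ξ' + b * g₁ + c * g₂) = A * (ξ * ξ') + b * (ξ * g₁) + c * (ξ * g₂) := by ring
  rw [this, hξ, hg₁, hg₂]
  ext
  · simp
    linarith
  · simp
  · simp

lemma exists_eq_pow_mul {ρ : ℤ} {ξ ξ' g₁ g₂ : PureCubic m} (h3 : (121 : ℤ) ∣ ρ ^ 3 - m)
    (hξ : ξ * ξ' = ⟨121, 0, 0⟩) (hg₁ : ξ * g₁ = ⟨-ρ, 1, 0⟩) (hg₂ : ξ * g₂ = ⟨-ρ ^ 2, 0, 1⟩)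
    (hρ : ¬ (11 : ℤ) ∣ ρ) (hNξ : norm ξ = 121) (n : ℕ) {α : PureCubic m} (hN : norm α = 121 ^ n)
    (hα : ¬ ((11 : ℤ) : PureCubic m) ∣ α * ⟨-ρ, 1, 0⟩) : ∃ u, norm u = 1 ∧ α = ξ ^ n * u := by
  induction n generalizing α with
  | zero => exact ⟨α, by simpa using hN, by simp⟩
  | succ n ih =>
    obtain ⟨β, rfl⟩ := exists_eq_mul_of_dvd_norm h3 hξ hg₁ hg₂ hρ
      (by rw [hN, pow_succ]; exact dvd_mul_left _ _) hα
    rw [map_mul, hNξ, pow_succ] at hN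
    obtain ⟨u, hu, rfl⟩ := ih (α := β) (by linarith) fun ⟨γ, hγ⟩ =>
      hα ⟨ξ * γ, by rw [mul_assoc, hγ]; ring⟩
    exact ⟨u, hu, by ring⟩

lemma exists_cube_root {m : ℝ} (hm : 0 < m) : ∃ θ : ℝ, 0 < θ ∧ θ ^ 3 = m :=
  ⟨m ^ ((3 : ℕ) : ℝ)⁻¹, by positivity, Real.rpow_inv_natCast_pow hm.le (by norm_num)⟩

/-- The fundamental unit `305 + 72 ϑ + 17 ϑ ^ 2` of `ℤ[∛76]`. -/
def unitSeventySix : (PureCubic 76)ˣ where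
  val := ⟨305, 72, 17⟩
  inv := ⟨1, 4, -1⟩
  val_inv := by ext <;> simp
  inv_val := by ext <;> simp

/-- The fundamental unit `29071 + 8647 ϑ + 2572 ϑ ^ 2` of `ℤ[∛38]`. -/
def unitThirtyEight : (PureCubic 38)ˣ where
  val := ⟨29071, 8647, 2572⟩
  inv := ⟨-151, 55, -3⟩
  val_inv := by ext <;> simp
  inv_val := by ext <;> simp

lemma exists_zpow_seventySix {α : PureCubic 76} (hα : norm α = 1) :
    ∃ s : ℤ, α = (unitSeventySix ^ s : (PureCubic 76)ˣ) := by
  obtain ⟨θ, h0, hθ⟩ := exists_cube_root (m := 76) (by norm_num)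
  have hlo : 4.2358 < θ := lt_of_pow_lt_pow_left₀ 3 h0.le (by rw [hθ]; norm_num)
  have hhi : θ < 4.2359 := lt_of_pow_lt_pow_left₀ 3 (by norm_num) (by rw [hθ]; norm_num)
  have hlo2 : 17.942 < θ ^ 2 := by nlinarith
  have hhi2 : θ ^ 2 < 17.943 := by nlinarith
  have hθ' : θ ^ 3 = ((76 : ℤ) : ℝ) := by push_cast; exact hθ
  have hev : ev θ hθ' (unitSeventySix : PureCubic 76) = 305 + 72 * θ + 17 * θ ^ 2 := by
    rw [ev_apply]; simp [unitSeventySix]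
  refine exists_zpow_eq hθ' unitSeventySix (by rw [norm_apply]; simp [unitSeventySix]) ?_ ?_ hα
  · rw [hev]; nlinarith
  · intro α hα h1 h2
    obtain ⟨hb, ha, hc1, hc2⟩ := coord_bounds hθ' hα h1 (T := 916) (h2.trans (by rw [hev]; nlinarith))
    obtain ⟨a, b, c⟩ := α
    simp only at hb ha hc1 hc2
    have c0 : 0 ≤ c := by
      by_contra! hn
      have : (c : ℝ) ≤ -1 := by exact_mod_cast Int.le_sub_one_of_lt hn
      nlinarith
    have c18 : c < 18 := by
      by_contra! hn
      have : (18 : ℝ) ≤ c := by exact_mod_cast hn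
      nlinarith
    have c0' : (0 : ℝ) ≤ c := by exact_mod_cast c0
    have c18' : (c : ℝ) ≤ 18 := by exact_mod_cast c18.le
    have hb' : |(b : ℝ) - c * θ| ≤ 0.3 := by
      rw [abs_mul, abs_of_pos h0] at hb
      by_contra! hn
      nlinarith
    rw [abs_le] at hb' ha
    obtain ⟨hb1, hb2⟩ := hb'
    obtain ⟨ha1, ha2⟩ := ha
    have hcl : 4.2358 * (c : ℝ) ≤ c * θ := by nlinarith
    have hch : c * θ ≤ 4.2358 * c + 0.0018 := by nlinarith
    have hcl2 : 17.942 * (c : ℝ) ≤ c * θ ^ 2 := by nlinarith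
    have hch2 : c * θ ^ 2 ≤ 17.942 * c + 0.018 := by nlinarith
    have eb1 : 42358 * c - 3000 ≤ 10000 * b := by
      have : (42358 : ℝ) * c - 3000 ≤ 10000 * b := by linarith
      exact_mod_cast this
    have eb2 : 10000 * b ≤ 42358 * c + 3018 := by
      have : (10000 : ℝ) * b ≤ 42358 * c + 3018 := by linarith
      exact_mod_cast this
    have ea1 : 17942 * c - 1580 ≤ 1000 * a := by
      have : (17942 : ℝ) * c - 1580 ≤ 1000 * a := by linarith
      exact_mod_cast this
    have ea2 : 1000 * a ≤ 17942 * c + 1598 := by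
      have : (1000 : ℝ) * a ≤ 17942 * c + 1598 := by linarith
      exact_mod_cast this
    have eb : b = (2 * 42358 * c + 10000) / 20000 := by omega
    obtain ⟨i, hi, ea⟩ : ∃ i : ℕ, i < 4 ∧ a = 17942 * c / 1000 + i - 1 :=
      ⟨(a + 1 - 17942 * c / 1000).toNat, by omega, by omega⟩
    lift c to ℕ using c0
    have key : ∀ c : ℕ, c < 18 → ∀ i : ℕ, i < 4 → norm (⟨17942 * (c : ℤ) / 1000 + (i : ℤ) - 1,
        (2 * 42358 * (c : ℤ) + 10000) / 20000, c⟩ : PureCubic 76) = 1 →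
        c = 0 ∧ i = 2 ∨ c = 17 ∧ i = 1 := by
      decide +kernel
    rw [ea, eb] at hα h2 ⊢
    rcases key c (by exact_mod_cast c18) i hi hα with ⟨rfl, rfl⟩ | ⟨rfl, rfl⟩
    · rfl
    · exact absurd h2 (lt_irrefl _)

lemma exists_zpow_thirtyEight {α : PureCubic 38} (hα : norm α = 1) :
    ∃ s : ℤ, α = (unitThirtyEight ^ s : (PureCubic 38)ˣ) := by
  obtain ⟨θ, h0, hθ⟩ := exists_cube_root (m := 38) (by norm_num)
  have hlo : 3.361975 < θ := lt_of_pow_lt_pow_left₀ 3 h0.le (by rw [hθ]; norm_num)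
  have hhi : θ < 3.361976 := lt_of_pow_lt_pow_left₀ 3 (by norm_num) (by rw [hθ]; norm_num)
  have hlo2 : 11.30287 < θ ^ 2 := by nlinarith
  have hhi2 : θ ^ 2 < 11.30289 := by nlinarith
  have hθ' : θ ^ 3 = ((38 : ℤ) : ℝ) := by push_cast; exact hθ
  have hev : ev θ hθ' (unitThirtyEight : PureCubic 38) = 29071 + 8647 * θ + 2572 * θ ^ 2 := by
    rw [ev_apply]; simp [unitThirtyEight]
  refine exists_zpow_eq hθ' unitThirtyEight (by rw [norm_apply]; simp [unitThirtyEight]) ?_ ?_ hα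
  · rw [hev]; nlinarith
  · intro α hα h1 h2
    obtain ⟨hb, ha, hc1, hc2⟩ := coord_bounds hθ' hα h1 (T := 87220) (h2.trans (by rw [hev]; nlinarith))
    obtain ⟨a, b, c⟩ := α
    simp only at hb ha hc1 hc2
    have c0 : 0 ≤ c := by
      by_contra! hn
      have : (c : ℝ) ≤ -1 := by exact_mod_cast Int.le_sub_one_of_lt hn
      nlinarith
    have c18 : c < 2600 := by
      by_contra! hn
      have : (2600 : ℝ) ≤ c := by exact_mod_cast hn
      nlinarith
    have c0' : (0 : ℝ) ≤ c := by exact_mod_cast c0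
    have c18' : (c : ℝ) ≤ 2600 := by exact_mod_cast c18.le
    have hb' : |(b : ℝ) - c * θ| ≤ 0.35 := by
      rw [abs_mul, abs_of_pos h0] at hb
      by_contra! hn
      nlinarith
    rw [abs_le] at hb' ha
    obtain ⟨hb1, hb2⟩ := hb'
    obtain ⟨ha1, ha2⟩ := ha
    have hcl : 3.361975 * (c : ℝ) ≤ c * θ := by nlinarith
    have hch : c * θ ≤ 3.361975 * c + 0.0026 := by nlinarith
    have hcl2 : 11.30287 * (c : ℝ) ≤ c * θ ^ 2 := by nlinarith
    have hch2 : c * θ ^ 2 ≤ 11.30287 * c + 0.052 := by nlinarith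
    have eb1 : 3361975 * c - 350000 ≤ 1000000 * b := by
      have : (3361975 : ℝ) * c - 350000 ≤ 1000000 * b := by linarith
      exact_mod_cast this
    have eb2 : 1000000 * b ≤ 3361975 * c + 352600 := by
      have : (1000000 : ℝ) * b ≤ 3361975 * c + 352600 := by linarith
      exact_mod_cast this
    have ea1 : 1130287 * c - 158000 ≤ 100000 * a := by
      have : (1130287 : ℝ) * c - 158000 ≤ 100000 * a := by linarith
      exact_mod_cast this
    have ea2 : 100000 * a ≤ 1130287 * c + 163200 := by
      have : (100000 : ℝ) * a ≤ 1130287 * c + 163200 := by linarith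
      exact_mod_cast this
    have eb : b = (2 * 3361975 * c + 1000000) / 2000000 := by omega
    obtain ⟨i, hi, ea⟩ : ∃ i : ℕ, i < 4 ∧ a = 1130287 * c / 100000 + i - 1 :=
      ⟨(a + 1 - 1130287 * c / 100000).toNat, by omega, by omega⟩
    lift c to ℕ using c0
    have key : ∀ c : ℕ, c < 2600 → ∀ i : ℕ, i < 4 → norm (⟨1130287 * (c : ℤ) / 100000 + (i : ℤ) - 1,
        (2 * 3361975 * (c : ℤ) + 1000000) / 2000000, c⟩ : PureCubic 38) = 1 →
        c = 0 ∧ i = 2 ∨ c = 2572 ∧ i = 2 := by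
      decide +kernel
    rw [ea, eb] at hα h2 ⊢
    rcases key c (by exact_mod_cast c18) i hi hα with ⟨rfl, rfl⟩ | ⟨rfl, rfl⟩
    · rfl
    · exact absurd h2 (lt_irrefl _)

lemma map_zpow_eq {A R : Type*} [CommRing A] [CommRing R] (f : A →+* R) (ε : Aˣ) {N : ℕ}
    (hN : 0 < N) (h : f ε ^ N = 1) (s : ℤ) :
    f ((ε ^ s : Aˣ) : A) = f ε ^ (s % N).toNat := by
  have hu : Units.map (f : A →* R) ε ^ N = 1 := Units.ext (by simpa using h)
  have h1 : Units.map (f : A →* R) (ε ^ s) = Units.map (f : A →* R) ε ^ (s % N).toNat := by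
    rw [map_zpow, ← zpow_natCast, Int.toNat_of_nonneg (Int.emod_nonneg s (by omega)),
      Int.emod_def, zpow_sub, zpow_mul, zpow_natCast, hu, one_zpow, inv_one, mul_one]
  have h2 := congrArg Units.val h1
  rw [Units.val_pow_eq_pow_val] at h2
  exact h2

/-- `ρ` is a cube root of `m` modulo `q`, and `e`, `x` are the values of `ε`, `ξ` there, of order
dividing `N`. -/
structure Residues (q N : ℕ) (ε ξ : PureCubic m) (ρ e x : ℕ) : Prop where
  cube : (ρ : ZMod q) ^ 3 = m
  left : ev (ρ : ZMod q) cube ε = e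
  right : ev (ρ : ZMod q) cube ξ = x
  left_pow : (e : ZMod q) ^ N = 1
  right_pow : (x : ZMod q) ^ N = 1

lemma Residues.ev_eq {q N ρ e x : ℕ} {ε : (PureCubic m)ˣ} {ξ : PureCubic m}
    (h : Residues q N ε ξ ρ e x) (hN : 0 < N) (s : ℤ) (n : ℕ) :
    ev (ρ : ZMod q) h.cube ((ε ^ s : (PureCubic m)ˣ) * ξ ^ n) =
      ((e ^ (s % N).toNat * x ^ (n % N) : ℕ) : ZMod q) := by
  rw [map_mul, map_pow, map_zpow_eq _ ε hN (by rw [h.left, h.left_pow]), h.left, h.right,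
    pow_eq_pow_mod n h.right_pow]
  push_cast
  rfl

lemma sum_mul_ev {R : Type*} [CommRing R] {ρ₁ ρ₂ ρ₃ : R} (h₁ : ρ₁ ^ 3 = m) (h₂ : ρ₂ ^ 3 = m)
    (h₃ : ρ₃ ^ 3 = m) (hs : ρ₁ + ρ₂ + ρ₃ = 0) (hs2 : ρ₁ ^ 2 + ρ₂ ^ 2 + ρ₃ ^ 2 = 0)
    {α : PureCubic m} (hα : α.c = 0) :
    ρ₁ * ev ρ₁ h₁ α + ρ₂ * ev ρ₂ h₂ α + ρ₃ * ev ρ₃ h₃ α = 0 := by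
  simp only [ev_apply, hα, Int.cast_zero]
  linear_combination α.a * hs + α.b * hs2

lemma sum_sq_mul_ev {R : Type*} [CommRing R] {ρ₁ ρ₂ ρ₃ : R} (h₁ : ρ₁ ^ 3 = m) (h₂ : ρ₂ ^ 3 = m)
    (h₃ : ρ₃ ^ 3 = m) (hs : ρ₁ + ρ₂ + ρ₃ = 0) (hs2 : ρ₁ ^ 2 + ρ₂ ^ 2 + ρ₃ ^ 2 = 0)
    {α : PureCubic m} (hα : α.b = 0) :
    ρ₁ ^ 2 * ev ρ₁ h₁ α + ρ₂ ^ 2 * ev ρ₂ h₂ α + ρ₃ ^ 2 * ev ρ₃ h₃ α = 0 := by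
  simp only [ev_apply, hα, Int.cast_zero]
  linear_combination α.a * hs2 + α.c * (ρ₁ * h₁ + ρ₂ * h₂ + ρ₃ * h₃) + m * α.c * hs

lemma dvd_sum_of_c_eq_zero {q N ρ₁ ρ₂ ρ₃ e₁ e₂ e₃ x₁ x₂ x₃ : ℕ} {ε : (PureCubic m)ˣ}
    {ξ : PureCubic m} (hN : 0 < N) (h₁ : Residues q N ε ξ ρ₁ e₁ x₁)
    (h₂ : Residues q N ε ξ ρ₂ e₂ x₂) (h₃ : Residues q N ε ξ ρ₃ e₃ x₃)
    (hs : (ρ₁ + ρ₂ + ρ₃ : ZMod q) = 0) (hs2 : (ρ₁ ^ 2 + ρ₂ ^ 2 + ρ₃ ^ 2 : ZMod q) = 0)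
    {s : ℤ} {n : ℕ} (hc : (((ε ^ s : (PureCubic m)ˣ) : PureCubic m) * ξ ^ n).c = 0) :
    (ρ₁ * (e₁ ^ (s % N).toNat * x₁ ^ (n % N)) + ρ₂ * (e₂ ^ (s % N).toNat * x₂ ^ (n % N))
      + ρ₃ * (e₃ ^ (s % N).toNat * x₃ ^ (n % N))) % q = 0 := by
  have h := sum_mul_ev h₁.cube h₂.cube h₃.cube hs hs2 hc
  rw [h₁.ev_eq hN, h₂.ev_eq hN, h₃.ev_eq hN] at h
  apply Nat.mod_eq_zero_of_dvd
  rw [← ZMod.natCast_eq_zero_iff]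
  push_cast at h ⊢
  exact h

lemma dvd_sum_of_b_eq_zero {q N ρ₁ ρ₂ ρ₃ e₁ e₂ e₃ x₁ x₂ x₃ : ℕ} {ε : (PureCubic m)ˣ}
    {ξ : PureCubic m} (hN : 0 < N) (h₁ : Residues q N ε ξ ρ₁ e₁ x₁)
    (h₂ : Residues q N ε ξ ρ₂ e₂ x₂) (h₃ : Residues q N ε ξ ρ₃ e₃ x₃)
    (hs : (ρ₁ + ρ₂ + ρ₃ : ZMod q) = 0) (hs2 : (ρ₁ ^ 2 + ρ₂ ^ 2 + ρ₃ ^ 2 : ZMod q) = 0)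
    {s : ℤ} {n : ℕ} (hb : (((ε ^ s : (PureCubic m)ˣ) : PureCubic m) * ξ ^ n).b = 0) :
    (ρ₁ ^ 2 * (e₁ ^ (s % N).toNat * x₁ ^ (n % N)) + ρ₂ ^ 2 * (e₂ ^ (s % N).toNat * x₂ ^ (n % N))
      + ρ₃ ^ 2 * (e₃ ^ (s % N).toNat * x₃ ^ (n % N))) % q = 0 := by
  have h := sum_sq_mul_ev h₁.cube h₂.cube h₃.cube hs hs2 hb
  rw [h₁.ev_eq hN, h₂.ev_eq hN, h₃.ev_eq hN] at h
  apply Nat.mod_eq_zero_of_dvd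
  rw [← ZMod.natCast_eq_zero_iff]
  push_cast at h ⊢
  exact h

/-- No `y - W ∛38 ^ 2` is a product of a unit and a power of `9 - 6 ∛38 + ∛38 ^ 2` with exponent
congruent to `1` modulo `3`. -/
lemma b_ne_zero_thirtyEight (s : ℤ) {n : ℕ} (hn : n % 3 = 1) :
    (((unitThirtyEight ^ s : (PureCubic 38)ˣ) : PureCubic 38) * ⟨9, -6, 1⟩ ^ n).b ≠ 0 := by
  intro hb
  have h13 := dvd_sum_of_b_eq_zero (q := 13) (N := 36) (ρ₁ := 4) (ρ₂ := 10) (ρ₃ := 12) (e₁ := 5)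
    (e₂ := 5) (e₃ := 12) (x₁ := 1) (x₂ := 10) (x₃ := 3) (by norm_num)
    ⟨by decide, by decide, by decide, by decide +kernel, by decide +kernel⟩
    ⟨by decide, by decide, by decide, by decide +kernel, by decide +kernel⟩
    ⟨by decide, by decide, by decide, by decide +kernel, by decide +kernel⟩ (by decide) (by decide) hb
  have h37 := dvd_sum_of_b_eq_zero (q := 37) (N := 36) (ρ₁ := 1) (ρ₂ := 10) (ρ₃ := 26) (e₁ := 34)
    (e₂ := 3) (e₃ := 4) (x₁ := 4) (x₂ := 12) (x₃ := 11) (by norm_num)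
    ⟨by decide, by decide, by decide, by decide +kernel, by decide +kernel⟩
    ⟨by decide, by decide, by decide, by decide +kernel, by decide +kernel⟩
    ⟨by decide, by decide, by decide, by decide +kernel, by decide +kernel⟩ (by decide) (by decide) hb
  have key : ∀ i < 36, ∀ j < 36, j % 3 = 1 →
      (4 ^ 2 * (5 ^ i * 1 ^ j) + 10 ^ 2 * (5 ^ i * 10 ^ j) + 12 ^ 2 * (12 ^ i * 3 ^ j)) % 13 = 0 →
      (1 ^ 2 * (34 ^ i * 4 ^ j) + 10 ^ 2 * (3 ^ i * 12 ^ j) + 26 ^ 2 * (4 ^ i * 11 ^ j)) % 37 ≠ 0 := by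
    decide +kernel
  exact key _ (by omega) _ (Nat.mod_lt _ (by norm_num)) (by omega) h13 h37

set_option synthInstance.maxHeartbeats 400000 in
set_option synthInstance.maxSize 1000 in
/-- If `y - W ∛76` is a product of a unit and a power of `9 - 2 ∛76` with exponent congruent to `1`
modulo `3`, then that product is close to `9 - 2 ∛76` multiplicatively. -/
lemma modEq_seventyTwo_of_c_eq_zero {s : ℤ} {n : ℕ} (hn : n % 3 = 1)
    (hc : (((unitSeventySix ^ s : (PureCubic 76)ˣ) : PureCubic 76) * ⟨9, -2, 0⟩ ^ n).c = 0) :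
    s % 72 = 0 ∧ n % 72 = 1 := by
  have h7 := dvd_sum_of_c_eq_zero (q := 7) (N := 6) (ρ₁ := 3) (ρ₂ := 5) (ρ₃ := 6) (e₁ := 2)
    (e₂ := 5) (e₃ := 5) (x₁ := 3) (x₂ := 6) (x₃ := 4) (by norm_num)
    ⟨by decide, by decide, by decide, by decide +kernel, by decide +kernel⟩
    ⟨by decide, by decide, by decide, by decide +kernel, by decide +kernel⟩
    ⟨by decide, by decide, by decide, by decide +kernel, by decide +kernel⟩ (by decide) (by decide) hc
  have h73 := dvd_sum_of_c_eq_zero (q := 73) (N := 72) (ρ₁ := 25) (ρ₂ := 54) (ρ₃ := 67) (e₁ := 28)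
    (e₂ := 37) (e₃ := 47) (x₁ := 32) (x₂ := 47) (x₃ := 21) (by norm_num)
    ⟨by decide, by decide, by decide, by decide +kernel, by decide +kernel⟩
    ⟨by decide, by decide, by decide, by decide +kernel, by decide +kernel⟩
    ⟨by decide, by decide, by decide, by decide +kernel, by decide +kernel⟩ (by decide) (by decide) hc
  have h109 := dvd_sum_of_c_eq_zero (q := 109) (N := 216) (ρ₁ := 8) (ρ₂ := 33) (ρ₃ := 68) (e₁ := 7)
    (e₂ := 48) (e₃ := 97) (x₁ := 102) (x₂ := 52) (x₃ := 91) (by norm_num)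
    ⟨by decide, by decide, by decide, by decide +kernel, by decide +kernel⟩
    ⟨by decide, by decide, by decide, by decide +kernel, by decide +kernel⟩
    ⟨by decide, by decide, by decide, by decide +kernel, by decide +kernel⟩ (by decide) (by decide) hc
  have key : ∀ j < 216, j % 3 = 1 → ∀ i < 216,
      (3 * (2 ^ (i % 6) * 3 ^ (j % 6)) + 5 * (5 ^ (i % 6) * 6 ^ (j % 6))
        + 6 * (5 ^ (i % 6) * 4 ^ (j % 6))) % 7 = 0 →
      (25 * (28 ^ (i % 72) * 32 ^ (j % 72)) + 54 * (37 ^ (i % 72) * 47 ^ (j % 72))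
        + 67 * (47 ^ (i % 72) * 21 ^ (j % 72))) % 73 = 0 →
      (8 * (7 ^ i * 102 ^ j) + 33 * (48 ^ i * 52 ^ j) + 68 * (97 ^ i * 91 ^ j)) % 109 = 0 →
      i % 72 = 0 ∧ j % 72 = 1 := by
    decide +kernel
  have ei6 : (s % (6 : ℕ)).toNat = (s % (216 : ℕ)).toNat % 6 := by omega
  have ei72 : (s % (72 : ℕ)).toNat = (s % (216 : ℕ)).toNat % 72 := by omega
  have ej6 : n % 6 = n % 216 % 6 := by omega
  have ej72 : n % 72 = n % 216 % 72 := by omega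
  rw [ei6, ej6] at h7
  rw [ei72, ej72] at h73
  have := key (n % 216) (by omega) (by omega) (s % (216 : ℕ)).toNat (by omega) h7 h73 h109
  omega

lemma mk_span_eq_iff {n : ℤ} {α β : PureCubic m} :
    Ideal.Quotient.mk (Ideal.span {(n : PureCubic m)}) α = Ideal.Quotient.mk _ β ↔
      n ∣ α.a - β.a ∧ n ∣ α.b - β.b ∧ n ∣ α.c - β.c := by
  rw [Ideal.Quotient.eq, Ideal.mem_span_singleton]
  constructor
  · intro h
    simpa using intCast_dvd h
  · rintro ⟨⟨x, hx⟩, ⟨y, hy⟩, ⟨z, hz⟩⟩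
    refine ⟨⟨x, y, z⟩, ?_⟩
    rw [intCast_mul_eq]
    ext <;> simpa

lemma four_dvd_b_add_two {s : ℤ} {n : ℕ} (hs : s % 4 = 0) (hn : n % 2 = 1) :
    4 ∣ (((unitSeventySix ^ s : (PureCubic 76)ˣ) : PureCubic 76) * ⟨9, -2, 0⟩ ^ n).b + 2 := by
  set f := Ideal.Quotient.mk (Ideal.span {((4 : ℤ) : PureCubic 76)}) with hf
  have hε : f unitSeventySix ^ 4 = 1 := by
    rw [← map_pow, ← map_one f]
    exact mk_span_eq_iff.mpr (by decide +kernel)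
  have hξ : f ⟨9, -2, 0⟩ ^ 2 = 1 := by
    rw [← map_pow, ← map_one f]
    exact mk_span_eq_iff.mpr (by decide +kernel)
  have h : f ((unitSeventySix ^ s : (PureCubic 76)ˣ) * ⟨9, -2, 0⟩ ^ n) = f ⟨9, -2, 0⟩ := by
    rw [map_mul, map_pow, map_zpow_eq f _ (by norm_num) hε, pow_eq_pow_mod n hξ, hn,
      (by omega : (s % (4 : ℕ)).toNat = 0), pow_zero, one_mul, pow_one]
  have := (mk_span_eq_iff.mp h).2.1
  simpa using this

section Nilpotent

variable {R : Type*} [CommRing R] {t : R}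

lemma one_add_four_mul_pow (ht : t ^ 3 = 0) (n : ℕ) :
    (1 + 4 * t) ^ n = 1 + 4 * n * t + 8 * n * (n - 1) * t ^ 2 := by
  induction n with
  | zero => simp
  | succ n ih =>
    rw [pow_succ, ih]
    push_cast
    linear_combination 32 * (n : R) * (n - 1) * ht

lemma one_add_sq_pow (ht : t ^ 3 = 0) (n : ℕ) : (1 + t ^ 2) ^ n = 1 + n * t ^ 2 := by
  induction n with
  | zero => simp
  | succ n ih =>
    rw [pow_succ, ih]
    push_cast
    linear_combination (n : R) * t * ht

end Nilpotent

/-- The logarithms of `305 + 72 ∛76 + 17 ∛76 ^ 2` and `9 - 2 ∛76` modulo `19`, where `∛76` is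
nilpotent, are independent. -/
lemma nineteen_dvd_exponents {s : ℤ} {n : ℕ} {y W : ℤ} (hW : 19 ∣ W)
    (h : (⟨y, -W, 0⟩ : PureCubic 76) = (unitSeventySix ^ s : (PureCubic 76)ˣ) * ⟨9, -2, 0⟩ ^ n) :
    s % 19 = 0 ∧ n % 19 = 0 := by
  set f := Ideal.Quotient.mk (Ideal.span {((19 : ℤ) : PureCubic 76)}) with hf
  set t := f ⟨0, 1, 0⟩ with ht
  have ht3 : t ^ 3 = 0 := by
    rw [ht, ← map_pow, ← map_zero f]
    exact mk_span_eq_iff.mpr (by decide +kernel)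
  have hε : f unitSeventySix ^ 19 = 1 := by
    rw [← map_pow, ← map_one f]
    exact mk_span_eq_iff.mpr (by decide +kernel)
  have h4 : f 4 = 4 := map_ofNat f 4
  have h17 : f 17 = 17 := map_ofNat f 17
  have hε' : f unitSeventySix * (1 + 4 * t) = 1 + t ^ 2 := by
    have : f unitSeventySix * (1 + 4 * t) = f (unitSeventySix * (1 + 4 * ⟨0, 1, 0⟩)) := by
      simp [ht, h4]
    rw [this, ht, ← map_pow, ← map_one f, ← map_add]
    exact mk_span_eq_iff.mpr (by decide +kernel)
  have hξ : 17 * f ⟨9, -2, 0⟩ = 1 + 4 * t := by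
    have h1 : 17 * f ⟨9, -2, 0⟩ = f (17 * ⟨9, -2, 0⟩) := by rw [map_mul, h17]
    have h2 : 1 + 4 * t = f (1 + 4 * ⟨0, 1, 0⟩) := by simp [ht, h4]
    rw [h1, h2]
    exact mk_span_eq_iff.mpr (by decide +kernel)
  obtain ⟨i, hi⟩ : ∃ i : ℕ, (s % (19 : ℕ)).toNat = i := ⟨_, rfl⟩
  have hα : f ⟨y, -W, 0⟩ = f ((y : ℤ) : PureCubic 76) := by
    refine mk_span_eq_iff.mpr ⟨by simp, by simpa using hW, by simp⟩
  have key : f (((y * 17 ^ n : ℤ) : PureCubic 76)) * (1 + 4 * t) ^ i = (1 + 4 * t) ^ n * (1 + t ^ 2) ^ i := by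
    have e1 : f (((y * 17 ^ n : ℤ) : PureCubic 76)) = 17 ^ n * f ⟨y, -W, 0⟩ := by
      rw [hα]; push_cast; rw [map_mul, map_pow]; simp [mul_comm, h17]
    rw [e1, h, map_mul, map_pow, map_zpow_eq f _ (by norm_num) hε, hi, ← hξ, ← hε', hξ, mul_pow, ← hξ,
      mul_pow]
    ring
  rw [one_add_four_mul_pow ht3, one_add_four_mul_pow ht3, one_add_sq_pow ht3] at key
  set A := y * 17 ^ n with hA
  have key' : f ⟨A, A * (4 * i), A * (8 * i * (i - 1))⟩ = f ⟨1, 4 * n, 8 * n * (n - 1) + i⟩ := by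
    have e : ∀ a b c : ℤ, f ⟨a, b, c⟩ = f (a : PureCubic 76) + f (b : PureCubic 76) * t
        + f (c : PureCubic 76) * t ^ 2 := by
      intro a b c
      rw [ht, ← map_pow, ← map_mul, ← map_mul, ← map_add, ← map_add]
      congr 1
      ext <;> simp [sq]
    rw [e A (A * (4 * i)), e 1 (4 * n)]
    simp only [map_intCast] at key ⊢
    push_cast
    linear_combination key
      + (4 * (n : PureCubic 76 ⧸ Ideal.span {((19 : ℤ) : PureCubic 76)}) * i + 8 * n * (n - 1) * i * t) * ht3
  obtain ⟨⟨u, hu⟩, ⟨v, hv⟩, ⟨w, hw⟩⟩ := mk_span_eq_iff.mp key'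
  simp only at hu hv hw
  have hni : (19 : ℤ) ∣ 4 * (i - n) := ⟨v - u * (4 * i), by linear_combination hv - 4 * (i : ℤ) * hu⟩
  obtain ⟨r, hr⟩ : (19 : ℤ) ∣ i - n := by omega
  have hi0 : (19 : ℤ) ∣ i := ⟨-w + u * (8 * i * (i - 1)) + 8 * (i + n - 1) * r, by
    linear_combination -hw + 8 * (i : ℤ) * (i - 1) * hu + 8 * (i + n - 1 : ℤ) * hr⟩
  omega

lemma not_nineteen_dvd {s : ℤ} {n : ℕ} (hs : s % 72 = 0) (hn : n % 72 = 1) (hs19 : s % 19 = 0)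
    (hn19 : n % 19 = 0) :
    (((unitSeventySix ^ s : (PureCubic 76)ˣ) : PureCubic 76) * ⟨9, -2, 0⟩ ^ n).c ≠ 0 := by
  intro hc
  have h := dvd_sum_of_c_eq_zero (q := 2053) (N := 2052) (ρ₁ := 66) (ρ₂ := 684) (ρ₃ := 1303)
    (e₁ := 1095) (e₂ := 511) (e₃ := 1362) (x₁ := 1930) (x₂ := 694) (x₃ := 1509) (by norm_num)
    ⟨by decide +kernel, by decide +kernel, by decide +kernel, by decide +kernel, by decide +kernel⟩
    ⟨by decide +kernel, by decide +kernel, by decide +kernel, by decide +kernel, by decide +kernel⟩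
    ⟨by decide +kernel, by decide +kernel, by decide +kernel, by decide +kernel, by decide +kernel⟩
    (by decide +kernel) (by decide +kernel) hc
  have key : ∀ i < 3, ∀ j < 3,
      (66 * (1095 ^ (684 * i) * 1930 ^ (684 * j + 361)) + 684 * (511 ^ (684 * i) * 694 ^ (684 * j + 361))
        + 1303 * (1362 ^ (684 * i) * 1509 ^ (684 * j + 361))) % 2053 ≠ 0 := by
    decide +kernel
  obtain ⟨i, hi, ei⟩ : ∃ i < 3, (s % (2052 : ℕ)).toNat = 684 * i :=
    ⟨(s % (2052 : ℕ)).toNat / 684, by omega, by omega⟩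
  obtain ⟨j, hj, ej⟩ : ∃ j < 3, n % 2052 = 684 * j + 361 :=
    ⟨n % 2052 / 684, by omega, by omega⟩
  rw [ei, ej] at h
  exact key i hi j hj h

end PureCubic

lemma one_add_seven_mul_pow {R : Type*} [CommRing R] (E : R) (v : ℕ) :
    ∀ n : ℕ, 7 ^ v ∣ n → ∃ F : R, (1 + 7 * E) ^ n = 1 + 7 * n * E + 7 ^ (v + 2) * F := by
  induction v with
  | zero =>
    intro n hn
    clear hn
    induction n with
    | zero => exact ⟨0, by simp⟩
    | succ n ih =>
      obtain ⟨F, hF⟩ := ih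
      refine ⟨F + n * E ^ 2 + 7 * E * F, ?_⟩
      rw [pow_succ, hF]
      push_cast
      ring
  | succ v ih =>
    rintro _ ⟨k, rfl⟩
    obtain ⟨F, hF⟩ := ih (7 ^ v * k) ⟨k, rfl⟩
    obtain ⟨g, hg⟩ : ∃ g : R, g = 7 ^ v := ⟨_, rfl⟩
    obtain ⟨G, hG⟩ : ∃ G : R, G = k * E + 7 * F := ⟨_, rfl⟩
    have h1 : (1 + 7 * E) ^ (7 ^ v * k) = 1 + 7 * g * G := by
      rw [hF, hG, pow_add, ← hg]
      push_cast
      rw [← hg]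
      ring
    refine ⟨F + 3 * g * G ^ 2 + 35 * g ^ 2 * G ^ 3 + 245 * g ^ 3 * G ^ 4 + 1029 * g ^ 4 * G ^ 5
      + 2401 * g ^ 5 * G ^ 6 + 2401 * g ^ 6 * G ^ 7, ?_⟩
    rw [show 7 ^ (v + 1) * k = 7 ^ v * k * 7 by ring, pow_mul, h1,
      show v + 1 + 2 = v + 3 by ring, pow_add, ← hg]
    push_cast
    rw [← hg]
    linear_combination 49 * g * hG

namespace PureCubic

variable {m : ℤ}

lemma natCast_mul_eq (n : ℕ) (α : PureCubic m) : (n : PureCubic m) * α = ⟨n * α.a, n * α.b, n * α.c⟩ := by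
  rw [← intCast_mul_eq]
  push_cast
  rfl

/-- Skolem's method at `7`: two independent one-parameter groups near `ξ`. -/
lemma exponents_eq_zero {E X ξ : PureCubic m}
    (hD : ¬(7 : ℤ) ∣ (E * ξ).b * (X * ξ).c - (E * ξ).c * (X * ξ).b) {i k : ℕ}
    (hb : ((1 + 7 * E) ^ i * (1 + 7 * X) ^ k * ξ).b = ξ.b)
    (hc : ((1 + 7 * E) ^ i * (1 + 7 * X) ^ k * ξ).c = ξ.c) : i = 0 ∧ k = 0 := by
  have key : ∀ v : ℕ, 7 ^ v ∣ i ∧ 7 ^ v ∣ k := by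
    intro v
    induction v with
    | zero => simp
    | succ v ih =>
      obtain ⟨hi, hk⟩ := ih
      obtain ⟨F, hF⟩ := one_add_seven_mul_pow E v i hi
      obtain ⟨G, hG⟩ := one_add_seven_mul_pow X v k hk
      obtain ⟨i', hi'⟩ := hi
      obtain ⟨k', hk'⟩ := hk
      obtain ⟨H, hH⟩ : ∃ H : PureCubic m, (1 + 7 * E) ^ i * (1 + 7 * X) ^ k * ξ =
          ξ + ((7 * i : ℕ) : PureCubic m) * (E * ξ) + ((7 * k : ℕ) : PureCubic m) * (X * ξ)
            + ((7 ^ (v + 2) : ℕ) : PureCubic m) * H := by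
        refine ⟨(F * (1 + 7 * k * X) + G * (1 + 7 * i * E + 7 ^ (v + 2) * F)
          + 7 ^ v * i' * k' * E * X) * ξ, ?_⟩
        rw [hF, hG, hi', hk']
        push_cast
        ring
      rw [hH] at hb hc
      simp only [natCast_mul_eq] at hb hc
      simp only [add_b, add_c] at hb hc
      have h7 : (7 : ℤ) ^ v ≠ 0 := by positivity
      have hb' : i' * (E * ξ).b + k' * (X * ξ).b + 7 * H.b = 0 := by
        have : (7 : ℤ) ^ (v + 1) ≠ 0 := by positivity
        rw [← mul_right_inj' this]
        rw [hi', hk'] at hb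
        push_cast at hb
        linear_combination hb
      have hc' : i' * (E * ξ).c + k' * (X * ξ).c + 7 * H.c = 0 := by
        have : (7 : ℤ) ^ (v + 1) ≠ 0 := by positivity
        rw [← mul_right_inj' this]
        rw [hi', hk'] at hc
        push_cast at hc
        linear_combination hc
      have h7p : Prime (7 : ℤ) := by norm_num
      have hi7 : (7 : ℤ) ∣ i' := by
        refine (h7p.dvd_or_dvd (a := i') (b := _) ⟨H.c * (X * ξ).b - H.b * (X * ξ).c, ?_⟩).resolve_right hD
        linear_combination (X * ξ).c * hb' - (X * ξ).b * hc'
      have hk7 : (7 : ℤ) ∣ k' := by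
        refine (h7p.dvd_or_dvd (a := k') (b := _) ⟨H.b * (E * ξ).c - H.c * (E * ξ).b, ?_⟩).resolve_right hD
        linear_combination (E * ξ).b * hc' - (E * ξ).c * hb'
      rw [hi', hk', pow_succ]
      exact ⟨mul_dvd_mul_left _ (by exact_mod_cast hi7), mul_dvd_mul_left _ (by exact_mod_cast hk7)⟩
  have hz : ∀ j : ℕ, (∀ v : ℕ, 7 ^ v ∣ j) → j = 0 := fun j h =>
    Nat.eq_zero_of_dvd_of_lt (h j) (Nat.lt_pow_self (by norm_num))
  exact ⟨hz i fun v => (key v).1, hz k fun v => (key v).2⟩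

lemma eq_one_of_coords {s : ℤ} {n : ℕ} (hs : s % 6 = 0) (hn : n % 6 = 1)
    (hb : (((unitSeventySix ^ s : (PureCubic 76)ˣ) : PureCubic 76) * ⟨9, -2, 0⟩ ^ n).b = -2)
    (hc : (((unitSeventySix ^ s : (PureCubic 76)ˣ) : PureCubic 76) * ⟨9, -2, 0⟩ ^ n).c = 0) :
    n = 1 := by
  obtain ⟨k, rfl⟩ : ∃ k, n = 6 * k + 1 := ⟨n / 6, by omega⟩
  have hX : (⟨9, -2, 0⟩ : PureCubic 76) ^ 6 = 1 + 7 * ⟨-1137648, 109836, 37476⟩ := by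
    ext <;> decide +kernel
  rw [pow_succ, pow_mul, hX, ← mul_assoc] at hb hc
  suffices k = 0 by omega
  rcases le_total 0 s with h0 | h0
  · obtain ⟨i, rfl⟩ : ∃ i : ℕ, s = (6 * i : ℕ) := ⟨(s / 6).toNat, by omega⟩
    have hE : (unitSeventySix : PureCubic 76) ^ 6 =
        1 + 7 * ⟨27944602468919136, 6597206402266812, 1557479028822042⟩ := by ext <;> decide +kernel
    rw [zpow_natCast, Units.val_pow_eq_pow_val, pow_mul, hE] at hb hc
    exact (exponents_eq_zero (by decide +kernel) hb hc).2
  · obtain ⟨i, rfl⟩ : ∃ i : ℕ, s = -(6 * i : ℕ) := ⟨(-s / 6).toNat, by omega⟩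
    have hE : ((unitSeventySix⁻¹ : (PureCubic 76)ˣ) : PureCubic 76) ^ 6 =
        1 + 7 * ⟨-69751584, 12606612, 911382⟩ := by ext <;> decide +kernel
    rw [zpow_neg, zpow_natCast, ← inv_pow, Units.val_pow_eq_pow_val, pow_mul, hE] at hb hc
    exact (exponents_eq_zero (by decide +kernel) hb hc).2


/-- The only solution of `y ^ 3 - 76 W ^ 3 = 121 ^ c` of the shape at hand is `(y, W) = (9, 2)`. -/
lemma eq_one_of_seventySix {y : ℤ} {a b c : ℕ} (hc : c % 3 = 1)
    (h : y ^ 3 = 121 ^ c + 76 * (2 ^ a * 19 ^ b) ^ 3) (ha : a % 2 = 1) : c = 1 ∧ a = 1 ∧ b = 0 := by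
  obtain ⟨W, hW⟩ : ∃ W : ℤ, W = 2 ^ a * 19 ^ b := ⟨_, rfl⟩
  have h11 : ¬ (11 : ℤ) ∣ W := by
    rw [hW]
    intro h
    have hp : Prime (11 : ℤ) := by norm_num
    rcases hp.dvd_or_dvd h with h | h <;> exact absurd (hp.dvd_of_dvd_pow h) (by norm_num)
  obtain ⟨u, hu, hα⟩ := exists_eq_pow_mul (m := 76) (ρ := 65) (ξ := ⟨9, -2, 0⟩) (ξ' := ⟨81, 18, 4⟩)
    (g₁ := ⟨-41, -9, -2⟩) (g₂ := ⟨-2817, -626, -139⟩) (by norm_num) (by ext <;> simp)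
    (by ext <;> simp) (by ext <;> simp) (by norm_num) (by norm_num [norm_apply]) c
    (α := ⟨y, -W, 0⟩) (by rw [norm_apply, hW]; linear_combination h)
    (fun hd => h11 (by simpa using (intCast_dvd hd).2.2))
  obtain ⟨s, rfl⟩ := exists_zpow_seventySix hu
  rw [mul_comm] at hα
  obtain ⟨hs72, hc72⟩ := modEq_seventyTwo_of_c_eq_zero (s := s) hc (by rw [← hα])
  have h4 := four_dvd_b_add_two (s := s) (n := c) (by omega) (by omega)
  rw [← hα] at h4
  replace h4 : 4 ∣ -W + 2 := h4
  obtain ⟨a', rfl⟩ : ∃ a', a = a' + 1 := ⟨a - 1, by omega⟩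
  rcases Nat.eq_zero_or_pos a' with rfl | ha'
  · rcases Nat.eq_zero_or_pos b with rfl | hb
    · refine ⟨eq_one_of_coords (s := s) (by omega) (by omega) ?_ (by rw [← hα]), rfl, rfl⟩
      rw [← hα, hW]
      norm_num
    · have h19 : (19 : ℤ) ∣ W := by
        rw [hW]
        exact dvd_mul_of_dvd_right (dvd_pow_self _ hb.ne') _
      obtain ⟨hs19, hc19⟩ := nineteen_dvd_exponents h19 hα
      exact absurd (by rw [← hα]) (not_nineteen_dvd hs72 hc72 hs19 hc19)
  · obtain ⟨a, rfl⟩ : ∃ a, a' = a + 1 := ⟨a' - 1, by omega⟩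
    rw [show W = 4 * (2 ^ a * 19 ^ b) by rw [hW]; ring] at h4
    omega

lemma no_thirtyEight {y : ℤ} {a b c : ℕ} (hc : c % 3 = 1) :
    y ^ 3 ≠ 121 ^ c + 38 ^ 2 * (2 ^ a * 19 ^ b) ^ 3 := by
  intro h
  obtain ⟨W, hW⟩ : ∃ W : ℤ, W = 2 ^ a * 19 ^ b := ⟨_, rfl⟩
  have h11 : ¬ (11 : ℤ) ∣ W := by
    rw [hW]
    intro h
    have hp : Prime (11 : ℤ) := by norm_num
    rcases hp.dvd_or_dvd h with h | h <;> exact absurd (hp.dvd_of_dvd_pow h) (by norm_num)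
  obtain ⟨u, hu, hα⟩ := exists_eq_pow_mul (m := 38) (ρ := 102) (ξ := ⟨9, -6, 1⟩)
    (ξ' := ⟨309, 92, 27⟩) (g₁ := ⟨-252, -75, -22⟩) (g₂ := ⟨-26540, -7902, -2319⟩) (by norm_num)
    (by ext <;> simp) (by ext <;> simp) (by ext <;> simp) (by norm_num)
    (by norm_num [norm_apply]) c (α := ⟨y, 0, -W⟩) (by rw [norm_apply, hW]; linear_combination h)
    (fun hd => h11 (by have := (intCast_dvd hd).2.2; simp at this; omega))
  obtain ⟨s, rfl⟩ := exists_zpow_thirtyEight hu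
  rw [mul_comm] at hα
  exact b_ne_zero_thirtyEight s hc (by rw [← hα])

end PureCubic

lemma eq_nine_of_eleven_pow {y : ℤ} {j l m : ℕ} (hj : Odd j) (hl : Even l) (hl0 : l ≠ 0) (hm : Odd m)
    (h19 : ¬ (19 : ℤ) ∣ y) (h2 : ¬ (2 : ℤ) ∣ y) (hy : 1 < y)
    (h : 11 ^ l + 2 ^ j * 19 ^ m = y ^ 3) : y = 9 ∧ (11 : ℤ) ^ l = 121 := by
  obtain ⟨hl6, hj6, hm6⟩ := cube_eq_eleven_pow_add hj hl hl0 hm h19 h2 hy h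
  obtain ⟨c, rfl⟩ : ∃ c, l = 2 * c := ⟨l / 2, by omega⟩
  obtain ⟨a, rfl⟩ : ∃ a, j = a * 3 + 2 := ⟨j / 3, by omega⟩
  rcases hm6 with hm6 | hm6
  · obtain ⟨b, rfl⟩ : ∃ b, m = b * 3 + 1 := ⟨m / 3, by omega⟩
    have h' : y ^ 3 = 121 ^ c + 76 * (2 ^ a * 19 ^ b) ^ 3 := by
      rw [← h, pow_mul, pow_succ (19 : ℤ), pow_add, pow_mul, pow_mul]
      ring
    obtain ⟨rfl, rfl, rfl⟩ := PureCubic.eq_one_of_seventySix (by omega) h' (by omega)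
    exact ⟨(pow_left_inj₀ (by omega) (by norm_num) three_ne_zero).mp (by rw [h']; norm_num), by norm_num⟩
  · obtain ⟨b, rfl⟩ : ∃ b, m = b * 3 + 2 := ⟨m / 3, by omega⟩
    refine absurd ?_ (PureCubic.no_thirtyEight (y := y) (a := a) (b := b) (c := c) (by omega))
    rw [← h, pow_mul, pow_add, pow_add, pow_mul, pow_mul]
    ring

lemma six_thirtyeight {x z y : ℤ} (h : Sol 38 x z y 6) : (x = 11 ∧ y = 3) ∨ (x = 487 ∧ y = 9) := by
  have h19 : ¬ (19 : ℤ) ∣ y := h.not_dvd 19 (by norm_num) (by norm_num)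
  have h2 : ¬ (2 : ℤ) ∣ y := h.odd
  have hy : 1 < y := by linarith [h.three_le]
  have hx := h.x_pos
  obtain ⟨U, V, j, l, m, hj, hl, hm, hUV, hxUV, hcase⟩ := h.split_thirtyeight
  rcases hcase with ⟨rfl, rfl⟩ | ⟨rfl, rfl⟩ | ⟨rfl, rfl⟩ | ⟨hl0, rfl, rfl⟩
  · exact absurd hUV (no_cube_eq_one_add hj hm h19 h2 hy)
  · obtain ⟨rfl, hU⟩ := eq_three_of_two_pow hj hl hm h19 h2 hy hUV
    left
    omega
  · obtain ⟨rfl, hU⟩ := eq_three_of_nineteen_pow hj hl hm h19 h2 hy hUV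
    left
    omega
  · obtain ⟨rfl, hU⟩ := eq_nine_of_eleven_pow hj hl hl0 hm h19 h2 hy hUV
    right
    omega

open QuadraticAlgebra

lemma luc_add_mul_sub {R : Type*} [CommRing R] (a b : R) (n : ℕ) :
    luc (a + b) (a * b) n * (a - b) = a ^ n - b ^ n := by
  induction n using Nat.strong_induction_on with
  | _ n ih =>
    match n with
    | 0 => simp [luc]
    | 1 => simp [luc]
    | n + 2 =>
      rw [luc, sub_mul, mul_assoc, mul_assoc, ih (n + 1) (by omega), ih n (by omega)]
      ring

lemma luc_add_period {R : Type*} [CommRing R] {P Q : R} {N : ℕ} (h0 : luc P Q N = 0)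
    (h1 : luc P Q (N + 1) = 1) (n : ℕ) : luc P Q (n + N) = luc P Q n := by
  induction n using Nat.strong_induction_on with
  | _ n ih =>
    match n with
    | 0 => rw [zero_add, h0, luc]
    | 1 => rw [add_comm, h1, luc]
    | n + 2 =>
      rw [add_right_comm, luc, luc, ← ih n (by omega), ← ih (n + 1) (by omega), add_right_comm]

lemma luc_mod_period {R : Type*} [CommRing R] {P Q : R} {N : ℕ} (h0 : luc P Q N = 0)
    (h1 : luc P Q (N + 1) = 1) (n : ℕ) : luc P Q n = luc P Q (n % N) := by
  induction n using Nat.strong_induction_on with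
  | _ n ih =>
    rcases lt_or_ge n N with h | h
    · rw [Nat.mod_eq_of_lt h]
    · rcases Nat.eq_zero_or_pos N with rfl | hN
      · rw [Nat.mod_zero]
      · obtain ⟨k, rfl⟩ : ∃ k, n = k + N := ⟨n - N, by omega⟩
        rw [luc_add_period h0 h1, ih k (by omega), Nat.add_mod_right]

lemma one_add_four_mul_pow_eq {R : Type*} [CommRing R] (X : R) (v : ℕ) :
    ∀ n : ℕ, 2 ^ v ∣ n → ∃ F : R, (1 + 4 * X) ^ n = 1 + 4 * n * X + 2 ^ (v + 3) * F := by
  induction v with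
  | zero =>
    intro n hn
    clear hn
    induction n with
    | zero => exact ⟨0, by simp⟩
    | succ n ih =>
      obtain ⟨F, hF⟩ := ih
      refine ⟨F + 2 * n * X ^ 2 + 4 * X * F, ?_⟩
      rw [pow_succ, hF]
      push_cast
      ring
  | succ v ih =>
    rintro _ ⟨k, rfl⟩
    obtain ⟨F, hF⟩ := ih (2 ^ v * k) ⟨k, rfl⟩
    obtain ⟨g, hg⟩ : ∃ g : R, g = 2 ^ v := ⟨_, rfl⟩
    refine ⟨F * (1 + 4 * g * k * X) + g * k ^ 2 * X ^ 2 + 4 * g * F ^ 2, ?_⟩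
    rw [show 2 ^ (v + 1) * k = 2 ^ v * k * 2 by ring, pow_mul, hF,
      show v + 1 + 3 = v + 4 by ring, pow_add, pow_add (2 : R) v, ← hg]
    push_cast
    rw [← hg]
    ring

lemma im_intCast_mul {a b : ℤ} (n : ℤ) (w : QuadraticAlgebra ℤ a b) :
    ((n : QuadraticAlgebra ℤ a b) * w).im = n * w.im := by
  simp

/-- Skolem's method at `2`. -/
lemma luc_ne_one_of_mod_four {A B : ℤ} (hA : A % 2 = 1) {p : ℕ} (hp : p % 4 = 1) (hp1 : p ≠ 1) :
    luc (2 * A) (A ^ 2 + 38 * B ^ 2) p ≠ 1 := by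
  intro h
  obtain ⟨k, rfl⟩ : ∃ k, p = 4 * k + 1 := ⟨p / 4, by omega⟩
  obtain ⟨a, rfl⟩ : ∃ a, A = 2 * a + 1 := ⟨A / 2, by omega⟩
  obtain ⟨d, hd⟩ : ∃ d, d = -38 * B ^ 2 := ⟨_, rfl⟩
  set w : QuadraticAlgebra ℤ d 0 := ⟨2 * a + 1, 1⟩ with hw
  have him : (w ^ (4 * k + 1)).im = 1 := by
    rw [im_pow_eq, ← h, tr, norm_def, hw]
    simp only [one_mul, mul_one]
    congr 1
    · ring
    · rw [hd]; ring
  obtain ⟨c, hc⟩ : ∃ c, a * (a + 1) = 2 * c := by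
    obtain ⟨c, hc⟩ := Int.even_mul_succ_self a
    exact ⟨c, by rw [hc]; ring⟩
  obtain ⟨K, hK⟩ : ∃ K, K = 4 * c - 19 * B ^ 2 := ⟨_, rfl⟩
  obtain ⟨e, he⟩ : ∃ e, K * (K + 1) = 2 * e := by
    obtain ⟨c, hc⟩ := Int.even_mul_succ_self K
    exact ⟨c, by rw [hc]; ring⟩
  set X : QuadraticAlgebra ℤ d 0 :=
    ⟨2 * e - 38 * B ^ 2 * (2 * a + 1) ^ 2, (2 * a + 1) * (2 * K + 1)⟩ with hX
  have hw4 : w ^ 4 = 1 + 4 * X := by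
    have h2 : w ^ 2 = ⟨2 * K + 1, 2 * (2 * a + 1)⟩ := by
      rw [pow_two, hw]
      ext
      · simp; linear_combination 4 * hc - 2 * hK + hd
      · simp; ring
    rw [show w ^ 4 = (w ^ 2) ^ 2 by ring, h2, hX, pow_two]
    ext
    · simp; linear_combination 4 * he + 4 * (2 * a + 1) ^ 2 * hd
    · simp; ring
  have key : ∀ v : ℕ, 2 ^ v ∣ k := by
    intro v
    induction v with
    | zero => simp
    | succ v ih =>
      obtain ⟨F, hF⟩ := one_add_four_mul_pow_eq X v k ih
      obtain ⟨l, rfl⟩ := ih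
      rw [pow_succ, pow_mul, hw4, hF] at him
      have h3 : (w + ((4 * (2 ^ v * l : ℕ) : ℤ) : QuadraticAlgebra ℤ d 0) * (X * w)
          + ((2 ^ (v + 3) : ℤ) : QuadraticAlgebra ℤ d 0) * (F * w)).im = 1 := by
        rw [← him]
        push_cast
        ring_nf
      have h4 : (X * w).im = 2 * (e - 19 * B ^ 2 * (2 * a + 1) ^ 2 + a * (2 * a + 2) * (2 * K + 1)
          + K) + 1 := by
        simp [hX, hw]; ring
      have h5 : (1 : ℤ) + 4 * (2 ^ v * l : ℕ) * (X * w).im + 2 ^ (v + 3) * (F * w).im = 1 := by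
        rw [QuadraticAlgebra.im_add, QuadraticAlgebra.im_add, im_intCast_mul, im_intCast_mul] at h3
        exact h3
      rw [h4] at h5
      have h6 : (2 : ℤ) ^ (v + 2) ≠ 0 := by positivity
      have h7 : (l : ℤ) * (2 * (e - 19 * B ^ 2 * (2 * a + 1) ^ 2 + a * (2 * a + 2) * (2 * K + 1) + K) + 1)
          + 2 * (F * w).im = 0 := by
        rw [← mul_right_inj' h6]
        push_cast at h5
        linear_combination h5
      have h8 : (2 : ℤ) ∣ l := ⟨-((F * w).im + l * (e - 19 * B ^ 2 * (2 * a + 1) ^ 2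
        + a * (2 * a + 2) * (2 * K + 1) + K)), by linear_combination h7⟩
      rw [pow_succ]
      exact mul_dvd_mul_left _ (by exact_mod_cast h8)
  have : k = 0 := Nat.eq_zero_of_dvd_of_lt (key k) (Nat.lt_pow_self (by norm_num))
  omega

/-- Some `v` modulo `q` is such that `v` and `u = v + 2 r b` lie in the cube classes prescribed by the
form `(6, 4, 7)` of discriminant `-152`, where `r ^ 2 = -38`, and `u ^ e - v ^ e = 2 r b`. -/
def LocallySolvable (q k r e b : ℕ) : Bool :=
  (List.range q).any fun v =>
    Nat.ble (((8 + 2 * (q - r)) * v) ^ k % q) 1 &&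
      Nat.ble (((8 + 2 * r) * ((v + 2 * r * b) % q)) ^ k % q) 1 &&
        Nat.beq (((v + 2 * r * b) % q) ^ e % q) ((v ^ e + 2 * r * b) % q)

lemma pow_mod_of_periodic {M : Type*} [Monoid M] {N : ℕ} {x : M} (hx : x ^ (N + 3) = x ^ 3) {n : ℕ}
    (hn : 3 ≤ n % N) : x ^ n = x ^ (n % N) := by
  have key : ∀ a, x ^ (n % N + N * a) = x ^ (n % N) := by
    intro a
    induction a with
    | zero => rfl
    | succ a ih =>
      rw [← ih]
      obtain ⟨c, hc⟩ : ∃ c, n % N + N * a = c + 3 := ⟨n % N + N * a - 3, by omega⟩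
      rw [Nat.mul_succ, ← add_assoc, hc, add_assoc, add_comm 3, pow_add, hx, ← pow_add]
  rw [← key (n / N), Nat.mod_add_div]

section Split

variable {R : Type*} [CommRing R] {r : R} {s t : ℤ}

lemma luc_mul_two_mul (hr : r ^ 2 = -38) (A B : ℤ) (n : ℕ) :
    (luc (2 * A) (A ^ 2 + 38 * B ^ 2) n : ℤ) * (2 * r * B) = (A + r * B) ^ n - (A - r * B) ^ n := by
  rw [← luc_add_mul_sub]
  have := luc_map (Int.castRingHom R) (2 * A) (A ^ 2 + 38 * B ^ 2) n
  simp only [eq_intCast] at this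
  rw [this]
  congr 2
  · push_cast; ring
  · push_cast; linear_combination (B : R) ^ 2 * hr
  · ring

lemma cube_eq_mul_add (hr : r ^ 2 = -38) :
    (8 + 2 * r) * (cubeRe s t + r * cubeIm s t) = (6 * t - 2 * s + r * s) ^ 3 := by
  rw [cubeRe, cubeIm]
  push_cast
  linear_combination (-(s : R) ^ 3 * r + 2 * (-3 * (s : R) ^ 3 + 3 * s ^ 2 * t + 6 * s * t ^ 2 - 2 * t ^ 3)
    - 3 * (s : R) ^ 2 * (6 * t - 2 * s)) * hr

lemma cube_eq_mul_sub (hr : r ^ 2 = -38) :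
    (8 - 2 * r) * (cubeRe s t - r * cubeIm s t) = (6 * t - 2 * s - r * s) ^ 3 := by
  have := cube_eq_mul_add (r := -r) (s := s) (t := t) (by rw [neg_sq, hr])
  linear_combination this

end Split

lemma locallySolvable {s t : ℤ} {p q N k r b : ℕ} [NeZero q] (hrq : r ≤ q) (hr : (r : ZMod q) ^ 2 = -38)
    (hN : ∀ x : ZMod q, x ^ (N + 3) = x ^ 3)
    (hk : ∀ x : ZMod q, (x ^ 3) ^ k = 0 ∨ (x ^ 3) ^ k = 1)
    (hL : luc (2 * cubeRe s t) (cubeRe s t ^ 2 + 38 * cubeIm s t ^ 2) p = 1)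
    (hp : 3 ≤ p % N) (hb : (cubeIm s t : ZMod q) = b) : LocallySolvable q k r (p % N) b = true := by
  have h := luc_mul_two_mul hr (cubeRe s t) (cubeIm s t) p
  rw [hL, Int.cast_one, one_mul] at h
  have h1 := cube_eq_mul_add (s := s) (t := t) hr
  have h2 := cube_eq_mul_sub (s := s) (t := t) hr
  obtain ⟨u, hu⟩ : ∃ u, u = (cubeRe s t + r * cubeIm s t : ZMod q) := ⟨_, rfl⟩
  obtain ⟨v, hv⟩ : ∃ v, v = (cubeRe s t - r * cubeIm s t : ZMod q) := ⟨_, rfl⟩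
  rw [← hu, ← hv, pow_mod_of_periodic (hN u) hp, pow_mod_of_periodic (hN v) hp] at h
  rw [← hu] at h1
  rw [← hv] at h2
  have huv : u = v + 2 * r * b := by rw [hu, hv, hb]; ring
  have hval : ((v.val : ℕ) : ZMod q) = v := ZMod.natCast_zmod_val v
  have huval : (((v.val + 2 * r * b) % q : ℕ) : ZMod q) = u := by
    rw [ZMod.natCast_mod]; push_cast; rw [hval, huv]
  have hle : ∀ n : ℕ, ((n : ZMod q) = 0 ∨ (n : ZMod q) = 1) → n % q ≤ 1 := by
    rintro n (hn | hn)
    · rw [ZMod.natCast_eq_zero_iff] at hn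
      rw [Nat.mod_eq_zero_of_dvd hn]
      exact zero_le_one
    · rw [← Nat.cast_one, ZMod.natCast_eq_natCast_iff'] at hn
      rw [hn]
      exact Nat.mod_le 1 q
  rw [LocallySolvable, List.any_eq_true]
  refine ⟨v.val, List.mem_range.mpr v.val_lt, ?_⟩
  simp only [Bool.and_eq_true, Nat.ble_eq, Nat.beq_eq]
  refine ⟨⟨hle _ ?_, hle _ ?_⟩, ?_⟩
  · push_cast [Nat.cast_sub hrq]
    rw [hval, ZMod.natCast_self, zero_sub, mul_neg, ← sub_eq_add_neg, h2]
    exact hk _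
  · rw [Nat.cast_pow, Nat.cast_mul, huval]
    push_cast
    rw [h1]
    exact hk _
  · rw [← ZMod.natCast_eq_natCast_iff', Nat.cast_pow, huval]
    push_cast
    rw [hval, ← sub_eq_iff_eq_add', ← h, hb]

lemma cubeIm_mod_twentySeven {s t : ℤ} {p : ℕ} (hp : p % 6 = 5)
    (hL : luc (2 * cubeRe s t) (cubeRe s t ^ 2 + 38 * cubeIm s t ^ 2) p = 1)
    (h3 : ¬ 3 ∣ cubeIm s t) : (cubeIm s t : ZMod 27) = 2 ∨ (cubeIm s t : ZMod 27) = 25 := by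
  have h := luc_mul_two_mul (R := ZMod 27) (r := 4) (by decide) (cubeRe s t) (cubeIm s t) p
  have hN : ∀ x : ZMod 27, x ^ (18 + 3) = x ^ 3 := by decide +kernel
  rw [hL, Int.cast_one, one_mul, pow_mod_of_periodic (hN (cubeRe s t + 4 * cubeIm s t)) (n := p) (by omega),
    pow_mod_of_periodic (hN (cubeRe s t - 4 * cubeIm s t)) (n := p) (by omega)] at h
  have h9 : (9 * cubeIm s t : ZMod 27) ≠ 0 := by
    intro h0
    have h0' : ((9 * cubeIm s t : ℤ) : ZMod 27) = 0 := by push_cast; exact h0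
    rw [ZMod.intCast_zmod_eq_zero_iff_dvd] at h0'
    omega
  have key : ∀ e ∈ [5, 11, 17], ∀ s t : ZMod 27,
      9 * (-3 * s ^ 3 + 3 * s ^ 2 * t + 6 * s * t ^ 2 - 2 * t ^ 3) ≠ 0 →
      2 * 4 * (-3 * s ^ 3 + 3 * s ^ 2 * t + 6 * s * t ^ 2 - 2 * t ^ 3) =
        (-s ^ 3 - 48 * s ^ 2 * t + 30 * s * t ^ 2 + 8 * t ^ 3
          + 4 * (-3 * s ^ 3 + 3 * s ^ 2 * t + 6 * s * t ^ 2 - 2 * t ^ 3)) ^ e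
        - (-s ^ 3 - 48 * s ^ 2 * t + 30 * s * t ^ 2 + 8 * t ^ 3
          - 4 * (-3 * s ^ 3 + 3 * s ^ 2 * t + 6 * s * t ^ 2 - 2 * t ^ 3)) ^ e →
      -3 * s ^ 3 + 3 * s ^ 2 * t + 6 * s * t ^ 2 - 2 * t ^ 3 = 2 ∨
      -3 * s ^ 3 + 3 * s ^ 2 * t + 6 * s * t ^ 2 - 2 * t ^ 3 = 25 := by
    decide +kernel
  have he : p % 18 ∈ [5, 11, 17] := by
    have : p % 18 = 5 ∨ p % 18 = 11 ∨ p % 18 = 17 := by omega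
    simpa using this
  have hk := key _ he (s : ZMod 27) t
  rw [cubeIm] at h9 ⊢
  rw [cubeIm, cubeRe] at h
  push_cast at h h9 ⊢
  exact hk h9 h

lemma luc_neg {R : Type*} [CommRing R] (P Q : R) (n : ℕ) :
    luc (-P) Q n = (-1) ^ (n + 1) * luc P Q n := by
  induction n using Nat.strong_induction_on with
  | _ n ih =>
    match n with
    | 0 => simp [luc]
    | 1 => simp [luc]
    | n + 2 =>
      rw [luc, luc, ih (n + 1) (by omega), ih n (by omega)]
      ring

set_option synthInstance.maxSize 1000 in
set_option synthInstance.maxHeartbeats 200000 in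
set_option maxRecDepth 100000 in
lemma sieve_eq_empty : ∀ i < 108, ∀ j < 36, 11 ^ i * 19 ^ j % 27 = 2 ∨ 11 ^ i * 19 ^ j % 27 = 25 →
    LocallySolvable 7 2 2 5 (11 ^ i * 19 ^ j % 7) = true →
    LocallySolvable 13 4 1 11 (11 ^ i * 19 ^ j % 13) = true →
    ∀ c < 9, LocallySolvable 37 12 6 ((11 + 12 * c) % 36) (11 ^ i * 19 ^ j % 37) = true →
    ¬ LocallySolvable 109 36 17 (11 + 12 * c) (11 ^ i * 19 ^ j % 109) = true := by
  decide +kernel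

lemma natCast_pow_mul_pow {q : ℕ} (h11 : (11 : ZMod q) ^ 108 = 1) (h19 : (19 : ZMod q) ^ 36 = 1)
    (i j : ℕ) :
    (11 : ZMod q) ^ i * 19 ^ j = (11 ^ (i % 108) * 19 ^ (j % 36) % q : ℕ) := by
  rw [← pow_mod_orderOf 11 i, ← pow_mod_orderOf 19 j,
    ← Nat.mod_mod_of_dvd i (orderOf_dvd_of_pow_eq_one h11),
    ← Nat.mod_mod_of_dvd j (orderOf_dvd_of_pow_eq_one h19), pow_mod_orderOf, pow_mod_orderOf]
  simp

/-- A sieve modulo `7`, `13`, `27`, `37` and `109`. -/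
lemma luc_ne_one_of_cubeIm_eq {s t : ℤ} {p i j : ℕ} (hp : p % 12 = 11)
    (hB : cubeIm s t = 11 ^ i * 19 ^ j) :
    luc (2 * cubeRe s t) (cubeRe s t ^ 2 + 38 * cubeIm s t ^ 2) p ≠ 1 := by
  intro hL
  have hcast : ∀ q : ℕ, (11 : ZMod q) ^ 108 = 1 → (19 : ZMod q) ^ 36 = 1 →
      (cubeIm s t : ZMod q) = (11 ^ (i % 108) * 19 ^ (j % 36) % q : ℕ) := by
    intro q h11 h19
    rw [← natCast_pow_mul_pow h11 h19, hB]
    push_cast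
    rfl
  have h27 : 11 ^ (i % 108) * 19 ^ (j % 36) % 27 = 2 ∨ 11 ^ (i % 108) * 19 ^ (j % 36) % 27 = 25 := by
    have h3 : ¬ (3 : ℤ) ∣ cubeIm s t := by
      rw [hB]
      intro h
      rcases Int.prime_three.dvd_mul.mp h with h | h <;>
        exact absurd (Int.prime_three.dvd_of_dvd_pow h) (by norm_num)
    have := cubeIm_mod_twentySeven (by omega) hL h3
    rw [hcast 27 (by decide +kernel) (by decide +kernel)] at this
    rcases this with h | h
    · left
      have := (ZMod.natCast_eq_natCast_iff' _ 2 27).mp h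
      simpa using this
    · right
      have := (ZMod.natCast_eq_natCast_iff' _ 25 27).mp h
      simpa using this
  have h7 := locallySolvable (q := 7) (N := 6) (k := 2) (r := 2) (by norm_num) (by decide +kernel)
    (by decide +kernel) (by decide +kernel) hL (by omega) (hcast 7 (by decide +kernel) (by decide +kernel))
  have h13 := locallySolvable (q := 13) (N := 12) (k := 4) (r := 1) (by norm_num) (by decide +kernel)
    (by decide +kernel) (by decide +kernel) hL (by omega) (hcast 13 (by decide +kernel) (by decide +kernel))
  have h37 := locallySolvable (q := 37) (N := 36) (k := 12) (r := 6) (by norm_num) (by decide +kernel)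
    (by decide +kernel) (by decide +kernel) hL (by omega) (hcast 37 (by decide +kernel) (by decide +kernel))
  have h109 := locallySolvable (q := 109) (N := 108) (k := 36) (r := 17) (by norm_num) (by decide +kernel)
    (by decide +kernel) (by decide +kernel) hL (by omega) (hcast 109 (by decide +kernel) (by decide +kernel))
  rw [show p % 6 = 5 by omega] at h7
  rw [hp] at h13
  rw [show p % 36 = (11 + 12 * (p % 108 / 12)) % 36 by omega] at h37
  rw [show p % 108 = 11 + 12 * (p % 108 / 12) by omega] at h109
  exact sieve_eq_empty _ (Nat.mod_lt _ (by norm_num)) _ (Nat.mod_lt _ (by norm_num)) h27 h7 h13 _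
    (by omega) h37 h109

lemma luc_mod_eight : ∀ A B : ZMod 8, 4 * A ≠ 0 →
    luc (2 * A) (A ^ 2 + 38 * B ^ 2) 8 = 0 ∧ luc (2 * A) (A ^ 2 + 38 * B ^ 2) (8 + 1) = 1 ∧
    luc (2 * A) (A ^ 2 + 38 * B ^ 2) 3 ≠ 1 ∧ (4 * B = 0 → luc (2 * A) (A ^ 2 + 38 * B ^ 2) 7 ≠ 1) := by
  decide +kernel

lemma luc_mod_five : ∀ s t : ZMod 5,
    (-3 * s ^ 3 + 3 * s ^ 2 * t + 6 * s * t ^ 2 - 2 * t ^ 3) ^ 2 = 1 →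
    ∀ A, A = -s ^ 3 - 48 * s ^ 2 * t + 30 * s * t ^ 2 + 8 * t ^ 3 →
    ∀ B, B = -3 * s ^ 3 + 3 * s ^ 2 * t + 6 * s * t ^ 2 - 2 * t ^ 3 →
    luc (2 * A) (A ^ 2 + 38 * B ^ 2) 24 = 0 ∧ luc (2 * A) (A ^ 2 + 38 * B ^ 2) (24 + 1) = 1 ∧
    luc (2 * A) (A ^ 2 + 38 * B ^ 2) 7 ≠ 1 := by
  decide +kernel

/-- Reduction modulo `3`, with `-38` congruent to `1`. -/
lemma luc_mod_three {A B : ℤ} (hB : ¬ 3 ∣ B) {p : ℕ} (hp : p % 2 = 1) :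
    luc (2 * A) (A ^ 2 + 38 * B ^ 2) p % 3 = 1 := by
  have h := luc_mul_two_mul (R := ZMod 3) (r := 1) (by decide) A B p
  have hodd : ∀ x : ZMod 3, x ^ p = x := by
    intro x
    rw [← Nat.div_add_mod p 2, hp, pow_succ, pow_mul]
    have : ∀ x : ZMod 3, x ^ 2 = 1 ∨ x = 0 := by decide
    rcases this x with h | rfl
    · rw [h, one_pow, one_mul]
    · rw [mul_zero]
  rw [hodd, hodd] at h
  have key : ∀ L A B : ZMod 3, B ≠ 0 → L * (2 * 1 * B) = A + 1 * B - (A - 1 * B) → L = 1 := by decide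
  have := key _ _ _ (intCast_ne_zero_of_not_dvd hB) h
  rw [← Int.cast_one, ZMod.intCast_eq_intCast_iff] at this
  exact this

lemma luc_ne_one {s t : ℤ} {p : ℕ} (hs : cubeRe s t % 2 = 1) (hB : SU (cubeIm s t)) (hp2 : p % 2 = 1)
    (hp3 : p % 3 ≠ 0) (hp1 : p ≠ 1) :
    luc (2 * cubeRe s t) (cubeRe s t ^ 2 + 38 * cubeIm s t ^ 2) p ≠ 1 := by
  intro hL
  rcases (by omega : p % 4 = 1 ∨ p % 4 = 3) with h4 | h4
  · exact luc_ne_one_of_mod_four hs h4 hp1 hL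
  have hcast : ∀ q : ℕ, luc (2 * (cubeRe s t : ZMod q))
      ((cubeRe s t : ZMod q) ^ 2 + 38 * (cubeIm s t : ZMod q) ^ 2) p = 1 := by
    intro q
    have := congrArg (Int.cast : ℤ → ZMod q) hL
    rw [luc_cast] at this
    push_cast at this
    exact this
  have hA : (4 * cubeRe s t : ZMod 8) ≠ 0 := by
    have := intCast_ne_zero_of_not_dvd (q := 8) (u := 4 * cubeRe s t) (by omega)
    push_cast at this
    exact this
  obtain ⟨h8, h9, hl3, hl7⟩ := luc_mod_eight _ (cubeIm s t) hA
  have h8p := hcast 8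
  rw [luc_mod_period h8 h9] at h8p
  rcases (by omega : p % 8 = 3 ∨ p % 8 = 7) with hp8 | hp8 <;> rw [hp8] at h8p
  · exact hl3 h8p
  have hBodd : ¬ (2 : ℤ) ∣ cubeIm s t := by
    intro h2
    refine hl7 ?_ h8p
    have := intCast_eq_zero_of_dvd (q := 8) (u := 4 * cubeIm s t) (by push_cast; omega)
    push_cast at this
    exact this
  obtain ⟨i, j, k, hijk, hi, -, -⟩ := hB.exists_pow_abs
  obtain rfl := hi hBodd
  rw [pow_zero, one_mul] at hijk
  have hp24 : p % 24 = 7 ∨ p % 12 = 11 := by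
    have : p % 24 = 7 ∨ p % 24 = 15 ∨ p % 24 = 23 := by omega
    omega
  rcases hp24 with hp | hp
  · have hsq : (cubeIm s t : ZMod 5) ^ 2 = 1 := by
      have : cubeIm s t ^ 2 = (11 ^ j * 19 ^ k) ^ 2 := by
        rcases hijk with h | h <;> rw [h]
        ring
      have := congrArg (Int.cast : ℤ → ZMod 5) this
      push_cast at this
      rw [this, mul_pow, ← pow_mul, ← pow_mul, mul_comm k 2, pow_mul 19, show (11 : ZMod 5) = 1 by decide,
        show (19 : ZMod 5) ^ 2 = 1 by decide]
      simp
    have hAc : (cubeRe s t : ZMod 5) = -s ^ 3 - 48 * s ^ 2 * t + 30 * s * t ^ 2 + 8 * t ^ 3 := by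
      rw [cubeRe]; push_cast; ring
    have hBc : (cubeIm s t : ZMod 5) = -3 * s ^ 3 + 3 * s ^ 2 * t + 6 * s * t ^ 2 - 2 * t ^ 3 := by
      rw [cubeIm]; push_cast; ring
    obtain ⟨h24, h25, hl⟩ := luc_mod_five s t (by rw [← hBc]; exact hsq) _ hAc _ hBc
    have h5p := hcast 5
    rw [luc_mod_period h24 h25, hp] at h5p
    exact hl h5p
  · rcases hijk with h | h
    · exact luc_ne_one_of_cubeIm_eq hp h hL
    · have hRe : cubeRe (-s) (-t) = -cubeRe s t := by simp only [cubeRe]; ring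
      have hIm : cubeIm (-s) (-t) = -cubeIm s t := by simp only [cubeIm]; ring
      refine luc_ne_one_of_cubeIm_eq (s := -s) (t := -t) hp (by rw [hIm, h, neg_neg]) ?_
      rw [hRe, hIm, neg_sq, neg_sq, mul_neg, luc_neg, hL, mul_one]
      exact Even.neg_one_pow (by rw [Nat.even_iff]; omega)

lemma luc_mod_seven : ∀ s t : ZMod 7,
    -3 * s ^ 3 + 3 * s ^ 2 * t + 6 * s * t ^ 2 - 2 * t ^ 3 ≠ 0 →
    ∀ A, A = -s ^ 3 - 48 * s ^ 2 * t + 30 * s * t ^ 2 + 8 * t ^ 3 →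
    ∀ B, B = -3 * s ^ 3 + 3 * s ^ 2 * t + 6 * s * t ^ 2 - 2 * t ^ 3 →
    luc (2 * A) (A ^ 2 + 38 * B ^ 2) 11 ≠ -11 ∧ luc (2 * A) (A ^ 2 + 38 * B ^ 2) 19 ≠ 19 := by
  decide +kernel

lemma luc_five (A B : ℤ) :
    luc (2 * A) (A ^ 2 + 38 * B ^ 2) 5 = 5 * A ^ 4 - 380 * A ^ 2 * B ^ 2 + 1444 * B ^ 4 := by
  simp only [luc]
  ring

lemma not_SU_luc_five {A B : ℤ} (h2 : ¬ 2 ∣ A) (h19 : ¬ 19 ∣ A) (hB : SU B) :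
    ¬ SU (luc (2 * A) (A ^ 2 + 38 * B ^ 2) 5) := by
  intro hL
  have hd2 : ¬ 2 ∣ luc (2 * A) (A ^ 2 + 38 * B ^ 2) 5 := by
    rw [luc_five]
    intro h
    have h' : (2 : ℤ) ∣ 5 * A ^ 4 := by
      have : (2 : ℤ) ∣ -380 * A ^ 2 * B ^ 2 + 1444 * B ^ 4 :=
        ⟨-190 * A ^ 2 * B ^ 2 + 722 * B ^ 4, by ring⟩
      rw [show 5 * A ^ 4 - 380 * A ^ 2 * B ^ 2 + 1444 * B ^ 4
        = -380 * A ^ 2 * B ^ 2 + 1444 * B ^ 4 + 5 * A ^ 4 by ring] at h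
      exact (dvd_add_right this).mp h
    rcases Int.prime_two.dvd_mul.mp h' with h' | h'
    · omega
    · exact h2 (Int.prime_two.dvd_of_dvd_pow h')
  have hA19 := intCast_ne_zero_of_not_dvd (q := 19) h19
  have key19 : ∀ A B : ZMod 19, A ≠ 0 → (5 * A ^ 4 - 380 * A ^ 2 * B ^ 2 + 1444 * B ^ 4) ^ 9 = 1 := by
    decide +kernel
  have hL19 : ((luc (2 * A) (A ^ 2 + 38 * B ^ 2) 5 : ℤ) : ZMod 19) ^ 9 = 1 := by
    rw [luc_five]
    push_cast
    exact key19 _ _ hA19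
  have hd19 : ¬ 19 ∣ luc (2 * A) (A ^ 2 + 38 * B ^ 2) 5 := by
    intro h
    rw [intCast_eq_zero_of_dvd (q := 19) h] at hL19
    exact absurd hL19 (by decide)
  obtain ⟨i, j, k, hijk, hi, -, hk⟩ := hL.exists_pow_abs
  obtain rfl := hi hd2
  obtain rfl := hk hd19
  rw [pow_zero, one_mul, pow_zero, mul_one] at hijk
  have h5B : ¬ (5 : ℤ) ∣ B := fun h => by
    have := hB.2 5 (by norm_num) h
    omega
  rcases hijk with h | h
  · have h5 := congrArg (Int.cast : ℤ → ZMod 5) h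
    rw [luc_five] at h5
    push_cast at h5
    have key5 : ∀ A B : ZMod 5, B ≠ 0 → 5 * A ^ 4 - 380 * A ^ 2 * B ^ 2 + 1444 * B ^ 4 ≠ 1 := by
      decide +kernel
    refine key5 _ _ (intCast_ne_zero_of_not_dvd h5B) (h5.trans ?_)
    rw [show (11 : ZMod 5) = 1 by decide, one_pow]
  · rw [h] at hL19
    push_cast at hL19
    rw [neg_pow, ← pow_mul, mul_comm j, pow_mul, show (11 : ZMod 19) ^ 9 = 1 by decide, one_pow] at hL19
    exact absurd hL19 (by decide)

/-- The powers of the nonprincipal cubes in `ℤ[√-38]`. -/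
lemma not_SU_luc_cube {s t : ℤ} {p : ℕ} (hp : p.Prime) (hp5 : 5 ≤ p) (h2 : ¬ 2 ∣ cubeRe s t)
    (h19 : ¬ 19 ∣ cubeRe s t) (hB : SU (cubeIm s t))
    (hL : SU (luc (2 * cubeRe s t) (cubeRe s t ^ 2 + 38 * cubeIm s t ^ 2) p))
    (hco : ∀ q : ℕ, (q = 2 ∨ q = 11 ∨ q = 19) →
      (q : ℤ) ∣ luc (2 * cubeRe s t) (cubeRe s t ^ 2 + 38 * cubeIm s t ^ 2) p →
      ¬ (q : ℤ) ∣ cubeRe s t ^ 2 + 38 * cubeIm s t ^ 2) : False := by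
  have hp2 : p % 2 = 1 := hp.eq_two_or_odd.resolve_left (by omega)
  rcases (by omega : p = 5 ∨ 7 ≤ p) with rfl | hp7
  · exact not_SU_luc_five h2 h19 hB hL
  have hp3 : p % 3 ≠ 0 := by
    intro h
    have := (Nat.prime_dvd_prime_iff_eq Nat.prime_three hp).mp (Nat.dvd_of_mod_eq_zero h)
    omega
  have hL1 := luc_ne_one (s := s) (t := t) (p := p) (by omega) hB hp2 hp3 (by omega)
  have hL3 := luc_mod_three (A := cubeRe s t) (three_not_dvd_of_SU hB) hp2
  have hB7 : ((cubeIm s t : ℤ) : ZMod 7) ≠ 0 := by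
    refine intCast_ne_zero_of_not_dvd fun h => ?_
    have := hB.2 7 (by norm_num) h
    omega
  have hAc : (cubeRe s t : ZMod 7) = -s ^ 3 - 48 * s ^ 2 * t + 30 * s * t ^ 2 + 8 * t ^ 3 := by
    rw [cubeRe]; push_cast; ring
  have hBc : (cubeIm s t : ZMod 7) = -3 * s ^ 3 + 3 * s ^ 2 * t + 6 * s * t ^ 2 - 2 * t ^ 3 := by
    rw [cubeIm]; push_cast; ring
  obtain ⟨h11, h19⟩ := luc_mod_seven s t (hBc ▸ hB7) _ hAc _ hBc
  have hcast := luc_cast 7 (2 * cubeRe s t) (cubeRe s t ^ 2 + 38 * cubeIm s t ^ 2) p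
  push_cast at hcast
  rcases luc_prime_bound hp hp7 hL hco with h | ⟨rfl | rfl, h⟩
  · rcases (abs_eq zero_le_one).mp h with h | h <;> omega
  · rcases (abs_eq (by norm_num)).mp h with h | h
    · rw [h] at hL3; norm_num at hL3
    · rw [h] at hcast
      exact h11 (by rw [← hcast]; decide)
  · rcases (abs_eq (by norm_num)).mp h with h | h
    · rw [h] at hcast
      exact h19 (by rw [← hcast]; decide)
    · rw [h] at hL3; norm_num at hL3

section Final

variable {d x y z : ℤ} {p : ℕ}

lemma no_index_three_mul_prime {a b : ℤ} (hD : b ^ 2 + 4 * a < 0) {w : QuadraticAlgebra ℤ a b} {Z : ℤ}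
    (hy : 3 ≤ y) (hodd : ¬ (2 : ℤ) ∣ y) (hp : p.Prime) (hp5 : 5 ≤ p) (hw : w.norm = y)
    (hZ : (w ^ (3 * p)).im = Z) (hSU : SU Z)
    (hco : ∀ q : ℕ, (q = 2 ∨ q = 11 ∨ q = 19) → (q : ℤ) ∣ Z → ¬ (q : ℤ) ∣ y) : False := by
  rcases (by have := hp.eq_two_or_odd; omega : p = 5 ∨ 7 ≤ p) with rfl | hp7
  · exact no_index_fifteen hy hodd hw hZ hSU hco
  · exact no_prime_index hD hy hw hp hp7 hZ hSU hco

lemma no_nonprincipal_thirtyeight {s t : ℤ} (hp : p.Prime) (hp5 : 5 ≤ p) (h : Sol 38 x z y (3 * p))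
    (hy : y = 7 * s ^ 2 - 4 * s * t + 6 * t ^ 2)
    (hz : cubeIm s t * luc (2 * cubeRe s t) (cubeRe s t ^ 2 + 38 * cubeIm s t ^ 2) p ∣ z) : False := by
  have hn : cubeRe s t ^ 2 + 38 * cubeIm s t ^ 2 = y ^ 3 := by rw [cube_norm, hy]
  refine not_SU_luc_cube hp hp5 ?_ ?_ (h.su.dvd (dvd_of_mul_right_dvd hz))
    (h.su.dvd (dvd_of_mul_left_dvd hz)) fun q hq hd => ?_
  · intro h2
    refine h.odd (Int.prime_two.dvd_of_dvd_pow (n := 3) ?_)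
    rw [← hn]
    exact dvd_add (dvd_pow h2 two_ne_zero) (Dvd.dvd.mul_right (by norm_num) _)
  · intro h19
    have hp19 : Prime (19 : ℤ) := by norm_num
    refine h.not_dvd 19 (by norm_num) (by norm_num) (hp19.dvd_of_dvd_pow (n := 3) ?_)
    rw [← hn]
    exact dvd_add (dvd_pow h19 two_ne_zero) (Dvd.dvd.mul_right (by norm_num) _)
  · rw [hn]
    intro hq3
    have hqp : Prime (q : ℤ) := by rcases hq with rfl | rfl | rfl <;> norm_num
    exact h.cop_self q hq (hd.trans (dvd_of_mul_left_dvd hz)) (hqp.dvd_of_dvd_pow hq3)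

lemma no_sol_thirtyeight (hp : p.Prime) (hp5 : 5 ≤ p) : ¬ Sol 38 x z y (3 * p) := by
  intro h
  have hpo : Odd p := hp.odd_of_ne_two (by omega)
  rcases root_neg_thirtyeight h.pos hpo h.eq h.coprime (h.not_dvd 19 (by norm_num) (by norm_num)) with
    ⟨w, hw, hw3⟩ | ⟨s, t, hy, hw | hw⟩
  · exact no_index_three_mul_prime (by norm_num) h.three_le h.odd hp hp5 hw (by rw [hw3]) h.su h.cop_self
  · refine no_nonprincipal_thirtyeight hp hp5 h hy (dvd_of_eq ?_)
    have him := congrArg QuadraticAlgebra.im hw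
    rw [im_pow_eq, tr, norm_def] at him
    dsimp only at him
    rw [← him]
    congr 2 <;> ring
  · refine no_nonprincipal_thirtyeight hp hp5 h hy (dvd_of_eq ?_ |>.trans (neg_dvd.mpr dvd_rfl))
    have him := congrArg QuadraticAlgebra.im hw
    rw [im_pow_eq, tr, norm_def] at him
    dsimp only at him
    rw [← him, ← neg_mul, neg_neg]
    congr 2 <;> ring

/-- The exponent is not three times a prime greater than `3`. -/
lemma no_sol_three_mul_prime
    (hd : d = 1 ∨ d = 2 ∨ d = 11 ∨ d = 19 ∨ d = 22 ∨ d = 38 ∨ d = 209 ∨ d = 418) (hp : p.Prime)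
    (hp5 : 5 ≤ p) : ¬ Sol d x z y (3 * p) := by
  intro h
  have hpo : Odd (3 * p) := (by decide : Odd 3).mul (hp.odd_of_ne_two (by omega))
  have hodd : Odd y := by have := h.odd; rw [Int.odd_iff]; omega
  rcases hd with rfl | rfl | rfl | rfl | rfl | rfl | rfl | rfl
  · obtain ⟨w, hw, hw3⟩ := root_neg_one (n := 3 * p) h.pos hpo (by simpa using h.eq) h.coprime
    exact no_index_three_mul_prime (by norm_num) h.three_le h.odd hp hp5 hw (by rw [hw3]) h.su h.cop_self
  · obtain ⟨w, hw, hw3⟩ := root_neg_two h.pos hpo h.eq h.coprime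
    exact no_index_three_mul_prime (by norm_num) h.three_le h.odd hp hp5 hw (by rw [hw3]) h.su h.cop_self
  · obtain ⟨w, hw, hw3⟩ := root_neg_eleven h.pos hpo h.eq h.coprime hodd
    exact no_index_three_mul_prime (by norm_num) h.three_le h.odd hp hp5 hw (by rw [hw3]) h.su.two_mul
      h.cop_two_mul
  · obtain ⟨w, hw, hw3⟩ := root_neg_nineteen h.pos hpo h.eq h.coprime hodd
    exact no_index_three_mul_prime (by norm_num) h.three_le h.odd hp hp5 hw (by rw [hw3]) h.su.two_mul
      h.cop_two_mul
  · obtain ⟨w, hw, hw3⟩ := root_neg_twentytwo h.pos hpo h.eq h.coprime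
      (h.not_dvd 11 (by simp) (by norm_num))
    exact no_index_three_mul_prime (by norm_num) h.three_le h.odd hp hp5 hw (by rw [hw3]) h.su h.cop_self
  · exact no_sol_thirtyeight hp hp5 h
  · exact no_sol_209 (h.root (dvd_mul_right 3 p) (by omega))
  · exact no_sol_418 (h.root (dvd_mul_right 3 p) (by omega))

lemma sol_six (hd : d = 1 ∨ d = 2 ∨ d = 11 ∨ d = 19 ∨ d = 22 ∨ d = 38 ∨ d = 209 ∨ d = 418)
    (h : Sol d x z y 6) :
    x = 5 ∧ y = 3 ∨ x = 487 ∧ y = 9 ∨ x = 117 ∧ y = 5 ∨ x = 11 ∧ y = 3 := by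
  rcases hd with rfl | rfl | rfl | rfl | rfl | rfl | rfl | rfl
  · have := six_one h; tauto
  · exact absurd h no_six_two
  · have := six_eleven h; tauto
  · exact absurd h no_six_nineteen
  · exact absurd h no_six_twentytwo
  · have := six_thirtyeight h; tauto
  · exact absurd (h.root (by norm_num) (by norm_num)) no_sol_209
  · exact absurd (h.root (by norm_num) (by norm_num)) no_sol_418

end Final

lemma eq_of_index_six {x y k l m : ℕ} (hx : 0 < x) (hgcd : Nat.gcd x y = 1)
    (heq : x ^ 2 + 2 ^ k * 11 ^ l * 19 ^ m = y ^ 6) :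
    (x, y, k, l, m) ∈ ({(5, 3, 6, 1, 0), (487, 9, 7, 2, 1), (117, 5, 4, 2, 0), (11, 3, 5, 0, 1)} :
      Set (ℕ × ℕ × ℕ × ℕ × ℕ)) := by
  obtain ⟨d, z, hd, -, hsol⟩ := exists_sol hx (by norm_num) hgcd heq
  simp only [Set.mem_insert_iff, Set.mem_singleton_iff, Prod.mk.injEq]
  have key : ∀ a b c : ℕ, 2 ^ k * 11 ^ l * 19 ^ m = 2 ^ a * 11 ^ b * 19 ^ c → k = a ∧ l = b ∧ m = c :=
    fun a b c h => pow_mul_pow_mul_pow_injective h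
  generalize 2 ^ k * 11 ^ l * 19 ^ m = v at heq key
  rcases sol_six hd hsol with ⟨h1, h2⟩ | ⟨h1, h2⟩ | ⟨h1, h2⟩ | ⟨h1, h2⟩ <;> norm_cast at h1 h2 <;>
    subst h1 h2 <;> norm_num at heq
  · exact Or.inl ⟨rfl, rfl, key 6 1 0 (by norm_num; omega)⟩
  · exact Or.inr (Or.inl ⟨rfl, rfl, key 7 2 1 (by norm_num; omega)⟩)
  · exact Or.inr (Or.inr (Or.inl ⟨rfl, rfl, key 4 2 0 (by norm_num; omega)⟩))
  · exact Or.inr (Or.inr (Or.inr ⟨rfl, rfl, key 5 0 1 (by norm_num; omega)⟩))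

theorem stmt_2 (x y k l m n : ℕ) (hx : 0 < x) (hy : 0 < y)
    (hgcd : Nat.gcd x y = 1) (hn : 3 < n) (hdvd : 3 ∣ n)
    (heq : x ^ 2 + 2 ^ k * 11 ^ l * 19 ^ m = y ^ n) :
    n ∈ ({6, 12} : Set ℕ) ∧
    (n = 6 → (x, y, k, l, m) ∈ ({(5, 3, 6, 1, 0), (487, 9, 7, 2, 1),
      (117, 5, 4, 2, 0), (11, 3, 5, 0, 1)} : Set (ℕ × ℕ × ℕ × ℕ × ℕ))) ∧
    (n = 12 → (x, y, k, l, m) = (487, 3, 7, 2, 1)) := by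
  obtain ⟨t, rfl⟩ := hdvd
  rcases Nat.even_or_odd' t with ⟨u, rfl | rfl⟩
  · have heq6 : x ^ 2 + 2 ^ k * 11 ^ l * 19 ^ m = (y ^ u) ^ 6 := by
      rw [heq, ← pow_mul]
      congr 1
      ring
    have h6 := eq_of_index_six hx (Nat.Coprime.pow_right u hgcd) heq6
    rcases (by omega : u = 1 ∨ 2 ≤ u) with rfl | hu
    · rw [pow_one] at h6
      exact ⟨by norm_num, fun _ => h6, fun h => by omega⟩
    · simp only [Set.mem_insert_iff, Set.mem_singleton_iff, Prod.mk.injEq] at h6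
      have hle : y ^ 2 ≤ y ^ u := Nat.pow_le_pow_right hy hu
      have hdvd : y ∣ y ^ u := dvd_pow_self y (by omega)
      have hyu : y ^ u = 9 := by
        have hsmall : y ^ u ≠ 3 ∧ y ^ u ≠ 5 := by
          constructor <;> intro h <;> rw [h] at hle hdvd <;> have : y ≤ 2 := by nlinarith
          all_goals interval_cases y <;> simp at h hdvd
        omega
      obtain rfl : y = 3 := by
        rw [hyu] at hle hdvd
        have : y ≤ 3 := by nlinarith
        interval_cases y <;> simp at hyu hdvd ⊢
      obtain rfl : u = 2 := Nat.pow_right_injective (by norm_num : 2 ≤ 3)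
        (hyu.trans (by norm_num : 9 = 3 ^ 2))
      norm_num at h6 ⊢
      exact h6
  · exfalso
    obtain ⟨d, z, hd, -, hsol⟩ := exists_sol hx hn.le hgcd heq
    obtain ⟨p, hp, hpd⟩ := Nat.exists_prime_and_dvd (n := 2 * u + 1) (by omega)
    have h3p : 3 * p ∣ 3 * (2 * u + 1) := mul_dvd_mul_left 3 hpd
    have hs := hsol.root h3p (by omega)
    have hp2 : p ≠ 2 := by rintro rfl; omega
    rcases (by have := hp.two_le; omega : p = 3 ∨ 4 ≤ p) with rfl | hp4
    · exact no_index_nine hd hs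
    · exact no_sol_three_mul_prime hd hp (by
        rcases hp4.eq_or_lt with rfl | h
        · norm_num at hp
        · exact h) hs
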